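/- arXiv:math/0409205 — 3 statements merged into one kernel-verified Lean document; each statement's English description precedes it below -/
import Mathlib

section
/- (Crisp–Paris; the Tits conjecture) Let Γ be a Coxeter graph over a finite set S, let A(Γ) be the associated Artin group with generators {σ_s : s ∈ S}, and associate to each s ∈ S an integer m_s ≥ 2. Let H be the group with generators {T_s : s ∈ S} and defining relations T_s T_t = T_t T_s for every pair s ≠ t with m(s,t) = 2. Then the group homomorphism H → A(Γ) determined by T_s ↦ σ_s^{m_s} is injective; moreover, for s ≠ t the elements σ_s^{m_s} and σ_t^{m_t} commute in A(Γ) if and only if m(s,t) = 2. -/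
/-- The alternating product `prod(x, y; m) = x y x y ⋯` with `m` factors. -/
def altProd {G : Type*} [Monoid G] : G → G → ℕ → G
  | _, _, 0 => 1
  | x, y, m + 1 => x * altProd y x m

/-- Relators of the Artin group `A(Γ)` of a Coxeter graph over `S` with labelling `M`
(where `M s t = 0` encodes the label `∞`, and otherwise `M s t ≥ 2`): for each pair
`s ≠ t` with finite label, the relator `prod(σ_s, σ_t; M s t) · prod(σ_t, σ_s; M s t)⁻¹`. -/
def artinRels (S : Type*) (M : S → S → ℕ) : Set (FreeGroup S) :=
  {w | ∃ s t : S, s ≠ t ∧ M s t ≠ 0 ∧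
        w = altProd (FreeGroup.of s) (FreeGroup.of t) (M s t) *
            (altProd (FreeGroup.of t) (FreeGroup.of s) (M s t))⁻¹}

/-- The Artin group `A(Γ)` associated to the Coxeter graph `Γ` over `S` with labels `M`. -/
abbrev ArtinGroup (S : Type*) (M : S → S → ℕ) : Type _ := PresentedGroup (artinRels S M)

/-- Relators of the group `H`: generators `T_s` with `T_s T_t = T_t T_s`
for every pair `s ≠ t` with `M s t = 2`. -/
def titsRels (S : Type*) (M : S → S → ℕ) : Set (FreeGroup S) :=
  {w | ∃ s t : S, s ≠ t ∧ M s t = 2 ∧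
        w = FreeGroup.of s * FreeGroup.of t * (FreeGroup.of t * FreeGroup.of s)⁻¹}

/-- The group `H` generated by `{T_s : s ∈ S}` with commutation relations for labels `2`. -/
abbrev TitsGroup (S : Type*) (M : S → S → ℕ) : Type _ := PresentedGroup (titsRels S M)

section AltProd

theorem altProd_succ' {G : Type*} [Monoid G] (x y : G) (n : ℕ) :
    altProd x y (n + 1) = altProd x y n * (if n % 2 = 0 then x else y) := by
  induction n generalizing x y with
  | zero => simp [altProd]
  | succ n ih =>
    rw [altProd, ih, altProd, mul_assoc]
    congr 2
    split_ifs <;> first | rfl | omega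

end AltProd

section BraidChain

variable {G : Type*} [Group G]

/-- `τ 0, …, τ (n - 1)` satisfy the braid relations of type `A`. -/
structure IsBraidChain (τ : ℕ → G) (n : ℕ) : Prop where
  braid : ∀ i, i + 1 < n → τ i * τ (i + 1) * τ i = τ (i + 1) * τ i * τ (i + 1)
  comm : ∀ i j, i + 1 < j → j < n → Commute (τ i) (τ j)

/-- The product of the `τ i` with `i + 2 ≤ k` and `i` of the same parity as `k`. -/
def braidLayer (τ : ℕ → G) : ℕ → G
  | 0 => 1
  | 1 => 1
  | k + 2 => braidLayer τ k * τ k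

/-- The product `τ q * τ (q + 2) * ⋯` with `k` factors. -/
def braidStair (τ : ℕ → G) (q : ℕ) : ℕ → G
  | 0 => 1
  | k + 1 => braidStair τ q k * τ (q + 2 * k)

/-- The product `τ (q + j - 1) * ⋯ * τ q` with `j` factors. -/
def braidDesc (τ : ℕ → G) (q : ℕ) : ℕ → G
  | 0 => 1
  | j + 1 => τ (q + j) * braidDesc τ q j

theorem braidDesc_succ' (τ : ℕ → G) (q j : ℕ) :
    braidDesc τ q (j + 1) = braidDesc τ (q + 1) j * τ q := by
  induction j with
  | zero => simp [braidDesc]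
  | succ j ih =>
    rw [braidDesc, ih, braidDesc, mul_assoc, add_right_comm, add_assoc]

theorem braidLayer_add (τ : ℕ → G) (q k : ℕ) :
    braidLayer τ (q + 2 * k) = braidLayer τ q * braidStair τ q k := by
  induction k with
  | zero => simp [braidStair]
  | succ k ih => rw [mul_add, ← add_assoc, mul_one, braidLayer, ih, braidStair, mul_assoc]

namespace IsBraidChain

variable {τ : ℕ → G} {n : ℕ}

theorem mono (h : IsBraidChain τ n) {m : ℕ} (hm : m ≤ n) : IsBraidChain τ m :=
  ⟨fun i hi => h.braid i (by omega), fun i j hij hj => h.comm i j hij (by omega)⟩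

theorem commute_layer (h : IsBraidChain τ n) (q i : ℕ) (hq : q ≤ i) (hi : i < n) :
    Commute (braidLayer τ q) (τ i) := by
  induction q using Nat.twoStepInduction with
  | zero => exact Commute.one_left _
  | one => exact Commute.one_left _
  | more q ih _ => exact (ih (by omega)).mul_left (h.comm _ _ (by omega) hi)

theorem commute_stair (h : IsBraidChain τ n) (q i k : ℕ) (hq : i + 1 < q)
    (hi : q + 2 * k ≤ n + 1) : Commute (τ i) (braidStair τ q k) := by
  induction k with
  | zero => exact Commute.one_right _
  | succ k ih => exact (ih (by omega)).mul_right (h.comm _ _ (by omega) (by omega))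

theorem commute_desc (h : IsBraidChain τ n) (q i j : ℕ) (hq : q + j < i) (hi : i < n) :
    Commute (braidDesc τ q j) (τ i) := by
  induction j with
  | zero => exact Commute.one_left _
  | succ j ih => exact (h.comm _ _ (by omega) hi).mul_left (ih (by omega))

theorem layer_commute_desc (h : IsBraidChain τ n) (q j : ℕ) (hi : q + 1 + j ≤ n) :
    Commute (braidLayer τ q) (braidDesc τ (q + 1) j) := by
  induction j with
  | zero => exact Commute.one_right _
  | succ j ih =>
    exact (h.commute_layer _ _ (by omega) (by omega)).mul_right (ih (by omega))

theorem layer_commute_stair (h : IsBraidChain τ n) (q k : ℕ) (hi : q + 2 * k ≤ n) :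
    Commute (braidLayer τ q) (braidStair τ (q + 1) k) := by
  induction k with
  | zero => exact Commute.one_right _
  | succ k ih =>
    exact (ih (by omega)).mul_right (h.commute_layer _ _ (by omega) (by omega))

theorem desc_mul (h : IsBraidChain τ n) (q i j : ℕ) (hq : q ≤ i) (hi : i + 1 < q + j)
    (hn : q + j ≤ n) : braidDesc τ q j * τ (i + 1) = τ i * braidDesc τ q j := by
  induction j with
  | zero => omega
  | succ j ih =>
    rcases Nat.lt_or_ge (i + 1) (q + j) with hlt | hge
    · rw [braidDesc, mul_assoc, ih hlt (by omega), ← mul_assoc, ← mul_assoc,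
        (h.comm i (q + j) hlt (by omega)).eq]
    · obtain rfl : j = i + 1 - q := by omega
      obtain ⟨l, rfl⟩ := Nat.exists_eq_add_of_le hq
      have e : q + l + 1 - q = l + 1 := by omega
      rw [e] at *
      have hc := h.commute_desc q (q + l + 1) l (by omega) (by omega)
      have hb := h.braid (q + l) (by omega)
      simp only [braidDesc, ← add_assoc]
      rw [mul_assoc, mul_assoc, hc.eq, ← mul_assoc, ← mul_assoc, ← hb]
      simp only [mul_assoc]

theorem desc_mul_stair (h : IsBraidChain τ n) (q j k : ℕ) (hk : 2 * k ≤ j) (hn : q + j ≤ n) :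
    braidDesc τ q j * braidStair τ (q + 1) k = braidStair τ q k * braidDesc τ q j := by
  induction k with
  | zero => simp [braidStair]
  | succ k ih =>
    rw [braidStair, braidStair, ← mul_assoc, ih (by omega), mul_assoc, add_right_comm,
      h.desc_mul q (q + 2 * k) j (by omega) (by omega) hn, mul_assoc]

theorem layer_mul_altProd (h : IsBraidChain τ (n + 1)) (j q : ℕ) (hq : q + j = n + 1) :
    braidLayer τ (n + 1) * altProd (braidLayer τ (n + 2)) (braidLayer τ (n + 1)) j =
      altProd (braidLayer τ (n + 1)) (braidLayer τ n) j * braidLayer τ q * braidDesc τ q j := by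
  induction j generalizing q with
  | zero =>
    obtain rfl : q = n + 1 := by omega
    simp [altProd, braidDesc]
  | succ j ih =>
    have e1 : (if j % 2 = 0 then braidLayer τ (n + 2) else braidLayer τ (n + 1)) =
        braidLayer τ q * τ q * braidStair τ (q + 2) (j / 2) := by
      rw [← braidLayer, ← braidLayer_add]
      split_ifs <;> congr 1 <;> omega
    have e2 : (if j % 2 = 0 then braidLayer τ (n + 1) else braidLayer τ n) =
        braidLayer τ (q + 1) * braidStair τ (q + 1) (j / 2) := by
      rw [← braidLayer_add]
      split_ifs <;> congr 1 <;> omega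
    rw [altProd_succ', altProd_succ', e1, e2, ← mul_assoc, ih (q + 1) (by omega),
      braidDesc_succ']
    have c1 := h.layer_commute_desc q j (by omega)
    have c2 := h.commute_stair (q + 2) q (j / 2) (by omega) (by omega)
    have c3 := h.desc_mul_stair (q + 1) j (j / 2) (by omega) (by omega)
    have c4 := h.layer_commute_stair q (j / 2) (by omega)
    simp only [mul_assoc]
    congr 2
    rw [c2.eq, ← mul_assoc _ (braidLayer τ q), ← c1.eq, mul_assoc, ← mul_assoc _ _ (τ q), c3,
      ← mul_assoc, ← mul_assoc, c4.eq]
    simp only [mul_assoc]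

/-- The alternating products of the two layers of a chain of type `A_n` coincide. -/
theorem altProd_layer (h : IsBraidChain τ n) :
    altProd (braidLayer τ (n + 1)) (braidLayer τ n) (n + 1) =
      altProd (braidLayer τ n) (braidLayer τ (n + 1)) (n + 1) := by
  induction n with
  | zero => simp [altProd, braidLayer]
  | succ n ih =>
    have ih := ih (h.mono (by omega))
    have k0 := h.layer_mul_altProd (n + 1) 0 (by omega)
    have e1 : braidLayer τ (n + 1) * altProd (braidLayer τ (n + 2)) (braidLayer τ (n + 1)) (n + 1) =
        altProd (braidLayer τ (n + 1)) (braidLayer τ (n + 2)) (n + 2) := rfl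
    have e2 : (if (n + 1) % 2 = 0 then braidLayer τ (n + 2) else braidLayer τ (n + 1)) =
        braidStair τ 1 ((n + 1) / 2) := by
      have := braidLayer_add τ 1 ((n + 1) / 2)
      rw [braidLayer, one_mul] at this
      rw [← this]
      split_ifs <;> congr 1 <;> omega
    have e3 : (if (n + 1) % 2 = 0 then braidLayer τ (n + 1) else braidLayer τ n) =
        braidStair τ 0 ((n + 1) / 2) := by
      have := braidLayer_add τ 0 ((n + 1) / 2)
      rw [braidLayer, one_mul] at this
      rw [← this]
      split_ifs <;> congr 1 <;> omega
    have c3 := h.desc_mul_stair 0 (n + 1) ((n + 1) / 2) (by omega) (by omega)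
    rw [zero_add] at c3
    have k1 : braidLayer τ (n + 1) *
          altProd (braidLayer τ (n + 2)) (braidLayer τ (n + 1)) (n + 2) =
        altProd (braidLayer τ (n + 1)) (braidLayer τ n) (n + 2) * braidDesc τ 0 (n + 1) := by
      rw [altProd_succ', altProd_succ' _ (braidLayer τ n), e2, e3, ← mul_assoc, k0, braidLayer, mul_one, mul_assoc, c3,
        mul_assoc]
    rw [show altProd (braidLayer τ (n + 1)) (braidLayer τ n) (n + 2) = braidLayer τ (n + 1) *
      altProd (braidLayer τ n) (braidLayer τ (n + 1)) (n + 1) from rfl, mul_assoc,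
      mul_right_inj, ← ih] at k1
    rw [k1, ← e1, k0, braidLayer, mul_one]

end IsBraidChain

end BraidChain

section Shear

open FreeGroup

variable {α : Type*}

theorem FreeGroup.IsReduced.append_singleton {L : List (α × Bool)} {x : α × Bool}
    (hL : IsReduced L) (h : ∀ y ∈ L.getLast?, y.1 = x.1 → y.2 = x.2) : IsReduced (L ++ [x]) :=
  List.IsChain.append hL (.singleton x) fun y hy z hz => by
    simp only [List.head?_cons, Option.mem_some_iff] at hz
    exact hz ▸ h y hy

theorem FreeGroup.mk_mem_closure_image {Λ : Set α} {L : List (α × Bool)}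
    (h : ∀ x ∈ L, x.1 ∈ Λ) : mk L ∈ Subgroup.closure (of '' Λ) := by
  induction L with
  | nil => exact one_mem _
  | cons x L ih =>
    rw [List.forall_mem_cons] at h
    rw [← List.singleton_append, ← mul_mk]
    refine mul_mem ?_ (ih h.2)
    obtain ⟨a, b⟩ := x
    have ha : of a ∈ Subgroup.closure (of '' Λ) := Subgroup.subset_closure ⟨a, h.1, rfl⟩
    cases b
    · have := inv_mem ha
      rwa [of, inv_mk] at this
    · exact ha

theorem FreeGroup.mem_of_mem_toWord [DecidableEq α] {Λ : Set α} {g : FreeGroup α}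
    (hg : g ∈ Subgroup.closure (of '' Λ)) : ∀ x ∈ g.toWord, x.1 ∈ Λ := by
  induction hg using Subgroup.closure_induction with
  | mem g hg =>
    obtain ⟨a, ha, rfl⟩ := hg
    simpa using ha
  | one => simp
  | mul g h _ _ hg hh =>
    intro x hx
    have := (toWord_mul_sublist g h).subset hx
    rw [List.mem_append] at this
    exact this.elim (hg x) (hh x)
  | inv g _ hg =>
    intro x hx
    simp only [toWord_inv, invRev, List.mem_reverse, List.mem_map] at hx
    obtain ⟨y, hy, rfl⟩ := hx
    exact hg y hy

/-- `T` fixes the generators in `Λ` and multiplies every other generator `z` on the right by an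
element `γ z` of the subgroup generated by `Λ`. -/
structure IsShear (T : FreeGroup α →* FreeGroup α) (Λ : Set α) (γ : α → FreeGroup α) : Prop where
  fix : ∀ z ∈ Λ, T (of z) = of z
  mul : ∀ z ∉ Λ, T (of z) = of z * γ z
  mem : ∀ z, γ z ∈ Subgroup.closure (of '' Λ)

namespace IsShear

variable {T : FreeGroup α →* FreeGroup α} {Λ : Set α} {γ : α → FreeGroup α}

theorem fix_of_mem_closure (h : IsShear T Λ γ) {g : FreeGroup α}
    (hg : g ∈ Subgroup.closure (of '' Λ)) : T g = g := by
  induction hg using Subgroup.closure_induction with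
  | mem g hg =>
    obtain ⟨a, ha, rfl⟩ := hg
    exact h.fix a ha
  | one => exact _root_.map_one T
  | mul g k _ _ hg hk => rw [_root_.map_mul, hg, hk]
  | inv g _ hg => rw [_root_.map_inv, hg]

theorem apply_letter (h : IsShear T Λ γ) {z : α} (hz : z ∉ Λ) (b : Bool) :
    T (FreeGroup.mk [(z, b)]) = (if b then 1 else (γ z)⁻¹) * FreeGroup.mk [(z, b)] * (if b then γ z else 1) := by
  cases b
  · have : (FreeGroup.mk [(z, false)] : FreeGroup α) = (of z)⁻¹ := by rw [of, inv_mk]; rfl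
    simp [this, h.mul z hz]
  · rw [if_pos rfl, if_pos rfl, one_mul]
    exact h.mul z hz

variable [DecidableEq α]

theorem exists_decomp (h : IsShear T Λ γ) (L : List (α × Bool)) (hL : IsReduced L) :
    ∃ (K Y K' : List (α × Bool)) (g : FreeGroup α), L = K ++ Y ∧ (∀ y ∈ Y, y.1 ∈ Λ) ∧
      T (FreeGroup.mk K) = FreeGroup.mk K' * g ∧ IsReduced K' ∧ g ∈ Subgroup.closure (of '' Λ) ∧
      ((K = [] ∧ K' = []) ∨ ∃ z b K₀ K₀', z ∉ Λ ∧ K = K₀ ++ [(z, b)] ∧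
        K' = K₀' ++ [(z, b)] ∧ g = if b then γ z else 1) := by
  induction L using List.reverseRecOn with
  | nil => exact ⟨[], [], [], 1, rfl, by simp, by simp [← one_eq_mk], .nil, one_mem _, .inl ⟨rfl, rfl⟩⟩
  | append_singleton L x ih =>
    obtain ⟨z, b⟩ := x
    obtain ⟨K, Y, K', g, rfl, hY, hT, hK', hg, hK⟩ := ih (hL.infix (List.prefix_append _ _).isInfix)
    by_cases hz : z ∈ Λ
    · refine ⟨K, Y ++ [(z, b)], K', g, by simp, ?_, hT, hK', hg, hK⟩
      intro y hy
      rw [List.mem_append, List.mem_singleton] at hy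
      exact hy.elim (hY y) fun hy => hy ▸ hz
    · have hYc := mk_mem_closure_image hY
      set y := g * FreeGroup.mk Y * (if b then 1 else (γ z)⁻¹) with hy
      have hyc : y ∈ Subgroup.closure (of '' Λ) := by
        refine mul_mem (mul_mem hg hYc) ?_
        cases b
        · exact inv_mem (h.mem z)
        · exact one_mem _
      have hyw := mem_of_mem_toWord hyc
      refine ⟨K ++ Y ++ [(z, b)], [], K' ++ y.toWord ++ [(z, b)], if b then γ z else 1, by simp,
        by simp, ?_, ?_, ?_, .inr ⟨z, b, _, _, hz, rfl, rfl, rfl⟩⟩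
      · rw [← mul_mk, ← mul_mk, _root_.map_mul, _root_.map_mul, hT, h.fix_of_mem_closure hYc,
          h.apply_letter hz, ← mul_mk, ← mul_mk, mk_toWord, hy]
        simp only [mul_assoc]
      · by_cases hy1 : y = 1
        · rw [hy1, toWord_one, List.append_nil]
          refine hK'.append_singleton fun x hx hxz => ?_
          rcases hK with ⟨rfl, rfl⟩ | ⟨z', b', K₀, K₀', hz', rfl, rfl, rfl⟩
          · simp at hx
          · simp only [List.getLast?_append, List.getLast?_singleton, Option.some_or,
              Option.mem_some_iff] at hx
            subst hx
            simp only at hxz ⊢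
            subst hxz
            by_contra hb
            have hY1 : FreeGroup.mk Y = 1 := by
              rw [hy1] at hy
              cases b <;> cases b' <;> simp at hb hy ⊢
              · rw [eq_comm, mul_inv_eq_one, mul_eq_left] at hy
                exact hy
              · exact hy.symm
            have hYnil : Y = [] := by
              have := (hL.infix (L₁ := Y) ⟨K₀ ++ [(z', b')], [(z', b)], rfl⟩).reduce_eq
              rw [← this, ← toWord_mk, hY1, toWord_one]
            rw [hYnil] at hL
            have := hL.infix (L₁ := [(z', b'), (z', b)]) ⟨K₀, [], by simp⟩
            simp [FreeGroup.IsReduced] at this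
            exact hb this
        · have hne : y.toWord ≠ [] := by rwa [Ne, toWord_eq_nil_iff]
          refine FreeGroup.IsReduced.append_singleton ?_ fun x hx hxz => ?_
          · refine List.IsChain.append hK' isReduced_toWord fun x hx x' hx' hxx => ?_
            rcases hK with ⟨rfl, rfl⟩ | ⟨z', b', K₀, K₀', hz', rfl, rfl, rfl⟩
            · simp at hx
            · simp only [List.getLast?_append, List.getLast?_singleton, Option.some_or,
                Option.mem_some_iff] at hx
              subst hx
              exact absurd (hyw x' (List.mem_of_mem_head? hx')) (hxx ▸ hz')
          · rw [List.getLast?_append_of_ne_nil _ hne] at hx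
            exact absurd (hyw x (List.mem_of_mem_getLast? hx)) (hxz ▸ hz)
      · cases b
        · exact one_mem _
        · exact h.mem z

theorem exists_append_singleton (h : IsShear T Λ γ) {L : List (α × Bool)} {z : α} {b : Bool}
    (hL : IsReduced (L ++ [(z, b)])) (hz : z ∉ Λ) :
    ∃ L', FreeGroup.IsReduced (L' ++ [(z, b)]) ∧
      T (FreeGroup.mk (L ++ [(z, b)])) = FreeGroup.mk (L' ++ [(z, b)]) * if b then γ z else 1 := by
  obtain ⟨K, Y, K', g, hKY, hY, hT, hK', -, hK⟩ := h.exists_decomp _ hL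
  obtain rfl : Y = [] := by
    rcases List.eq_nil_or_concat Y with rfl | ⟨Y, y, rfl⟩
    · rfl
    · rw [List.concat_eq_append, ← List.append_assoc] at hKY
      have := (List.append_inj' hKY rfl).2
      simp only [List.cons.injEq, and_true] at this
      exact absurd (hY y (by simp)) (this ▸ hz)
  rw [List.append_nil] at hKY
  rcases hK with ⟨rfl, rfl⟩ | ⟨z', b', K₀, K₀', hz', rfl, rfl, rfl⟩
  · simp at hKY
  · obtain ⟨rfl, h2⟩ := List.append_inj' hKY rfl
    simp only [List.cons.injEq, and_true, Prod.mk.injEq] at h2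
    obtain ⟨rfl, rfl⟩ := h2
    exact ⟨K₀', hK', hT⟩

theorem infix_toWord (h : IsShear T Λ γ) {v : FreeGroup α} {x y : α} (hx : x ∉ Λ) (hy : y ∉ Λ)
    (hv : [(x, true), (y, true)] <:+: v.toWord) :
    (x, true) :: (γ x).toWord ++ [(y, true)] <:+: (T v).toWord := by
  obtain ⟨p, q, hpq⟩ := hv
  have hred : IsReduced v.toWord := isReduced_toWord
  obtain ⟨P, hP, hTP⟩ := h.exists_append_singleton (L := p) (b := true)
    (hred.infix ⟨[], (y, true) :: q, by simp [← hpq]⟩) hx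
  have hyq : IsReduced ((y, true) :: q) := hred.infix ⟨p ++ [(x, true)], [], by simp [← hpq]⟩
  have hinv : invRev ((y, true) :: q) = invRev q ++ [(y, false)] := by simp [invRev]
  obtain ⟨Q, hQ, hTQ⟩ := h.exists_append_singleton (L := invRev q) (b := false)
    (by rw [← hinv, isReduced_iff_reduce_eq, reduce_invRev, hyq.reduce_eq]) hy
  have hQ' : IsReduced ((y, true) :: invRev Q) := by
    have : (y, true) :: invRev Q = invRev (Q ++ [(y, false)]) := by simp [invRev]
    rw [this, isReduced_iff_reduce_eq, reduce_invRev, hQ.reduce_eq]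
  have hTQ' : T (FreeGroup.mk ((y, true) :: q)) = FreeGroup.mk ((y, true) :: invRev Q) := by
    rw [← hinv, ← inv_mk, _root_.map_inv] at hTQ
    rw [← inv_inj, hTQ]
    rw [if_neg (by simp), mul_one, inv_mk]
    congr 1
    simp [invRev, Function.comp_def]
  have hγ := mem_of_mem_toWord (h.mem x)
  have hTv : T v = FreeGroup.mk (P ++ [(x, true)] ++ (γ x).toWord ++ (y, true) :: invRev Q) := by
    rw [← mul_mk, ← mul_mk, mk_toWord, ← hTQ', ← mk_toWord (x := v), ← hpq,
      show p ++ [(x, true), (y, true)] ++ q = (p ++ [(x, true)]) ++ (y, true) :: q by simp,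
      ← mul_mk, _root_.map_mul, hTP]
    simp
  have hred' : IsReduced (P ++ [(x, true)] ++ (γ x).toWord ++ (y, true) :: invRev Q) := by
    refine List.IsChain.append (List.IsChain.append hP isReduced_toWord ?_) hQ' ?_
    · intro a ha b hb hab
      simp only [List.getLast?_append, List.getLast?_singleton, Option.some_or,
        Option.mem_some_iff] at ha
      subst ha
      exact absurd (hγ b (List.mem_of_mem_head? hb)) (hab ▸ hx)
    · intro a ha b hb hab
      simp only [List.head?_cons, Option.mem_some_iff] at hb
      subst hb
      by_cases hne : (γ x).toWord = []
      · simp only [hne, List.append_nil, List.getLast?_append, List.getLast?_singleton,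
          Option.some_or, Option.mem_some_iff] at ha
        subst ha
        rfl
      · rw [List.getLast?_append_of_ne_nil _ hne] at ha
        exact absurd (hγ a (List.mem_of_mem_getLast? ha)) (hab ▸ hy)
  rw [hTv, toWord_mk, hred'.reduce_eq]
  exact ⟨P, invRev Q, by simp⟩

end IsShear

end Shear

section Twist

open FreeGroup

/-- The combinatorial data defining Dehn twists along a system of circles indexed by `V`: the
intersection graph of the circles, an orientation sign for every circle, and, for every `v`, the
cyclic order on `V` cut open right after `v`. -/
structure TwistData (V : Type*) where
  graph : SimpleGraph V
  sign : V → ℤ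
  sign_eq : ∀ v, sign v = 1 ∨ sign v = -1
  rot : V → List V
  rot_split : ∀ s t, ∃ P B, rot s = P ++ t :: B ∧ rot t = B ++ P ++ [t] ∧ t ∉ P ∧ t ∉ B

namespace TwistData

variable {V : Type*} (D : TwistData V)

/-- The loop running once around the circle `r`, based at the position `c`. -/
def loop (r c : V) : FreeGroup (V × V) := ((D.rot c).map fun q => of (r, q)).prod

open Classical in
/-- The factor by which the `k`-th power of the multi-twist along `A` changes a generator. -/
noncomputable def shift (A : Set V) (k : ℤ) (z : V × V) : FreeGroup (V × V) :=
  if z.2 ∈ A ∧ D.graph.Adj z.1 z.2 then D.loop z.2 z.1 ^ (D.sign z.2 * k) else 1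

/-- The `k`-th power of the multi-twist along `A`, as an endomorphism. -/
noncomputable def twistHom (A : Set V) (k : ℤ) : FreeGroup (V × V) →* FreeGroup (V × V) :=
  FreeGroup.lift fun z => of z * D.shift A k z

@[simp]
theorem twistHom_of (A : Set V) (k : ℤ) (z : V × V) :
    D.twistHom A k (of z) = of z * D.shift A k z := by
  simp [twistHom]

theorem shift_of_not {A : Set V} {k : ℤ} {z : V × V} (h : ¬(z.2 ∈ A ∧ D.graph.Adj z.1 z.2)) :
    D.shift A k z = 1 := by
  rw [shift, if_neg h]

theorem shift_of_mem {A : Set V} {k : ℤ} {c r : V} (h : r ∈ A) (h' : D.graph.Adj c r) :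
    D.shift A k (c, r) = D.loop r c ^ (D.sign r * k) := by
  rw [shift, if_pos ⟨h, h'⟩]

theorem shift_congr {A B : Set V} {k : ℤ} {z : V × V} (h : z.2 ∈ A ↔ z.2 ∈ B) :
    D.shift A k z = D.shift B k z := by
  by_cases hz : z.2 ∈ A ∧ D.graph.Adj z.1 z.2
  · rw [shift, shift, if_pos hz, if_pos ⟨h.1 hz.1, hz.2⟩]
  · rw [D.shift_of_not hz, D.shift_of_not fun h' => hz ⟨h.2 h'.1, h'.2⟩]

theorem shift_add (A : Set V) (k l : ℤ) (z : V × V) :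
    D.shift A (k + l) z = D.shift A k z * D.shift A l z := by
  unfold shift
  split_ifs
  · rw [mul_add, zpow_add]
  · simp

theorem loop_mem_closure (r c : V) :
    D.loop r c ∈ Subgroup.closure (of '' {z : V × V | z.1 = r}) := by
  refine list_prod_mem fun x hx => ?_
  obtain ⟨q, -, rfl⟩ := List.mem_map.1 hx
  exact Subgroup.subset_closure ⟨(r, q), rfl, rfl⟩

theorem shift_mem_closure_fst (A : Set V) (k : ℤ) (z : V × V) :
    D.shift A k z ∈ Subgroup.closure (of '' {y : V × V | y.1 = z.2}) := by
  by_cases h : z.2 ∈ A ∧ D.graph.Adj z.1 z.2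
  · rw [D.shift_of_mem h.1 h.2]
    exact zpow_mem (D.loop_mem_closure _ _) _
  · rw [D.shift_of_not h]
    exact one_mem _

theorem shift_mem_closure (A : Set V) (k : ℤ) (z : V × V) :
    D.shift A k z ∈ Subgroup.closure (of '' {y : V × V | y.1 ∈ A}) := by
  by_cases h : z.2 ∈ A
  · refine Subgroup.closure_mono (Set.image_mono ?_) (D.shift_mem_closure_fst A k z)
    rintro y (hy : y.1 = z.2)
    exact Set.mem_of_eq_of_mem (s := A) hy h
  · rw [D.shift_of_not fun h' => h h'.1]
    exact one_mem _

theorem shift_eq_one {A : Set V} (hA : D.graph.IsIndepSet A) {k : ℤ} {z : V × V}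
    (hz : z.1 ∈ A) : D.shift A k z = 1 :=
  D.shift_of_not fun h => hA hz h.1 h.2.ne h.2

open Classical in
theorem isShear {A : Set V} (hA : D.graph.IsIndepSet A) (k : ℤ) :
    IsShear (D.twistHom A k) {z | z.1 ∈ A} (D.shift A k) where
  fix z hz := by rw [twistHom_of, D.shift_eq_one hA hz, mul_one]
  mul z _ := D.twistHom_of A k z
  mem z := D.shift_mem_closure A k z

theorem twistHom_twistHom {A : Set V} (hA : D.graph.IsIndepSet A) (k l : ℤ)
    (x : FreeGroup (V × V)) : D.twistHom A k (D.twistHom A l x) = D.twistHom A (k + l) x := by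
  rw [← MonoidHom.comp_apply]
  congr 1
  refine FreeGroup.ext_hom _ _ fun z => ?_
  rw [MonoidHom.comp_apply, twistHom_of, _root_.map_mul,
    (D.isShear hA k).fix_of_mem_closure (D.shift_mem_closure A l z), twistHom_of, twistHom_of,
    shift_add, mul_assoc]

theorem twistHom_zero (A : Set V) (x : FreeGroup (V × V)) : D.twistHom A 0 x = x := by
  conv_rhs => rw [← MonoidHom.id_apply _ x]
  congr 1
  refine FreeGroup.ext_hom _ _ fun z => ?_
  rw [twistHom_of, shift]
  simp

theorem twistHom_empty (k : ℤ) (x : FreeGroup (V × V)) : D.twistHom ∅ k x = x := by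
  conv_rhs => rw [← MonoidHom.id_apply _ x]
  congr 1
  refine FreeGroup.ext_hom _ _ fun z => ?_
  rw [twistHom_of, D.shift_of_not (A := ∅) fun h => h.1, mul_one, MonoidHom.id_apply]

/-- The multi-twist along an independent set of circles. -/
noncomputable def twist {A : Set V} (hA : D.graph.IsIndepSet A) : MulAut (FreeGroup (V × V)) :=
  MonoidHom.toMulEquiv (D.twistHom A 1) (D.twistHom A (-1))
    (by ext; simp only [MonoidHom.comp_apply, D.twistHom_twistHom hA]; exact D.twistHom_zero _ _)
    (by ext; simp only [MonoidHom.comp_apply, D.twistHom_twistHom hA]; exact D.twistHom_zero _ _)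

theorem twist_apply {A : Set V} (hA : D.graph.IsIndepSet A) (x : FreeGroup (V × V)) :
    D.twist hA x = D.twistHom A 1 x := rfl

theorem twist_inv_apply {A : Set V} (hA : D.graph.IsIndepSet A) (x : FreeGroup (V × V)) :
    (D.twist hA)⁻¹ x = D.twistHom A (-1) x := rfl

theorem twist_zpow_apply {A : Set V} (hA : D.graph.IsIndepSet A) (k : ℤ)
    (x : FreeGroup (V × V)) : (D.twist hA ^ k) x = D.twistHom A k x := by
  induction k generalizing x with
  | zero => simp [D.twistHom_zero]
  | succ k ih => rw [zpow_add_one, MulAut.mul_apply, ih, twist_apply, D.twistHom_twistHom hA]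
  | pred k ih =>
    rw [zpow_sub_one, MulAut.mul_apply, ih, twist_inv_apply, D.twistHom_twistHom hA, sub_eq_add_neg]

theorem twistHom_union {A B : Set V} (hAB : D.graph.IsIndepSet (A ∪ B)) (hd : Disjoint A B)
    (k : ℤ) (x : FreeGroup (V × V)) :
    D.twistHom (A ∪ B) k x = D.twistHom A k (D.twistHom B k x) := by
  rw [← MonoidHom.comp_apply]
  congr 1
  refine FreeGroup.ext_hom _ _ fun z => ?_
  have hB : D.twistHom A k (D.shift B k z) = D.shift B k z := by
    by_cases h : z.2 ∈ B
    · have := D.shift_mem_closure_fst B k z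
      generalize D.shift B k z = g at this
      induction this using Subgroup.closure_induction with
      | mem g hg =>
        obtain ⟨y, hy, rfl⟩ := hg
        rw [twistHom_of, D.shift_of_not, mul_one]
        rintro ⟨h1, h2⟩
        refine hAB (.inr ?_) (.inl h1) h2.ne h2
        rwa [show y.1 = z.2 from hy]
      | one => exact _root_.map_one _
      | mul g k _ _ hg hk => rw [_root_.map_mul, hg, hk]
      | inv g _ hg => rw [_root_.map_inv, hg]
    · rw [D.shift_of_not fun h' => h h'.1, _root_.map_one]
  rw [MonoidHom.comp_apply, twistHom_of, twistHom_of, _root_.map_mul, hB, twistHom_of, mul_assoc]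
  congr 1
  by_cases hz : z.2 ∈ B
  · have hzA : z.2 ∉ A := fun h => hd.le_bot ⟨h, hz⟩
    rw [D.shift_of_not (A := A) fun h => hzA h.1, one_mul]
    exact D.shift_congr ⟨fun _ => hz, .inr⟩
  · rw [D.shift_of_not (A := B) fun h => hz h.1, mul_one]
    exact D.shift_congr ⟨fun h => h.resolve_right hz, .inl⟩

theorem twist_union {A B : Set V} (hAB : D.graph.IsIndepSet (A ∪ B)) (hd : Disjoint A B)
    (hA : D.graph.IsIndepSet A) (hB : D.graph.IsIndepSet B) :
    D.twist hAB = D.twist hA * D.twist hB :=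
  MulEquiv.ext fun x => D.twistHom_union hAB hd 1 x

theorem commute_twist {A B : Set V} (hAB : D.graph.IsIndepSet (A ∪ B)) (hd : Disjoint A B)
    (hA : D.graph.IsIndepSet A) (hB : D.graph.IsIndepSet B) :
    Commute (D.twist hA) (D.twist hB) := by
  rw [Commute, SemiconjBy, ← D.twist_union hAB hd, ← D.twist_union (by rwa [Set.union_comm]) hd.symm]
  congr 1
  exact Set.union_comm A B

theorem twistHom_of_singleton (t c : V) (ε : ℤ) : D.twistHom {t} ε (of (t, c)) = of (t, c) :=
  (D.isShear (Set.pairwise_singleton _ _) ε).fix _ rfl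

theorem twistHom_singleton_of_ne {t r : V} (h : r ≠ t) (c : V) (ε : ℤ) :
    D.twistHom {t} ε (of (c, r)) = of (c, r) := by
  rw [twistHom_of, D.shift_of_not fun h' => h h'.1, mul_one]

theorem twistHom_singleton_of_adj {t c : V} (h : D.graph.Adj c t) (ε : ℤ) :
    D.twistHom {t} ε (of (c, t)) = of (c, t) * D.loop t c ^ (D.sign t * ε) := by
  rw [twistHom_of, D.shift_of_mem (Set.mem_singleton _) h]

theorem twistHom_loop_of_adj {t t' : V} (h : D.graph.Adj t t') (c : V) (ε : ℤ) :
    ∃ p b : FreeGroup (V × V), D.loop t c = p * of (t, t') * b ∧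
      D.loop t t' = b * p * of (t, t') ∧
      (∀ δ, D.twistHom {t} δ p = p) ∧ (∀ δ, D.twistHom {t} δ b = b) ∧
      D.twistHom {t'} ε p = p ∧ D.twistHom {t'} ε b = b := by
  obtain ⟨P, B, h1, h2, h3, h4⟩ := D.rot_split c t'
  have key (r : V) (ε : ℤ) (L : List V) (hL : r ∉ L ∨ r = t) :
      D.twistHom {r} ε (L.map fun q => of (t, q)).prod = (L.map fun q => of (t, q)).prod := by
    rw [map_list_prod, List.map_map]
    congr 1
    refine List.map_congr_left fun q hq => ?_
    rcases hL with hL | rfl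
    · exact D.twistHom_singleton_of_ne (fun e : q = r => hL (e ▸ hq)) t ε
    · exact D.twistHom_of_singleton r q ε
  refine ⟨(P.map fun q => of (t, q)).prod, (B.map fun q => of (t, q)).prod, ?_, ?_,
    fun δ => key t δ P (.inr rfl), fun δ => key t δ B (.inr rfl), key t' ε P (.inl h3),
    key t' ε B (.inl h4)⟩
  · simp [loop, h1, mul_assoc]
  · simp [loop, h2, mul_assoc]

theorem twistHom_braid_of {t t' : V} (h : D.graph.Adj t t') (hs : D.sign t' = -D.sign t) (c : V) :
    D.twistHom {t} 1 (D.twistHom {t'} 1 (D.twistHom {t} 1 (of (c, t)))) =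
      D.twistHom {t'} 1 (D.twistHom {t} 1 (D.twistHom {t'} 1 (of (c, t)))) := by
  have h0 := D.twistHom_singleton_of_ne h.ne c 1
  by_cases hc : D.graph.Adj c t
  · have h1 := D.twistHom_singleton_of_adj hc 1
    obtain ⟨p, b, e1, e2, e3, e4, e5, e6⟩ := D.twistHom_loop_of_adj h c 1
    obtain ⟨p', b', -, f2, -, -, f5, f6⟩ := D.twistHom_loop_of_adj h.symm t' 1
    have h2 := D.twistHom_singleton_of_adj h 1
    have h3 := D.twistHom_singleton_of_adj h.symm 1
    have h4 : D.twistHom {t} 1 (D.loop t' t) = D.loop t' t * D.loop t t' ^ D.sign t := by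
      rw [f2, _root_.map_mul, _root_.map_mul, f5, f6, h3, mul_one, mul_assoc _ _ (_ ^ _)]
    have h5 := D.twistHom_of_singleton t t' 1
    simp only [h0, h1, h2, hs, e1, e3, e4, e5, e6, h5, h4, mul_one, _root_.map_mul,
      map_zpow]
    rw [e2]
    rcases D.sign_eq t with hε | hε <;> rw [hε] <;> simp <;> group
  · have h1 : D.twistHom {t} 1 (of (c, t)) = of (c, t) := by
      rw [twistHom_of, D.shift_of_not, mul_one]
      exact fun h' => hc h'.2
    simp only [h0, h1]

theorem isIndepSet_singleton (t : V) : D.graph.IsIndepSet {t} := Set.pairwise_singleton _ _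

theorem twist_braid {t t' : V} (h : D.graph.Adj t t') (hs : D.sign t' = -D.sign t) :
    D.twist (D.isIndepSet_singleton t) * D.twist (D.isIndepSet_singleton t') *
        D.twist (D.isIndepSet_singleton t) =
      D.twist (D.isIndepSet_singleton t') * D.twist (D.isIndepSet_singleton t) *
        D.twist (D.isIndepSet_singleton t') := by
  refine MulEquiv.ext fun x => ?_
  change ((D.twistHom {t} 1).comp ((D.twistHom {t'} 1).comp (D.twistHom {t} 1))) x =
    ((D.twistHom {t'} 1).comp ((D.twistHom {t} 1).comp (D.twistHom {t'} 1))) x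
  congr 1
  refine FreeGroup.ext_hom _ _ fun ⟨c, r⟩ => ?_
  simp only [MonoidHom.comp_apply]
  by_cases hr : r = t
  · subst hr
    exact D.twistHom_braid_of h hs c
  by_cases hr' : r = t'
  · subst hr'
    exact (D.twistHom_braid_of h.symm (by rw [hs, neg_neg]) c).symm
  simp only [D.twistHom_singleton_of_ne hr, D.twistHom_singleton_of_ne hr']

/-- On the subgroup attached to a set `J` of circles which is closed under adjacency with `A`, the
multi-twists along `A` and `A ∩ J` agree. -/
theorem twistHom_inter {A J : Set V} (hJ : ∀ c ∈ J, ∀ r ∈ A, D.graph.Adj c r → r ∈ J) (k : ℤ)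
    {x : FreeGroup (V × V)}
    (hx : x ∈ Subgroup.closure (of '' {z : V × V | z.1 ∈ J ∨ z.2 ∈ J})) :
    D.twistHom A k x = D.twistHom (A ∩ J) k x ∧
      D.twistHom A k x ∈ Subgroup.closure (of '' {z : V × V | z.1 ∈ J ∨ z.2 ∈ J}) := by
  induction hx using Subgroup.closure_induction with
  | mem g hg =>
    obtain ⟨⟨c, r⟩, hz, rfl⟩ := hg
    have hz' := Subgroup.subset_closure (Set.mem_image_of_mem of hz)
    rw [twistHom_of, twistHom_of]
    by_cases hr : r ∈ A ∧ D.graph.Adj c r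
    · have hrJ : r ∈ J := hz.elim (fun hc => hJ c hc r hr.1 hr.2) id
      rw [D.shift_of_mem hr.1 hr.2, D.shift_of_mem (A := A ∩ J) ⟨hr.1, hrJ⟩ hr.2]
      refine ⟨rfl, mul_mem hz' (zpow_mem (Subgroup.closure_mono (Set.image_mono ?_)
        (D.loop_mem_closure r c)) _)⟩
      rintro y (hy : y.1 = r)
      exact .inl (by rwa [hy])
    · rw [D.shift_of_not hr, D.shift_of_not (A := A ∩ J) fun h => hr ⟨h.1.1, h.2⟩, mul_one]
      exact ⟨rfl, hz'⟩
  | one => simp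
  | mul g k _ _ hg hk =>
    rw [_root_.map_mul, _root_.map_mul, ← hg.1, ← hk.1]
    exact ⟨rfl, mul_mem hg.2 hk.2⟩
  | inv g _ hg =>
    rw [_root_.map_inv, _root_.map_inv, ← hg.1]
    exact ⟨rfl, inv_mem hg.2⟩

end TwistData

end Twist

section PingPong

open FreeGroup

theorem FreeGroup.isReduced_of_forall_snd {α : Type*} {L : List (α × Bool)}
    (h : ∀ x ∈ L, x.2 = true) : FreeGroup.IsReduced L :=
  List.Pairwise.isChain <| List.pairwise_iff_forall_sublist.2 fun {a b} hab _ => by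
    rw [h a (hab.subset (by simp)), h b (hab.subset (by simp))]

theorem FreeGroup.invRev_infix {α : Type*} {L L' : List (α × Bool)} (h : L <:+: L') :
    invRev L <:+: invRev L' := by
  obtain ⟨p, q, rfl⟩ := h
  exact ⟨invRev q, invRev p, by simp [invRev]⟩

theorem FreeGroup.exists_mk_pow {α : Type*} (L : List (α × Bool)) (n : ℕ) :
    ∃ L' : List (α × Bool), mk L ^ (n + 2) = mk (L ++ L ++ L') ∧ ∀ x ∈ L', x ∈ L := by
  induction n with
  | zero => exact ⟨[], by rw [pow_two, mul_mk, List.append_nil], by simp⟩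
  | succ n ih =>
    obtain ⟨L', h1, h2⟩ := ih
    refine ⟨L' ++ L, by rw [pow_succ, h1, mul_mk, List.append_assoc], fun x hx => ?_⟩
    exact (List.mem_append.1 hx).elim (h2 x) id

namespace TwistData

variable {V : Type*} [DecidableEq V] (D : TwistData V)

/-- The elements whose reduced word, or that of the inverse, runs positively through every position
of the circle `s`. -/
def wraps (s : V) : Set (FreeGroup (V × V)) :=
  {v | ∀ r, ∃ r', [((s, r), true), ((s, r'), true)] <:+: v.toWord ∨
    [((s, r), true), ((s, r'), true)] <:+: v⁻¹.toWord}

theorem inv_mem_wraps {s : V} {v : FreeGroup (V × V)} : v⁻¹ ∈ wraps s ↔ v ∈ wraps s := by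
  refine forall_congr' fun r => exists_congr fun r' => ?_
  rw [inv_inv, or_comm]

theorem exists_toWord_loop_pow (r c : V) (n : ℕ) :
    ∃ L : List V, (D.loop r c ^ (n + 2)).toWord =
      (D.rot c ++ D.rot c ++ L).map fun q => ((r, q), true) := by
  have hl : D.loop r c = FreeGroup.mk ((D.rot c).map fun q => ((r, q), true)) := by
    unfold loop
    induction D.rot c with
    | nil => rfl
    | cons q L ih => rw [List.map_cons, List.prod_cons, ih, List.map_cons, of, mul_mk]; rfl
  obtain ⟨L', h1, h2⟩ := exists_mk_pow ((D.rot c).map fun q => ((r, q), true)) n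
  obtain ⟨L, rfl⟩ : ∃ L : List V, L' = L.map fun q => ((r, q), true) := by
    refine ⟨L'.map fun x => x.1.2, ?_⟩
    rw [List.map_map]
    refine (Eq.trans (List.map_congr_left fun x hx => ?_) (List.map_id L')).symm
    obtain ⟨q, -, rfl⟩ := List.mem_map.1 (h2 x hx)
    rfl
  refine ⟨L, ?_⟩
  rw [hl, h1, ← List.map_append, ← List.map_append, toWord_mk, FreeGroup.IsReduced.reduce_eq]
  refine isReduced_of_forall_snd fun x hx => ?_
  obtain ⟨q, -, rfl⟩ := List.mem_map.1 hx
  rfl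

theorem mem_wraps_of_pow {r c : V} {n : ℕ} {v : FreeGroup (V × V)}
    (hv : (D.loop r c ^ (n + 2)).toWord <:+: v.toWord) : v ∈ wraps r := by
  intro q
  obtain ⟨L, hL⟩ := D.exists_toWord_loop_pow r c n
  obtain ⟨P, B, h, -⟩ := D.rot_split c q
  obtain ⟨q', R, hR⟩ : ∃ q' R, B ++ (P ++ q :: (B ++ L)) = q' :: R := by
    rcases hB : B ++ (P ++ q :: (B ++ L)) with - | ⟨q', R⟩
    · simp at hB
    · exact ⟨q', R, rfl⟩
  refine ⟨q', .inl (List.IsInfix.trans ?_ (hL ▸ hv))⟩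
  have : D.rot c ++ D.rot c ++ L = P ++ [q, q'] ++ R := by
    simp only [h, List.append_assoc, List.cons_append, List.nil_append, ← hR]
  rw [this]
  exact ⟨P.map fun q => ((r, q), true), R.map fun q => ((r, q), true), by simp⟩

theorem mem_wraps_of_zpow {r c : V} {n : ℤ} (hn : 2 ≤ |n|) {v : FreeGroup (V × V)}
    (hv : (D.loop r c ^ n).toWord <:+: v.toWord) : v ∈ wraps r := by
  obtain ⟨m, hm⟩ : ∃ m : ℕ, |n| = m + 2 := ⟨(|n| - 2).toNat, by omega⟩
  rcases abs_choice n with h | h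
  · rw [← h, hm] at hv
    exact D.mem_wraps_of_pow (n := m) (by exact_mod_cast hv)
  · rw [← inv_mem_wraps]
    refine D.mem_wraps_of_pow (c := c) (n := m) ?_
    have e : D.loop r c ^ (m + 2) = (D.loop r c ^ n)⁻¹ := by
      rw [← zpow_neg, ← h, hm]
      norm_cast
    rw [e, toWord_inv, toWord_inv]
    exact invRev_infix hv

theorem loop_sq_mem_wraps (r c : V) : D.loop r c ^ 2 ∈ wraps r :=
  D.mem_wraps_of_pow (n := 0) (List.infix_refl _)

theorem loop_sq_notMem_wraps {r s : V} (hs : s ≠ r) (c : V) : D.loop r c ^ 2 ∉ wraps s := by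
  have key : ∀ g ∈ Subgroup.closure (of '' {z : V × V | z.1 = r}),
      ∀ r', ¬[((s, r), true), ((s, r'), true)] <:+: g.toWord := fun g hg r' h =>
    hs (mem_of_mem_toWord hg _ (h.subset (List.mem_cons_self)))
  have hc := pow_mem (D.loop_mem_closure r c) 2
  intro h
  obtain ⟨r', h' | h'⟩ := h r
  · exact key _ hc r' h'
  · exact key _ (inv_mem hc) r' h'

theorem twistHom_mem_wraps_of_not_adj {A : Set V} (hA : D.graph.IsIndepSet A) {c : V} (hc : c ∉ A)
    (h : ∀ r ∈ A, ¬D.graph.Adj c r) (k : ℤ) {v : FreeGroup (V × V)} (hv : v ∈ wraps c) :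
    D.twistHom A k v ∈ wraps c := by
  have key {u : FreeGroup (V × V)} {r r' : V}
      (hu : [((c, r), true), ((c, r'), true)] <:+: u.toWord) :
      [((c, r), true), ((c, r'), true)] <:+: (D.twistHom A k u).toWord := by
    have := (D.isShear hA k).infix_toWord (x := (c, r)) (y := (c, r')) hc hc hu
    rwa [D.shift_of_not fun h' => h r h'.1 h'.2, toWord_one] at this
  intro r
  obtain ⟨r', h' | h'⟩ := hv r
  · exact ⟨r', .inl (key h')⟩
  · exact ⟨r', .inr (by rw [← _root_.map_inv]; exact key h')⟩

theorem twistHom_mem_wraps_of_adj {A : Set V} (hA : D.graph.IsIndepSet A) {c r : V} (hr : r ∈ A)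
    (h : D.graph.Adj c r) {k : ℤ} (hk : 2 ≤ |k|) {v : FreeGroup (V × V)} (hv : v ∈ wraps c) :
    D.twistHom A k v ∈ wraps r := by
  have hc : c ∉ A := fun hc => hA hc hr h.ne h
  have key {u : FreeGroup (V × V)} {r' : V}
      (hu : [((c, r), true), ((c, r'), true)] <:+: u.toWord) : D.twistHom A k u ∈ wraps r := by
    have := (D.isShear hA k).infix_toWord (x := (c, r)) (y := (c, r')) hc hc hu
    rw [D.shift_of_mem hr h] at this
    refine D.mem_wraps_of_zpow (c := c) (n := D.sign r * k) ?_ (List.IsInfix.trans ?_ this)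
    · rcases D.sign_eq r with e | e <;> simpa [e] using hk
    · exact ⟨[((c, r), true)], [((c, r'), true)], rfl⟩
  obtain ⟨r', h' | h'⟩ := hv r
  · exact key h'
  · rw [← inv_mem_wraps, ← _root_.map_inv]
    exact key h'

end TwistData

end PingPong

section Cover

theorem altProd_apply_congr {G : Type*} [Group G] {K : Set G} {X X' Y Y' : MulAut G}
    (hX : ∀ x ∈ K, X x = X' x ∧ X x ∈ K) (hY : ∀ x ∈ K, Y x = Y' x ∧ Y x ∈ K) (m : ℕ)
    {x : G} (hx : x ∈ K) : altProd X Y m x = altProd X' Y' m x ∧ altProd X Y m x ∈ K := by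
  induction m generalizing X X' Y Y' with
  | zero => exact ⟨rfl, hx⟩
  | succ m ih =>
    obtain ⟨h1, h2⟩ := ih hY hX
    rw [altProd, altProd, MulAut.mul_apply, MulAut.mul_apply, ← h1]
    exact hX _ h2

theorem List.exists_rotations (V : Type*) [Fintype V] :
    ∃ rot : V → List V, ∀ s t, ∃ P B,
      rot s = P ++ t :: B ∧ rot t = B ++ P ++ [t] ∧ t ∉ P ∧ t ∉ B := by
  have hmem (s : V) : ∃ A C, (Finset.univ : Finset V).toList = A ++ s :: C :=
    List.append_of_mem (by simp)
  have hnd : (Finset.univ : Finset V).toList.Nodup := Finset.nodup_toList _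
  choose A C hAC using hmem
  refine ⟨fun s => C s ++ A s ++ [s], fun s t => ?_⟩
  have hs := hAC s
  have ht := hAC t
  rw [ht] at hnd
  by_cases hst : s = t
  · subst hst
    refine ⟨C s ++ A s, [], by simp, by simp, ?_, by simp⟩
    grind
  rcases List.append_eq_append_iff.1 (hs.symm.trans ht) with ⟨M, h1, h2⟩ | ⟨M, h1, h2⟩
  · rcases List.cons_eq_append_iff.1 h2 with ⟨rfl, h3⟩ | ⟨M, rfl, h3⟩
    · grind
    · exact ⟨M, C t ++ A s ++ [s], by simp [h3], by simp [h1], by grind, by grind⟩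
  · rcases List.cons_eq_append_iff.1 h2 with ⟨rfl, h3⟩ | ⟨M, rfl, h3⟩
    · grind
    · exact ⟨C s ++ A t, M ++ [s], by simp [h1], by simp [h3], by grind, by grind⟩

variable {S : Type*} (d : Sym2 S → ℕ)

/-- The vertices of the covering graph: the vertices `(s, f)` over `s`, where `f` assigns a position
to every edge of the Coxeter graph, and an auxiliary vertex `none`. -/
abbrev CoverVertex : Type _ := Option (S × ∀ p, Fin (d p + 1))

/-- Vertices over `s` and `t` are adjacent if their positions agree except at the edge `s(s, t)`,
where they are consecutive. Thus the vertices over `s` and `t` span a disjoint union of paths. The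
auxiliary vertex is adjacent to all others. -/
def coverGraph : SimpleGraph (CoverVertex d) where
  Adj
    | none, none => False
    | none, some _ => True
    | some _, none => True
    | some (s, f), some (t, g) => s ≠ t ∧ (∀ q, q ≠ s(s, t) → f q = g q) ∧
        ((f s(s, t) : ℕ) + 1 = g s(s, t) ∨ (g s(s, t) : ℕ) + 1 = f s(s, t))
  symm := by
    constructor
    rintro (_ | ⟨s, f⟩) (_ | ⟨t, g⟩) h
    · exact h
    · trivial
    · trivial
    · obtain ⟨h1, h2, h3⟩ := h
      refine ⟨h1.symm, fun q hq => (h2 q (by rwa [Sym2.eq_swap])).symm, ?_⟩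
      rw [Sym2.eq_swap]
      exact h3.symm
  loopless := by
    constructor
    rintro (_ | ⟨s, f⟩) h
    · exact h
    · exact h.1 rfl

theorem coverGraph_adj_some {s t : S} {f g : ∀ p, Fin (d p + 1)} :
    (coverGraph d).Adj (some (s, f)) (some (t, g)) ↔ s ≠ t ∧ (∀ q, q ≠ s(s, t) → f q = g q) ∧
        ((f s(s, t) : ℕ) + 1 = g s(s, t) ∨ (g s(s, t) : ℕ) + 1 = f s(s, t)) := Iff.rfl

/-- The vertices over `s`. -/
def sheet (s : S) : Set (CoverVertex d) := {x | ∃ f, x = some (s, f)}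

theorem isIndepSet_sheet (s : S) : (coverGraph d).IsIndepSet (sheet d s) := by
  rintro _ ⟨f, rfl⟩ _ ⟨g, rfl⟩ - h
  exact h.1 rfl

section Path

variable [DecidableEq S]

/-- The vertices of the path through `(s, f)` or `(t, f)` in the graph spanned by the vertices over
`s` and `t`, the last one lying over `s`. -/
def pathVertex (s t : S) (f : ∀ p, Fin (d p + 1)) (i : ℕ) : CoverVertex d :=
  some (if i % 2 = d s(s, t) % 2 then s else t,
    Function.update f s(s, t) (Fin.ofNat (d s(s, t) + 1) i))

variable {d} {s t : S} {f : ∀ p, Fin (d p + 1)}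

theorem pathVertex_injOn {i j : ℕ} (hi : i < d s(s, t) + 1) (hj : j < d s(s, t) + 1)
    (h : pathVertex d s t f i = pathVertex d s t f j) : i = j := by
  simp only [pathVertex, Option.some.injEq, Prod.mk.injEq] at h
  have := congrArg Fin.val (congrFun h.2 s(s, t))
  simpa [Nat.mod_eq_of_lt hi, Nat.mod_eq_of_lt hj] using this

theorem pathVertex_adj_iff (hst : s ≠ t) {i j : ℕ} (hi : i < d s(s, t) + 1)
    (hj : j < d s(s, t) + 1) :
    (coverGraph d).Adj (pathVertex d s t f i) (pathVertex d s t f j) ↔ i + 1 = j ∨ j + 1 = i := by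
  rw [pathVertex, pathVertex, coverGraph_adj_some]
  by_cases h1 : i % 2 = d s(s, t) % 2 <;> by_cases h2 : j % 2 = d s(s, t) % 2
  · simp only [if_pos h1, if_pos h2, ne_eq, not_true, false_and, false_iff]
    omega
  · rw [if_pos h1, if_neg h2]
    simp +contextual [hst, Nat.mod_eq_of_lt hi, Nat.mod_eq_of_lt hj]
  · rw [if_neg h1, if_pos h2, Sym2.eq_swap]
    simp +contextual [hst.symm, Nat.mod_eq_of_lt hi, Nat.mod_eq_of_lt hj]
  · simp only [if_neg h1, if_neg h2, ne_eq, not_true, false_and, false_iff]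
    omega

theorem exists_pathVertex_of_adj {i : ℕ} (hi : i < d s(s, t) + 1) {r : CoverVertex d}
    (hr : r ∈ sheet d s ∪ sheet d t) (h : (coverGraph d).Adj (pathVertex d s t f i) r) :
    ∃ j < d s(s, t) + 1, r = pathVertex d s t f j := by
  obtain ⟨w, g, rfl, hw⟩ : ∃ w g, r = some (w, g) ∧ (w = s ∨ w = t) := by
    rcases hr with ⟨g, rfl⟩ | ⟨g, rfl⟩
    exacts [⟨s, g, rfl, .inl rfl⟩, ⟨t, g, rfl, .inr rfl⟩]
  refine ⟨g s(s, t), (g s(s, t)).2, ?_⟩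
  rw [pathVertex, coverGraph_adj_some] at h
  have key : w = (if (g s(s, t) : ℕ) % 2 = d s(s, t) % 2 then s else t) ∧
      ∀ q, q ≠ s(s, t) → f q = g q := by
    by_cases h1 : i % 2 = d s(s, t) % 2
    · rw [if_pos h1] at h
      obtain rfl := hw.resolve_left h.1.symm
      simp +contextual [Nat.mod_eq_of_lt hi] at h
      refine ⟨?_, fun q hq => h.2.1 q hq⟩
      rw [if_neg (by omega)]
    · rw [if_neg h1] at h
      obtain rfl := hw.resolve_right h.1.symm
      rw [Sym2.eq_swap] at h
      simp +contextual [Nat.mod_eq_of_lt hi] at h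
      refine ⟨?_, fun q hq => h.2.1 q hq⟩
      rw [if_pos (by omega)]
  rw [pathVertex, ← key.1]
  congr 2
  funext q
  by_cases hq : q = s(s, t)
  · subst hq
    simp
  · rw [Function.update_of_ne hq, key.2 q hq]

/-- The vertices over `s` or `t`, depending on the parity of `k`, which lie in a given path. -/
def pathLayer (s t : S) (f : ∀ p, Fin (d p + 1)) (k : ℕ) : Set (CoverVertex d) :=
  {x | ∃ i, i + 2 ≤ k ∧ i % 2 = k % 2 ∧ x = pathVertex d s t f i}

theorem isIndepSet_pathLayer (k : ℕ) : (coverGraph d).IsIndepSet (pathLayer s t f k) := by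
  rintro _ ⟨i, -, hi, rfl⟩ _ ⟨j, -, hj, rfl⟩ - h
  rw [pathVertex, pathVertex, hi, hj] at h
  exact h.1 rfl

/-- The vertices of a path over `s(s, t)`. -/
def pathSet (s t : S) (f : ∀ p, Fin (d p + 1)) : Set (CoverVertex d) :=
  {x | ∃ i < d s(s, t) + 1, x = pathVertex d s t f i}

theorem sheet_inter_pathSet (hst : s ≠ t) :
    sheet d s ∩ pathSet s t f = pathLayer s t f (d s(s, t) + 2) := by
  ext x
  constructor
  · rintro ⟨⟨g, rfl⟩, i, hi, h⟩
    refine ⟨i, by omega, ?_, h⟩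
    simp only [pathVertex, Option.some.injEq, Prod.mk.injEq] at h
    by_contra h'
    rw [if_neg (by omega)] at h
    exact hst h.1
  · rintro ⟨i, h1, h2, rfl⟩
    exact ⟨⟨_, by rw [pathVertex, if_pos (by omega)]⟩, i, by omega, rfl⟩

theorem sheet_inter_pathSet' (hst : s ≠ t) :
    sheet d t ∩ pathSet s t f = pathLayer s t f (d s(s, t) + 1) := by
  ext x
  constructor
  · rintro ⟨⟨g, rfl⟩, i, hi, h⟩
    have : i % 2 ≠ d s(s, t) % 2 := by
      intro h'
      simp only [pathVertex, Option.some.injEq, Prod.mk.injEq, if_pos h'] at h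
      exact hst h.1.symm
    exact ⟨i, by omega, by omega, h⟩
  · rintro ⟨i, h1, h2, rfl⟩
    exact ⟨⟨_, by rw [pathVertex, if_neg (by omega)]⟩, i, by omega, rfl⟩

theorem eq_pathVertex (h : (f s(s, t) : ℕ) % 2 = d s(s, t) % 2) :
    pathVertex d s t f (f s(s, t)) = some (s, f) := by
  rw [pathVertex, if_pos h]
  congr 2
  simp

theorem exists_adj_sheet (hst : s ≠ t) (hd : d s(s, t) ≠ 0) (g : ∀ p, Fin (d p + 1)) :
    ∃ f, (coverGraph d).Adj (some (t, g)) (some (s, f)) := by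
  obtain ⟨j, hj⟩ : ∃ j : Fin (d s(t, s) + 1),
      (g s(t, s) : ℕ) + 1 = j ∨ (j : ℕ) + 1 = g s(t, s) := by
    rw [Sym2.eq_swap] at hd
    have := (g s(t, s)).2
    by_cases h0 : (g s(t, s) : ℕ) = 0
    · exact ⟨⟨1, by omega⟩, .inl (by simp [h0])⟩
    · exact ⟨⟨g s(t, s) - 1, by omega⟩, .inr (by simp; omega)⟩
  refine ⟨Function.update g s(t, s) j, (coverGraph_adj_some d).2 ⟨hst.symm, fun q hq => ?_, ?_⟩⟩
  · rw [Function.update_of_ne hq]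
  · rwa [Function.update_self]

end Path

variable [Fintype S] [DecidableEq S]

/-- The sign of a vertex is the parity of its total position. -/
def coverSign : CoverVertex d → ℤ
  | none => 1
  | some (_, f) => (-1) ^ ∑ q, (f q : ℕ)

theorem coverSign_of_adj {s t : S} {f g : ∀ p, Fin (d p + 1)}
    (h : (coverGraph d).Adj (some (s, f)) (some (t, g))) :
    coverSign d (some (t, g)) = -coverSign d (some (s, f)) := by
  obtain ⟨-, h2, h3⟩ := h
  have e : ∑ q ∈ Finset.univ.erase s(s, t), (f q : ℕ) =
      ∑ q ∈ Finset.univ.erase s(s, t), (g q : ℕ) :=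
    Finset.sum_congr rfl fun q hq => by rw [h2 q (Finset.ne_of_mem_erase hq)]
  have e1 := Finset.add_sum_erase Finset.univ (fun q => (f q : ℕ)) (Finset.mem_univ s(s, t))
  have e2 := Finset.add_sum_erase Finset.univ (fun q => (g q : ℕ)) (Finset.mem_univ s(s, t))
  simp only [coverSign, ← e1, ← e2, e]
  rcases h3 with h3 | h3
  · rw [← h3]
    ring
  · rw [← h3]
    ring

/-- The twist data of the covering graph. -/
noncomputable def coverData : TwistData (CoverVertex d) where
  graph := coverGraph d
  sign := coverSign d
  sign_eq
    | none => .inl rfl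
    | some (_, _) => neg_one_pow_eq_or ℤ _
  rot := (List.exists_rotations (CoverVertex d)).choose
  rot_split := (List.exists_rotations (CoverVertex d)).choose_spec

end Cover

section Representation

variable {S : Type*} [Fintype S] [DecidableEq S] {d : Sym2 S → ℕ} {s t : S}
  {f : ∀ p, Fin (d p + 1)}

/-- The action of the Artin generator `s` by the multi-twist along the vertices over `s`. -/
noncomputable def sheetTwist (d : Sym2 S → ℕ) (s : S) :
    MulAut (FreeGroup (CoverVertex d × CoverVertex d)) :=
  (coverData d).twist (A := sheet d s) (isIndepSet_sheet d s)

/-- The twists along the vertices of a path over `s(s, t)`. -/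
noncomputable def pathTwist (s t : S) (f : ∀ p, Fin (d p + 1)) (i : ℕ) :
    MulAut (FreeGroup (CoverVertex d × CoverVertex d)) :=
  (coverData d).twist ((coverData d).isIndepSet_singleton (pathVertex d s t f i))

theorem isBraidChain_pathTwist (hst : s ≠ t) :
    IsBraidChain (pathTwist s t f) (d s(s, t) + 1) where
  braid i hi := by
    have h := (pathVertex_adj_iff (f := f) hst (i := i) (by omega) hi).2 (.inl rfl)
    exact (coverData d).twist_braid h (coverSign_of_adj d h)
  comm i j hij hj := by
    have hne : pathVertex d s t f i ≠ pathVertex d s t f j := fun h => by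
      have := pathVertex_injOn (by omega) hj h
      omega
    refine (coverData d).commute_twist ?_ (by simpa using hne) _ _
    rintro _ (rfl | rfl) _ (rfl | rfl) h hadj
    · exact h rfl
    · have := (pathVertex_adj_iff hst (by omega) hj).1 hadj
      omega
    · have := (pathVertex_adj_iff hst hj (by omega)).1 hadj
      omega
    · exact h rfl

theorem braidLayer_pathTwist_apply (k : ℕ) (hk : k ≤ d s(s, t) + 2)
    (x : FreeGroup (CoverVertex d × CoverVertex d)) :
    braidLayer (pathTwist s t f) k x = (coverData d).twistHom (pathLayer s t f k) 1 x := by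
  induction k using Nat.twoStepInduction generalizing x with
  | zero =>
    have : pathLayer s t f 0 = ∅ := by
      refine Set.eq_empty_of_forall_notMem ?_
      rintro _ ⟨i, hi, -⟩
      omega
    rw [this, TwistData.twistHom_empty]
    rfl
  | one =>
    have : pathLayer s t f 1 = ∅ := by
      refine Set.eq_empty_of_forall_notMem ?_
      rintro _ ⟨i, hi, -⟩
      omega
    rw [this, TwistData.twistHom_empty]
    rfl
  | more k ih _ =>
    have e : pathLayer s t f (k + 2) = pathLayer s t f k ∪ {pathVertex d s t f k} := by
      ext x
      constructor
      · rintro ⟨i, h1, h2, rfl⟩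
        rcases Nat.lt_or_ge i k with hi | hi
        · exact .inl ⟨i, by omega, by omega, rfl⟩
        · obtain rfl : i = k := by omega
          exact .inr rfl
      · rintro (⟨i, h1, h2, rfl⟩ | rfl)
        · exact ⟨i, by omega, by omega, rfl⟩
        · exact ⟨k, by omega, by omega, rfl⟩
    have hi := isIndepSet_pathLayer (s := s) (t := t) (f := f) (k + 2)
    rw [e] at hi
    rw [braidLayer, MulAut.mul_apply, ih (by omega), e, (coverData d).twistHom_union hi]
    · rfl
    · rw [Set.disjoint_singleton_right]
      rintro ⟨i, h1, -, h2⟩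
      have := pathVertex_injOn (by omega) (by omega) h2
      omega

theorem altProd_sheetTwist_pathVertex (hst : s ≠ t) {i : ℕ} (hi : i < d s(s, t) + 1)
    (c : CoverVertex d) :
    altProd (sheetTwist d s) (sheetTwist d t) (d s(s, t) + 2)
        (FreeGroup.of (c, pathVertex d s t f i)) =
      altProd (sheetTwist d t) (sheetTwist d s) (d s(s, t) + 2)
        (FreeGroup.of (c, pathVertex d s t f i)) := by
  set K : Subgroup (FreeGroup (CoverVertex d × CoverVertex d)) := Subgroup.closure
    (FreeGroup.of '' {z | z.1 ∈ pathSet s t f ∨ z.2 ∈ pathSet s t f}) with hK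
  have hs : ∀ x ∈ (K : Set _), sheetTwist d s x =
      braidLayer (pathTwist s t f) (d s(s, t) + 2) x ∧ sheetTwist d s x ∈ (K : Set _) := by
    intro x hx
    rw [braidLayer_pathTwist_apply _ le_rfl, ← sheet_inter_pathSet hst]
    refine (coverData d).twistHom_inter ?_ 1 hx
    rintro _ ⟨j, hj, rfl⟩ r hr h
    exact exists_pathVertex_of_adj hj (.inl hr) h
  have ht : ∀ x ∈ (K : Set _), sheetTwist d t x =
      braidLayer (pathTwist s t f) (d s(s, t) + 1) x ∧ sheetTwist d t x ∈ (K : Set _) := by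
    intro x hx
    rw [braidLayer_pathTwist_apply _ (by omega), ← sheet_inter_pathSet' hst]
    refine (coverData d).twistHom_inter ?_ 1 hx
    rintro _ ⟨j, hj, rfl⟩ r hr h
    exact exists_pathVertex_of_adj hj (.inr hr) h
  have hx : FreeGroup.of (c, pathVertex d s t f i) ∈ (K : Set _) :=
    Subgroup.subset_closure ⟨_, .inr ⟨i, hi, rfl⟩, rfl⟩
  rw [(altProd_apply_congr hs ht _ hx).1, (altProd_apply_congr ht hs _ hx).1,
    (isBraidChain_pathTwist hst).altProd_layer]

theorem altProd_sheetTwist (hst : s ≠ t) :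
    altProd (sheetTwist d s) (sheetTwist d t) (d s(s, t) + 2) =
      altProd (sheetTwist d t) (sheetTwist d s) (d s(s, t) + 2) := by
  have key {s t : S} (hst : s ≠ t) (f : ∀ p, Fin (d p + 1)) (c : CoverVertex d) :
      altProd (sheetTwist d s) (sheetTwist d t) (d s(s, t) + 2) (FreeGroup.of (c, some (s, f))) =
      altProd (sheetTwist d t) (sheetTwist d s) (d s(s, t) + 2)
        (FreeGroup.of (c, some (s, f))) := by
    by_cases h : (f s(s, t) : ℕ) % 2 = d s(s, t) % 2
    · rw [← eq_pathVertex h]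
      exact altProd_sheetTwist_pathVertex hst (f s(s, t)).2 c
    · have e : pathVertex d t s f (f s(t, s)) = some (s, f) := by
        rw [pathVertex, if_neg (by rwa [Sym2.eq_swap])]
        congr 2
        simp
      rw [← e, Sym2.eq_swap]
      exact (altProd_sheetTwist_pathVertex hst.symm (f s(t, s)).2 c).symm
  refine MulEquiv.ext fun x => ?_
  rw [← MulEquiv.coe_toMonoidHom, ← MulEquiv.coe_toMonoidHom (altProd _ _ _)]
  congr 1
  refine FreeGroup.ext_hom _ _ fun ⟨c, r⟩ => ?_
  rw [MulEquiv.coe_toMonoidHom, MulEquiv.coe_toMonoidHom]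
  by_cases hs : r ∈ sheet d s
  · obtain ⟨f, rfl⟩ := hs
    exact key hst f c
  by_cases ht : r ∈ sheet d t
  · obtain ⟨f, rfl⟩ := ht
    have := (key hst.symm f c).symm
    rwa [Sym2.eq_swap] at this
  have h1 (w : S) (hw : r ∉ sheet d w) :
      ∀ x ∈ ({FreeGroup.of (c, r)} : Set (FreeGroup (CoverVertex d × CoverVertex d))),
        sheetTwist d w x = (1 : MulAut _) x ∧ sheetTwist d w x ∈ ({FreeGroup.of (c, r)} : Set _) := by
    rintro _ rfl
    have : sheetTwist d w (FreeGroup.of (c, r)) = FreeGroup.of (c, r) := by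
      change (coverData d).twistHom (sheet d w) 1 (FreeGroup.of (c, r)) = _
      rw [TwistData.twistHom_of, TwistData.shift_of_not _ fun h => hw h.1, mul_one]
    rw [this]
    exact ⟨rfl, rfl⟩
  rw [(altProd_apply_congr (h1 s hs) (h1 t ht) _ rfl).1,
    (altProd_apply_congr (h1 t ht) (h1 s hs) _ rfl).1]

end Representation

section PartiallyCommutative

variable {S H X : Type*} [Group H]

/-- Ping-pong sets `Y s ⊆ X` and a base point for an action of a group on `X`, and for elements `a s`
of the group which commute if they are related by `com`. -/
structure IsPingPong (θ : H →* Equiv.Perm X) (a : S → H) (com : S → S → Prop) (Y : S → Set X)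
    (x₀ : X) : Prop where
  symm : ∀ s t, com s t → com t s
  commute : ∀ s t, com s t → Commute (a s) (a t)
  base : ∀ s (k : ℤ), k ≠ 0 → θ (a s ^ k) x₀ ∈ Y s
  base_notMem : ∀ s, x₀ ∉ Y s
  move : ∀ s t (k : ℤ), s ≠ t → ¬com s t → k ≠ 0 → ∀ x ∈ Y t, θ (a s ^ k) x ∈ Y s
  stay : ∀ s t (k : ℤ), s ≠ t → com s t → k ≠ 0 → ∀ x ∈ Y t, θ (a s ^ k) x ∈ Y t

/-- The product of the syllables `a s ^ k` in a list. -/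
def syllableProd (a : S → H) (w : List (S × ℤ)) : H := (w.map fun x => a x.1 ^ x.2).prod

theorem syllableProd_cons (a : S → H) (x : S × ℤ) (w : List (S × ℤ)) :
    syllableProd a (x :: w) = a x.1 ^ x.2 * syllableProd a w := List.prod_cons

theorem syllableProd_append (a : S → H) (w w' : List (S × ℤ)) :
    syllableProd a (w ++ w') = syllableProd a w * syllableProd a w' := by
  simp [syllableProd]

theorem exists_syllableProd_eq {a : S → H} {h : H} (hh : h ∈ Subgroup.closure (Set.range a)) :
    ∃ w, syllableProd a w = h := by
  induction hh using Subgroup.closure_induction with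
  | mem h hh =>
    obtain ⟨s, rfl⟩ := hh
    exact ⟨[(s, 1)], by simp [syllableProd]⟩
  | one => exact ⟨[], rfl⟩
  | mul g h _ _ hg hh =>
    obtain ⟨⟨w, rfl⟩, w', rfl⟩ := hg, hh
    exact ⟨w ++ w', syllableProd_append a w w'⟩
  | inv g _ hg =>
    obtain ⟨w, rfl⟩ := hg
    refine ⟨(w.map fun x => (x.1, -x.2)).reverse, ?_⟩
    simp [syllableProd, List.prod_inv_reverse, Function.comp_def, List.map_reverse]

theorem List.forall_or_exists_first {α : Type*} (p : α → Prop) (w : List α) :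
    (∀ x ∈ w, p x) ∨ ∃ u x v, w = u ++ x :: v ∧ (∀ y ∈ u, p y) ∧ ¬p x := by
  induction w with
  | nil => exact .inl (by simp)
  | cons x w ih =>
    by_cases hx : p x
    · rcases ih with h | ⟨u, y, v, rfl, hu, hy⟩
      · exact .inl (List.forall_mem_cons.2 ⟨hx, h⟩)
      · exact .inr ⟨x :: u, y, v, rfl, List.forall_mem_cons.2 ⟨hx, hu⟩, hy⟩
    · exact .inr ⟨[], x, w, rfl, by simp, hx⟩

namespace IsPingPong

variable {θ : H →* Equiv.Perm X} {a : S → H} {com : S → S → Prop} {Y : S → Set X} {x₀ : X}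

theorem commute_syllableProd (h : IsPingPong θ a com Y x₀) {s : S} {u : List (S × ℤ)}
    (hu : ∀ x ∈ u, s ≠ x.1 ∧ com s x.1) (k : ℤ) : Commute (a s ^ k) (syllableProd a u) := by
  refine Commute.list_prod_right _ _ fun y hy => ?_
  obtain ⟨x, hx, rfl⟩ := List.mem_map.1 hy
  exact (h.commute _ _ (hu x hx).2).zpow_zpow _ _

theorem syllableProd_stay (h : IsPingPong θ a com Y x₀) {s : S} {u : List (S × ℤ)}
    (hu : ∀ x ∈ u, s ≠ x.1 ∧ com s x.1) {x : X} (hx : x ∈ Y s) :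
    θ (syllableProd a u) x ∈ Y s := by
  induction u with
  | nil => simpa [syllableProd] using hx
  | cons y u ih =>
    rw [List.forall_mem_cons] at hu
    rw [syllableProd_cons, map_mul, Equiv.Perm.mul_apply]
    by_cases hk : y.2 = 0
    · simpa [hk] using ih hu.2
    · exact h.stay _ _ _ hu.1.1.symm (h.symm _ _ hu.1.2) hk _ (ih hu.2)

theorem mem_of_minimal (h : IsPingPong θ a com Y x₀) (n : ℕ) {s : S} {k : ℤ} {w : List (S × ℤ)}
    (hn : w.length = n)
    (hw : ∀ w', syllableProd a w' = syllableProd a ((s, k) :: w) → w.length < w'.length) :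
    θ (syllableProd a ((s, k) :: w)) x₀ ∈ Y s := by
  induction n using Nat.strong_induction_on generalizing s k w with
  | _ n ih =>
    have hk : k ≠ 0 := by
      rintro rfl
      exact lt_irrefl _ (hw w (by simp [syllableProd_cons]))
    rcases w.forall_or_exists_first fun x => s ≠ x.1 ∧ com s x.1 with hall | ⟨u, ⟨t, l⟩, v, rfl, hu, ht⟩
    · rw [syllableProd_cons, (h.commute_syllableProd hall k).eq, map_mul, Equiv.Perm.mul_apply]
      exact h.syllableProd_stay hall (h.base s k hk)
    · have e : syllableProd a ((s, k) :: (u ++ (t, l) :: v)) =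
          syllableProd a u * (a s ^ k * syllableProd a ((t, l) :: v)) := by
        rw [syllableProd_cons, syllableProd_append, ← mul_assoc,
          (h.commute_syllableProd hu k).eq, mul_assoc]
      by_cases hst : s = t
      · subst hst
        have := hw (u ++ (s, k + l) :: v) (by
          rw [e, syllableProd_append, syllableProd_cons, syllableProd_cons, zpow_add, mul_assoc])
        simp at this
      · have hcom : ¬com s t := fun hc => ht ⟨hst, hc⟩
        rw [e, map_mul, Equiv.Perm.mul_apply, map_mul, Equiv.Perm.mul_apply]
        refine h.syllableProd_stay hu (h.move s t k hst hcom hk _ (ih v.length ?_ rfl ?_))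
        · rw [← hn]
          simp
          omega
        · intro w' hw'
          have := hw ((s, k) :: (u ++ w')) (by
            rw [syllableProd_cons, syllableProd_append, hw', syllableProd_cons a (s, k),
              syllableProd_append])
          simp at this
          omega

theorem injective (h : IsPingPong θ a com Y x₀) (ha : Subgroup.closure (Set.range a) = ⊤) :
    Function.Injective θ := by
  rw [injective_iff_map_eq_one]
  intro g hg
  have hex : ∃ n w, List.length w = n ∧ syllableProd a w = g := by
    obtain ⟨w, hw⟩ := exists_syllableProd_eq (a := a) (h := g) (ha ▸ Subgroup.mem_top g)
    exact ⟨_, w, rfl, hw⟩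
  classical
  obtain ⟨w, hwl, rfl⟩ := Nat.find_spec hex
  rcases w with - | ⟨⟨s, k⟩, w⟩
  · rfl
  · have hmem : θ (syllableProd a ((s, k) :: w)) x₀ ∈ Y s := by
      refine h.mem_of_minimal _ rfl fun w' hw' => ?_
      have := Nat.find_min' hex ⟨w', rfl, hw'⟩
      rw [← hwl] at this
      exact this
    rw [hg] at hmem
    exact absurd hmem (h.base_notMem s)

end IsPingPong

end PartiallyCommutative

section Tits

section Wraps

variable {S : Type*} [Fintype S] [DecidableEq S] {d : Sym2 S → ℕ}

/-- The elements which wrap around some vertex over `s`. -/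
def sheetWraps (d : Sym2 S → ℕ) (s : S) : Set (FreeGroup (CoverVertex d × CoverVertex d)) :=
  {v | ∃ f, v ∈ TwistData.wraps (some (s, f))}

/-- The base point for the ping-pong argument. -/
noncomputable def coverBase (d : Sym2 S → ℕ) : FreeGroup (CoverVertex d × CoverVertex d) :=
  (coverData d).loop none none ^ 2

theorem coverBase_notMem (s : S) : coverBase d ∉ sheetWraps d s := by
  rintro ⟨f, h⟩
  exact (coverData d).loop_sq_notMem_wraps (Option.some_ne_none _) _ h

theorem sheetTwist_zpow_apply (s : S) (k : ℤ) (x : FreeGroup (CoverVertex d × CoverVertex d)) :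
    (sheetTwist d s ^ k) x = (coverData d).twistHom (sheet d s) k x :=
  (coverData d).twist_zpow_apply _ k x

theorem sheetTwist_zpow_coverBase (s : S) {k : ℤ} (hk : 2 ≤ |k|) :
    (sheetTwist d s ^ k) (coverBase d) ∈ sheetWraps d s := by
  rw [sheetTwist_zpow_apply]
  exact ⟨0, (coverData d).twistHom_mem_wraps_of_adj (c := none) (isIndepSet_sheet d s) ⟨0, rfl⟩
    trivial hk ((coverData d).loop_sq_mem_wraps _ _)⟩

theorem sheetTwist_zpow_mem {s t : S} (hst : s ≠ t) (hd : d s(s, t) ≠ 0) {k : ℤ} (hk : 2 ≤ |k|)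
    {v : FreeGroup (CoverVertex d × CoverVertex d)} (hv : v ∈ sheetWraps d t) :
    (sheetTwist d s ^ k) v ∈ sheetWraps d s := by
  obtain ⟨g, hg⟩ := hv
  obtain ⟨f, hf⟩ := exists_adj_sheet hst hd g
  rw [sheetTwist_zpow_apply]
  exact ⟨f, (coverData d).twistHom_mem_wraps_of_adj (isIndepSet_sheet d s) ⟨f, rfl⟩ hf hk hg⟩

theorem sheetTwist_zpow_mem_of_eq_zero {s t : S} (hst : s ≠ t) (hd : d s(s, t) = 0) (k : ℤ)
    {v : FreeGroup (CoverVertex d × CoverVertex d)} (hv : v ∈ sheetWraps d t) :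
    (sheetTwist d s ^ k) v ∈ sheetWraps d t := by
  obtain ⟨g, hg⟩ := hv
  rw [sheetTwist_zpow_apply]
  refine ⟨g, (coverData d).twistHom_mem_wraps_of_not_adj (isIndepSet_sheet d s) ?_ ?_ k hg⟩
  · rintro ⟨f, h⟩
    simp only [Option.some.injEq, Prod.mk.injEq] at h
    exact hst h.1.symm
  · rintro _ ⟨f, rfl⟩ h
    obtain ⟨-, -, h⟩ := (coverGraph_adj_some d).1 h
    have h1 := (f s(t, s)).2
    have h2 := (g s(t, s)).2
    rw [Sym2.eq_swap] at hd
    omega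

end Wraps

theorem map_altProd {G H : Type*} [Monoid G] [Monoid H] (f : G →* H) (x y : G) (m : ℕ) :
    f (altProd x y m) = altProd (f x) (f y) m := by
  induction m generalizing x y with
  | zero => exact map_one f
  | succ m ih => rw [altProd, map_mul, ih, altProd]

variable {S : Type*} {M : S → S → ℕ}

theorem ArtinGroup.commute_of (s t : S) (hst : s ≠ t) (h : M s t = 2) :
    Commute (PresentedGroup.of s : ArtinGroup S M) (PresentedGroup.of t) := by
  have : (PresentedGroup.mk (artinRels S M)) (altProd (FreeGroup.of s) (FreeGroup.of t) (M s t) *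
      (altProd (FreeGroup.of t) (FreeGroup.of s) (M s t))⁻¹) = 1 :=
    PresentedGroup.one_of_mem ⟨s, t, hst, by omega, rfl⟩
  rw [map_mul, map_inv, mul_inv_eq_one, map_altProd, map_altProd, h] at this
  simp only [altProd, mul_one] at this
  exact this

theorem TitsGroup.commute_of (s t : S) (hst : s ≠ t) (h : M s t = 2) :
    Commute (PresentedGroup.of s : TitsGroup S M) (PresentedGroup.of t) := by
  have : (PresentedGroup.mk (titsRels S M)) (FreeGroup.of s * FreeGroup.of t *
      (FreeGroup.of t * FreeGroup.of s)⁻¹) = 1 :=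
    PresentedGroup.one_of_mem ⟨s, t, hst, h, rfl⟩
  rwa [map_mul, map_inv, mul_inv_eq_one, map_mul, map_mul] at this

theorem TitsGroup.exists_hom {G : Type*} [Group G] (f : S → G)
    (hf : ∀ s t, s ≠ t → M s t = 2 → Commute (f s) (f t)) :
    ∃ φ : TitsGroup S M →* G, ∀ s, φ (PresentedGroup.of s) = f s := by
  refine ⟨PresentedGroup.toGroup (f := f) ?_, fun s => PresentedGroup.toGroup.of _⟩
  rintro _ ⟨s, t, hst, h, rfl⟩
  rw [map_mul, map_inv, mul_inv_eq_one, map_mul, map_mul, FreeGroup.lift_apply_of,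
    FreeGroup.lift_apply_of]
  exact hf s t hst h

theorem ArtinGroup.exists_hom {G : Type*} [Group G] (f : S → G)
    (hf : ∀ s t, s ≠ t → M s t ≠ 0 → altProd (f s) (f t) (M s t) = altProd (f t) (f s) (M s t)) :
    ∃ φ : ArtinGroup S M →* G, ∀ s, φ (PresentedGroup.of s) = f s := by
  refine ⟨PresentedGroup.toGroup (f := f) ?_, fun s => PresentedGroup.toGroup.of _⟩
  rintro _ ⟨s, t, hst, h, rfl⟩
  rw [map_mul, map_inv, mul_inv_eq_one, map_altProd, map_altProd, FreeGroup.lift_apply_of,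
    FreeGroup.lift_apply_of]
  exact hf s t hst h

theorem TitsGroup.not_commute_of (hsymm : ∀ s t : S, s ≠ t → M s t = M t s) {s t : S}
    (hst : s ≠ t) (h : M s t ≠ 2) :
    ¬Commute (PresentedGroup.of s : TitsGroup S M) (PresentedGroup.of t) := by
  classical
  obtain ⟨φ, hφ⟩ := TitsGroup.exists_hom (M := M) (G := Equiv.Perm (Fin 3))
    (fun u => if u = s then Equiv.swap 0 1 else if u = t then Equiv.swap 1 2 else 1) (by
      intro u v huv hM
      by_cases hu : u = s <;> by_cases hv : v = s <;> by_cases hu' : u = t <;>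
        by_cases hv' : v = t <;> simp_all)
  intro hc
  have := hc.map φ
  rw [hφ, hφ, if_pos rfl, if_neg hst.symm, if_pos rfl] at this
  revert this
  unfold Commute SemiconjBy
  decide

/-- The lengths of the paths in the covering graph attached to a Coxeter graph. -/
theorem exists_pathLength (hsymm : ∀ s t : S, s ≠ t → M s t = M t s)
    (hM : ∀ s t : S, s ≠ t → M s t = 0 ∨ 2 ≤ M s t) :
    ∃ d : Sym2 S → ℕ, ∀ s t, s ≠ t →
      (M s t ≠ 0 → d s(s, t) + 2 = M s t) ∧ (d s(s, t) = 0 ↔ M s t = 2) := by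
  classical
  refine ⟨Sym2.lift ⟨fun s t => if s = t then 0 else if M s t = 0 then 1 else M s t - 2, ?_⟩, ?_⟩
  · intro s t
    by_cases h : s = t
    · rw [h]
    · simp only [h, Ne.symm h, if_false, hsymm s t h]
  · intro s t h
    have := hM s t h
    simp only [Sym2.lift_mk, h, if_false]
    by_cases h0 : M s t = 0
    · simp [h0]
    · rw [if_neg h0]
      refine ⟨fun _ => ?_, ?_⟩ <;> omega

end Tits

/-- (Crisp–Paris; the Tits conjecture) Let `Γ` be a Coxeter graph over a finite set `S`
(labels `M s t ∈ {2,3,…} ∪ {∞}`, with `∞` encoded as `0`), let `A(Γ)` be the associated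
Artin group, and fix integers `m_s = e s ≥ 2`.  The homomorphism `H → A(Γ)` sending
`T_s ↦ σ_s ^ (e s)` is well defined and injective; moreover for `s ≠ t` the elements
`σ_s ^ (e s)` and `σ_t ^ (e t)` commute in `A(Γ)` if and only if `M s t = 2`. -/
theorem tits_conjecture (S : Type*) [Fintype S] (M : S → S → ℕ)
    (hsymm : ∀ s t : S, s ≠ t → M s t = M t s)
    (hM : ∀ s t : S, s ≠ t → M s t = 0 ∨ 2 ≤ M s t)
    (e : S → ℕ) (he : ∀ s : S, 2 ≤ e s) :
    (∃ φ : TitsGroup S M →* ArtinGroup S M,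
        (∀ s : S, φ (PresentedGroup.of s) =
          (PresentedGroup.of s : ArtinGroup S M) ^ (e s)) ∧
        Function.Injective φ) ∧
    (∀ s t : S, s ≠ t →
      (Commute ((PresentedGroup.of s : ArtinGroup S M) ^ (e s))
        ((PresentedGroup.of t : ArtinGroup S M) ^ (e t)) ↔ M s t = 2)) := by
  obtain ⟨φ, hφ⟩ := TitsGroup.exists_hom (M := M)
    (fun s => (PresentedGroup.of s : ArtinGroup S M) ^ e s)
    fun s t hst h => (ArtinGroup.commute_of s t hst h).pow_pow _ _
  have hinj : Function.Injective φ := by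
    classical
    obtain ⟨d, hd⟩ := exists_pathLength hsymm hM
    obtain ⟨ρ, hρ⟩ := ArtinGroup.exists_hom (M := M) (sheetTwist d) fun s t hst h => by
      rw [← (hd s t hst).1 h]
      exact altProd_sheetTwist hst
    have happ (s : S) (k : ℤ) (v : FreeGroup (CoverVertex d × CoverVertex d)) :
        (MulAut.toPerm _).comp (ρ.comp φ) (PresentedGroup.of s ^ k) v =
          (sheetTwist d s ^ (e s * k)) v := by
      rw [MonoidHom.comp_apply, MonoidHom.comp_apply, map_zpow φ, hφ, map_zpow ρ, map_pow ρ, hρ,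
        ← zpow_natCast, ← zpow_mul]
      rfl
    have habs (s : S) {k : ℤ} (hk : k ≠ 0) : 2 ≤ |e s * k| := by
      rw [abs_mul, Nat.abs_cast]
      have h1 : (2 : ℤ) ≤ e s := by exact_mod_cast he s
      nlinarith [Int.one_le_abs hk]
    have hpp : IsPingPong ((MulAut.toPerm _).comp (ρ.comp φ)) PresentedGroup.of
        (fun s t => s ≠ t ∧ M s t = 2) (sheetWraps d) (coverBase d) :=
      { symm := fun s t h => ⟨h.1.symm, hsymm s t h.1 ▸ h.2⟩
        commute := fun s t h => TitsGroup.commute_of s t h.1 h.2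
        base := fun s k hk => by
          rw [happ]
          exact sheetTwist_zpow_coverBase s (habs s hk)
        base_notMem := coverBase_notMem
        move := fun s t k hst h hk v hv => by
          rw [happ]
          exact sheetTwist_zpow_mem hst (fun h' => h ⟨hst, (hd s t hst).2.1 h'⟩) (habs s hk) hv
        stay := fun s t k hst h hk v hv => by
          rw [happ]
          exact sheetTwist_zpow_mem_of_eq_zero hst ((hd s t hst).2.2 h.2) _ hv }
    have := hpp.injective (PresentedGroup.closure_range_of _)
    rw [MonoidHom.coe_comp, MonoidHom.coe_comp] at this
    exact this.of_comp.of_comp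
  refine ⟨⟨φ, hφ, hinj⟩, fun s t hst => ⟨fun hc => ?_, fun h => ?_⟩⟩
  · by_contra h
    refine TitsGroup.not_commute_of hsymm hst h (hinj ?_)
    rw [map_mul, map_mul, hφ, hφ]
    exact hc
  · exact (ArtinGroup.commute_of s t hst h).pow_pow _ _
end

section
/- (Ocneanu) For each nonzero t ∈ ℂ and each nonzero z ∈ ℂ there exists a unique family of ℂ-linear maps tr_n : H_n(t) → ℂ (n = 1, 2, 3, …) such that: (i) tr_n(1) = 1 for all n; (ii) tr_n(ab) = tr_n(ba) for all a, b ∈ H_n(t); (iii) tr_{n+1} ∘ ι_n = tr_n for all n; and (iv) tr_{n+1}(ι_n(u) · x_n · ι_n(v)) = z · tr_n(u v) for all u, v ∈ H_n(t), where ι_n : H_n(t) → H_{n+1}(t) is the canonical unital algebra homomorphism sending x_i to x_i. -/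
/-- Defining relations of the Hecke algebra with `m` generators `x₀, …, x_{m-1}`
(H_{m+1}(t) in classical 1-indexed notation): `xᵢ xₖ = xₖ xᵢ` for `|i-k| ≥ 2`,
`xᵢ x_{i+1} xᵢ = x_{i+1} xᵢ x_{i+1}`, and `xᵢ² = (t-1) xᵢ + t`. -/
inductive HeckeRel (t : ℂ) (m : ℕ) :
    FreeAlgebra ℂ (Fin m) → FreeAlgebra ℂ (Fin m) → Prop
  | comm (i k : Fin m) (h : (i : ℕ) + 2 ≤ (k : ℕ)) :
      HeckeRel t m (FreeAlgebra.ι ℂ i * FreeAlgebra.ι ℂ k)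
        (FreeAlgebra.ι ℂ k * FreeAlgebra.ι ℂ i)
  | braid (i k : Fin m) (h : (i : ℕ) + 1 = (k : ℕ)) :
      HeckeRel t m (FreeAlgebra.ι ℂ i * FreeAlgebra.ι ℂ k * FreeAlgebra.ι ℂ i)
        (FreeAlgebra.ι ℂ k * FreeAlgebra.ι ℂ i * FreeAlgebra.ι ℂ k)
  | quad (i : Fin m) :
      HeckeRel t m (FreeAlgebra.ι ℂ i * FreeAlgebra.ι ℂ i)
        (algebraMap ℂ (FreeAlgebra ℂ (Fin m)) (t - 1) * FreeAlgebra.ι ℂ i +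
          algebraMap ℂ (FreeAlgebra ℂ (Fin m)) t)

/-- The Hecke algebra with `m` generators, i.e. `H_{m+1}(t)`; in particular
`Hecke t 0 = H₁(t) ≅ ℂ`. -/
abbrev Hecke (t : ℂ) (m : ℕ) : Type := RingQuot (HeckeRel t m)

/-- The generator `x_{i+1}` (Lean index `i`) of the Hecke algebra `H_{m+1}(t)`. -/
noncomputable def heckeGen (t : ℂ) (m : ℕ) (i : Fin m) : Hecke t m :=
  RingQuot.mkAlgHom ℂ (HeckeRel t m) (FreeAlgebra.ι ℂ i)

/-- The generators indexed by `ℕ`, extended by zero. -/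
noncomputable def heckeNatGen (t : ℂ) (m : ℕ) (i : ℕ) : Hecke t m :=
  if h : i < m then heckeGen t m ⟨i, h⟩ else 0

lemma heckeNatGen_of_lt (t : ℂ) {m i : ℕ} (h : i < m) :
    heckeNatGen t m i = heckeGen t m ⟨i, h⟩ := dif_pos h

lemma heckeGen_comm (t : ℂ) (m : ℕ) (i k : Fin m) (h : (i : ℕ) + 2 ≤ k) :
    heckeGen t m i * heckeGen t m k = heckeGen t m k * heckeGen t m i := by
  simpa [heckeGen] using RingQuot.mkAlgHom_rel ℂ (HeckeRel.comm (t := t) i k h)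

lemma heckeGen_braid (t : ℂ) (m : ℕ) (i k : Fin m) (h : (i : ℕ) + 1 = k) :
    heckeGen t m i * heckeGen t m k * heckeGen t m i =
      heckeGen t m k * heckeGen t m i * heckeGen t m k := by
  simpa [heckeGen] using RingQuot.mkAlgHom_rel ℂ (HeckeRel.braid (t := t) i k h)

lemma heckeGen_sq (t : ℂ) (m : ℕ) (i : Fin m) :
    heckeGen t m i * heckeGen t m i = (t - 1) • heckeGen t m i + t • 1 := by
  have := RingQuot.mkAlgHom_rel ℂ (HeckeRel.quad (t := t) i)
  rw [map_mul, map_add, map_mul, AlgHom.commutes, AlgHom.commutes, ← Algebra.smul_def,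
    Algebra.algebraMap_eq_smul_one] at this
  exact this

lemma heckeNatGen_comm (t : ℂ) (m : ℕ) {i k : ℕ} (h : i + 2 ≤ k) :
    heckeNatGen t m i * heckeNatGen t m k = heckeNatGen t m k * heckeNatGen t m i := by
  unfold heckeNatGen
  split_ifs
  · exact heckeGen_comm t m _ _ h
  all_goals simp

lemma heckeNatGen_braid (t : ℂ) {m i : ℕ} (h : i + 1 < m) :
    heckeNatGen t m i * (heckeNatGen t m (i + 1) * heckeNatGen t m i) =
      heckeNatGen t m (i + 1) * (heckeNatGen t m i * heckeNatGen t m (i + 1)) := by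
  rw [heckeNatGen_of_lt t h, heckeNatGen_of_lt t (Nat.lt_of_succ_lt h), ← mul_assoc, ← mul_assoc]
  exact heckeGen_braid t m _ _ rfl

lemma heckeNatGen_sq (t : ℂ) {m i : ℕ} (h : i < m) :
    heckeNatGen t m i * heckeNatGen t m i = (t - 1) • heckeNatGen t m i + t • 1 := by
  rw [heckeNatGen_of_lt t h]
  exact heckeGen_sq t m _

/-- A subspace containing `1` and stable under left multiplication by the generators is
everything. -/
lemma hecke_submodule_eq_top (t : ℂ) (m : ℕ) (S : Submodule ℂ (Hecke t m))
    (h1 : (1 : Hecke t m) ∈ S)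
    (hS : ∀ (i : Fin m), ∀ a ∈ S, heckeGen t m i * a ∈ S) (a : Hecke t m) : a ∈ S := by
  obtain ⟨b, rfl⟩ := RingQuot.mkAlgHom_surjective ℂ (HeckeRel t m) a
  suffices H : ∀ c ∈ S, RingQuot.mkAlgHom ℂ (HeckeRel t m) b * c ∈ S by simpa using H 1 h1
  induction b using FreeAlgebra.induction with
  | grade0 r =>
    intro c hc
    rw [AlgHom.commutes, ← Algebra.smul_def]
    exact S.smul_mem r hc
  | grade1 i => exact hS i
  | mul a b ha hb =>
    intro c hc
    rw [map_mul, mul_assoc]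
    exact ha _ (hb _ hc)
  | add a b ha hb =>
    intro c hc
    rw [map_add, add_mul]
    exact S.add_mem (ha _ hc) (hb _ hc)

/-- The action of the `i`-th generator of `H_{m+2}` on the representation induced from the regular
representation of `H_{m+1}`, in coordinates `0, …, m + 1`.  On the irrelevant coordinates above
`m + 1` it is the scalar `t`. -/
noncomputable def inducedGen (t : ℂ) (m i : ℕ) : Module.End ℂ (ℕ → Hecke t m) where
  toFun v k :=
    if m + 1 < k then t • v k
    else if k < i then heckeNatGen t m (i - 1) * v k
    else if k = i then (t - 1) • v i + v (i + 1)
    else if k = i + 1 then t • v i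
    else heckeNatGen t m i * v k
  map_add' v w := by
    ext k
    simp only [Pi.add_apply]
    split_ifs <;> (simp only [smul_add, mul_add]; try abel)
  map_smul' r v := by
    ext k
    simp only [Pi.smul_apply, RingHom.id_apply]
    split_ifs <;> simp only [smul_add, mul_smul_comm, smul_comm r]

lemma inducedGen_apply (t : ℂ) (m i : ℕ) (v : ℕ → Hecke t m) (k : ℕ) :
    inducedGen t m i v k =
      if m + 1 < k then t • v k
      else if k < i then heckeNatGen t m (i - 1) * v k
      else if k = i then (t - 1) • v i + v (i + 1)
      else if k = i + 1 then t • v i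
      else heckeNatGen t m i * v k := rfl

lemma inducedGen_above (t : ℂ) {m i k : ℕ} (v : ℕ → Hecke t m) (h : m + 1 < k) :
    inducedGen t m i v k = t • v k := by
  rw [inducedGen_apply, if_pos h]

lemma inducedGen_lt (t : ℂ) {m i k : ℕ} (v : ℕ → Hecke t m) (h : k < i) (hi : i ≤ m) :
    inducedGen t m i v k = heckeNatGen t m (i - 1) * v k := by
  rw [inducedGen_apply, if_neg (by omega), if_pos h]

lemma inducedGen_self (t : ℂ) {m i : ℕ} (v : ℕ → Hecke t m) (hi : i ≤ m) :
    inducedGen t m i v i = (t - 1) • v i + v (i + 1) := by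
  rw [inducedGen_apply, if_neg (by omega), if_neg (by omega), if_pos rfl]

lemma inducedGen_succ (t : ℂ) {m i : ℕ} (v : ℕ → Hecke t m) (hi : i ≤ m) :
    inducedGen t m i v (i + 1) = t • v i := by
  rw [inducedGen_apply, if_neg (by omega), if_neg (by omega), if_neg (by omega), if_pos rfl]

lemma inducedGen_gt (t : ℂ) {m i k : ℕ} (v : ℕ → Hecke t m) (h : i + 1 < k) (hk : k ≤ m + 1) :
    inducedGen t m i v k = heckeNatGen t m i * v k := by
  rw [inducedGen_apply, if_neg (by omega), if_neg (by omega), if_neg (by omega), if_neg (by omega)]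

lemma inducedGen_sq (t : ℂ) {m i : ℕ} (hi : i ≤ m) :
    inducedGen t m i * inducedGen t m i = (t - 1) • inducedGen t m i + t • 1 := by
  ext1 v
  funext k
  simp only [Module.End.mul_apply, LinearMap.add_apply, LinearMap.smul_apply, Module.End.one_apply,
    Pi.add_apply, Pi.smul_apply]
  rcases lt_or_ge (m + 1) k with h | h
  · simp only [inducedGen_above t _ h]
    module
  rcases lt_trichotomy k i with h' | rfl | h'
  · simp only [inducedGen_lt t _ h' hi]
    rw [← mul_assoc, heckeNatGen_sq t (by omega), add_mul, smul_mul_assoc, smul_mul_assoc, one_mul]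
  · simp only [inducedGen_self t _ hi, inducedGen_succ t _ hi]
  rcases eq_or_lt_of_le (Nat.succ_le_of_lt h') with rfl | h'
  · simp only [Nat.succ_eq_add_one, inducedGen_self t _ hi, inducedGen_succ t _ hi]
    module
  · simp only [inducedGen_gt t _ h' h]
    rw [← mul_assoc, heckeNatGen_sq t (by omega), add_mul, smul_mul_assoc, smul_mul_assoc, one_mul]

lemma inducedGen_braid (t : ℂ) {m i : ℕ} (hi : i + 1 ≤ m) :
    inducedGen t m i * inducedGen t m (i + 1) * inducedGen t m i =
      inducedGen t m (i + 1) * inducedGen t m i * inducedGen t m (i + 1) := by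
  have hi' : i ≤ m := by omega
  ext1 v
  funext k
  simp only [Module.End.mul_apply]
  rcases lt_or_ge (m + 1) k with h | h
  · simp only [inducedGen_above t _ h]
  have self := fun w => inducedGen_self t (m := m) (i := i) w hi'
  have succ := fun w => inducedGen_succ t (m := m) (i := i) w hi'
  have self' := fun w => inducedGen_self t (m := m) (i := i + 1) w hi
  have succ' := fun w => inducedGen_succ t (m := m) (i := i + 1) w hi
  have low := fun w => inducedGen_lt t (m := m) (i := i + 1) (k := i) w (by omega) hi
  have high := fun w => inducedGen_gt t (m := m) (i := i) (k := i + 1 + 1) w (by omega) (by omega)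
  simp only [Nat.add_sub_cancel] at low
  have sq : ∀ w, heckeNatGen t m i * (heckeNatGen t m i * w) =
      (t - 1) • (heckeNatGen t m i * w) + t • w := by
    intro w
    rw [← mul_assoc, heckeNatGen_sq t (by omega), add_mul, smul_mul_assoc, smul_mul_assoc, one_mul]
  rcases lt_trichotomy k i with h' | rfl | h'
  · have h1 : k < i + 1 := by omega
    simp only [inducedGen_lt t _ h' hi', inducedGen_lt t _ h1 hi, Nat.add_sub_cancel]
    obtain ⟨j, rfl⟩ : ∃ j, i = j + 1 := ⟨i - 1, by omega⟩
    have := congrArg (· * v k) (heckeNatGen_braid t (m := m) (i := j) (by omega))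
    simpa only [mul_assoc, Nat.add_sub_cancel] using this
  · simp only [self, succ, self', low, high, mul_add, mul_smul_comm, sq]
    module
  rcases eq_or_lt_of_le (Nat.succ_le_of_lt h') with rfl | h'
  · simp only [Nat.succ_eq_add_one, self, succ, self', succ', low, high, mul_add, mul_smul_comm]
    module
  rcases eq_or_lt_of_le (Nat.succ_le_of_lt h') with rfl | h'
  · simp only [Nat.succ_eq_add_one, succ, succ', low, high, mul_smul_comm]
  · simp only [Nat.succ_eq_add_one] at h'
    have h1 : i + 1 < k := by omega
    simp only [inducedGen_gt t _ h1 h, inducedGen_gt t _ h' h]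
    have := congrArg (· * v k) (heckeNatGen_braid t (m := m) (i := i) (by omega))
    simpa only [mul_assoc] using this

lemma inducedGen_comm (t : ℂ) {m i j : ℕ} (hij : i + 2 ≤ j) (hj : j ≤ m) :
    inducedGen t m i * inducedGen t m j = inducedGen t m j * inducedGen t m i := by
  have hi : i ≤ m := by omega
  ext1 v
  funext k
  simp only [Module.End.mul_apply]
  rcases lt_or_ge (m + 1) k with h | h
  · simp only [inducedGen_above t _ h]
  have selfi := fun w => inducedGen_self t (m := m) (i := i) w hi
  have succi := fun w => inducedGen_succ t (m := m) (i := i) w hi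
  have selfj := fun w => inducedGen_self t (m := m) (i := j) w hj
  have succj := fun w => inducedGen_succ t (m := m) (i := j) w hj
  have low := fun w k (hk : k < j) => inducedGen_lt t (m := m) (i := j) (k := k) w hk hj
  have high := fun w k (hk : i + 1 < k) (hk' : k ≤ m + 1) =>
    inducedGen_gt t (m := m) (i := i) (k := k) w hk hk'
  rcases lt_trichotomy k i with h' | rfl | h'
  · have h1 : k < j := by omega
    simp only [inducedGen_lt t _ h' hi, inducedGen_lt t _ h1 hj]
    rw [← mul_assoc, ← mul_assoc, heckeNatGen_comm t m (by omega)]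
  · simp only [selfi, low _ k (by omega), low _ (k + 1) (by omega), mul_add, mul_smul_comm]
  rcases eq_or_lt_of_le (Nat.succ_le_of_lt h') with rfl | h'
  · simp only [Nat.succ_eq_add_one, succi, low _ i (by omega), low _ (i + 1) (by omega),
      mul_smul_comm]
  simp only [Nat.succ_eq_add_one] at h'
  rcases lt_trichotomy k j with h2 | rfl | h2
  · simp only [low _ k h2, high _ k h' h]
    rw [← mul_assoc, ← mul_assoc, heckeNatGen_comm t m (by omega)]
  · simp only [selfj, high _ k h' h, high _ (k + 1) (by omega) (by omega), mul_add,
      mul_smul_comm]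
  rcases eq_or_lt_of_le (Nat.succ_le_of_lt h2) with rfl | h2
  · simp only [Nat.succ_eq_add_one, succj, high _ j (by omega) (by omega),
      high _ (j + 1) (by omega) (by omega), mul_smul_comm]
  · simp only [Nat.succ_eq_add_one] at h2
    simp only [inducedGen_gt t _ h' h, inducedGen_gt t _ h2 h]
    rw [← mul_assoc, ← mul_assoc, heckeNatGen_comm t m hij]

/-- The representation of `H_{m+2}` induced from the regular representation of `H_{m+1}`. -/
noncomputable def inducedRep (t : ℂ) (m : ℕ) :
    Hecke t (m + 1) →ₐ[ℂ] Module.End ℂ (ℕ → Hecke t m) :=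
  RingQuot.liftAlgHom ℂ ⟨FreeAlgebra.lift ℂ fun i : Fin (m + 1) => inducedGen t m i, by
    intro a b hab
    cases hab with
    | comm i k h => simpa using inducedGen_comm t h (Nat.le_of_lt_succ k.2)
    | braid i k h =>
      have := inducedGen_braid t (m := m) (i := i) (by omega)
      simpa [← h] using this
    | quad i =>
      rw [map_mul, map_add, map_mul, AlgHom.commutes, AlgHom.commutes, ← Algebra.smul_def,
        Algebra.algebraMap_eq_smul_one, FreeAlgebra.lift_ι_apply]
      exact inducedGen_sq t (Nat.le_of_lt_succ i.2)⟩

lemma inducedRep_gen (t : ℂ) (m : ℕ) (i : Fin (m + 1)) :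
    inducedRep t m (heckeGen t (m + 1) i) = inducedGen t m i := by
  simp [inducedRep, heckeGen]

lemma inducedGen_mul_right (t : ℂ) (m i : ℕ) (v : ℕ → Hecke t m) (b : Hecke t m) :
    inducedGen t m i (fun k => v k * b) = fun k => inducedGen t m i v k * b := by
  funext k
  simp only [inducedGen_apply]
  split_ifs <;> simp only [smul_mul_assoc, add_mul, mul_assoc]

lemma inducedRep_mul_right (t : ℂ) (m : ℕ) (h : Hecke t (m + 1)) (v : ℕ → Hecke t m)
    (b : Hecke t m) :
    inducedRep t m h (fun k => v k * b) = fun k => inducedRep t m h v k * b := by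
  let S : Submodule ℂ (Hecke t (m + 1)) :=
    { carrier := {h | inducedRep t m h (fun k => v k * b) = fun k => inducedRep t m h v k * b}
      add_mem' := by
        intro x y hx hy
        simp only [Set.mem_ofPred_eq] at *
        rw [map_add, LinearMap.add_apply, hx, hy]
        funext k
        simp [add_mul]
      zero_mem' := by
        simp only [Set.mem_ofPred_eq]
        funext k
        simp
      smul_mem' := by
        intro r x hx
        simp only [Set.mem_ofPred_eq] at *
        rw [map_smul, LinearMap.smul_apply, hx]
        funext k
        simp }
  refine hecke_submodule_eq_top t (m + 1) S ?_ ?_ h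
  · simp [S]
  · intro i a ha
    change _ = _ at ha
    change _ = _
    rw [map_mul, Module.End.mul_apply, ha, inducedRep_gen, inducedGen_mul_right]
    rfl

/-- The product `x_{m-d} ⋯ x_{m-1}` of the last `d` generators. -/
noncomputable def lastProd (t : ℂ) (m : ℕ) : ℕ → Hecke t m
  | 0 => 1
  | d + 1 => heckeNatGen t m (m - (d + 1)) * lastProd t m d

lemma lastProd_comm (t : ℂ) (m : ℕ) {i d : ℕ} (h : i + 1 + d < m) :
    heckeNatGen t m i * lastProd t m d = lastProd t m d * heckeNatGen t m i := by
  induction d with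
  | zero => simp [lastProd]
  | succ d ih =>
    rw [lastProd, ← mul_assoc, heckeNatGen_comm t m (by omega), mul_assoc, ih (by omega), mul_assoc]

lemma lastProd_shift (t : ℂ) (m : ℕ) {i d : ℕ} (h : m ≤ i + d) (hd : d ≤ m) (hi : i + 1 < m) :
    heckeNatGen t m (i + 1) * lastProd t m d = lastProd t m d * heckeNatGen t m i := by
  induction d with
  | zero => omega
  | succ d ih =>
    rcases eq_or_lt_of_le h with h | h
    · obtain ⟨d, rfl⟩ : ∃ e, d = e + 1 := ⟨d - 1, by omega⟩
      have e1 : m - (d + 1 + 1) = i := by omega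
      have e2 : m - (d + 1) = i + 1 := by omega
      simp only [lastProd, e1, e2, mul_assoc]
      rw [← lastProd_comm t m (by omega)]
      have := congrArg (· * lastProd t m d) (heckeNatGen_braid t hi)
      simpa only [mul_assoc] using this.symm
    · rw [lastProd, ← mul_assoc, ← heckeNatGen_comm t m (by omega), mul_assoc,
        ih (by omega) (by omega), mul_assoc]

/-- The values of the conditional expectation on the basis of the induced representation. -/
noncomputable def expCoeff (t z : ℂ) (m k : ℕ) : Hecke t m :=
  if k = m + 1 then 1 else z • lastProd t m (m - k)

lemma expCoeff_step (t z : ℂ) {m i : ℕ} (hi : i < m) :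
    expCoeff t z m i = heckeNatGen t m i * expCoeff t z m (i + 1) := by
  rw [expCoeff, expCoeff, if_neg (by omega), if_neg (by omega),
    show m - i = m - (i + 1) + 1 by omega, lastProd, mul_smul_comm]
  congr 3
  omega

lemma expCoeff_comm (t z : ℂ) {m i k : ℕ} (hik : i + 1 < k) :
    expCoeff t z m k * heckeNatGen t m i = heckeNatGen t m i * expCoeff t z m k := by
  rw [expCoeff]
  split_ifs with h
  · simp
  · rw [smul_mul_assoc, mul_smul_comm]
    by_cases hm : i + 1 < m
    · rw [lastProd_comm t m (by omega)]
    · rw [show m - k = 0 by omega, lastProd, one_mul, mul_one]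

lemma expCoeff_shift (t z : ℂ) {m i k : ℕ} (hik : k ≤ i) (hi : i + 1 < m) :
    expCoeff t z m k * heckeNatGen t m i = heckeNatGen t m (i + 1) * expCoeff t z m k := by
  rw [expCoeff, if_neg (by omega), smul_mul_assoc, mul_smul_comm,
    lastProd_shift t m (by omega) (by omega) hi]

/-- The functional on the induced representation giving the conditional expectation. -/
noncomputable def expFunctional (t z : ℂ) (m : ℕ) : (ℕ → Hecke t m) →ₗ[ℂ] Hecke t m :=
  ∑ k ∈ Finset.range (m + 2), LinearMap.mulLeft ℂ (expCoeff t z m k) ∘ₗ LinearMap.proj k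

lemma expFunctional_apply (t z : ℂ) (m : ℕ) (v : ℕ → Hecke t m) :
    expFunctional t z m v = ∑ k ∈ Finset.range (m + 2), expCoeff t z m k * v k := by
  simp [expFunctional]

lemma expFunctional_inducedGen (t z : ℂ) {m i : ℕ} (hi : i < m) (v : ℕ → Hecke t m) :
    expFunctional t z m (inducedGen t m i v) = heckeNatGen t m i * expFunctional t z m v := by
  have h1 : i ∈ Finset.range (m + 2) := by simp; omega
  have h2 : i + 1 ∈ (Finset.range (m + 2)).erase i := by simp; omega
  rw [expFunctional_apply, expFunctional_apply, Finset.mul_sum, ← Finset.add_sum_erase _ _ h1,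
    ← Finset.add_sum_erase _ _ h2, ← Finset.add_sum_erase _ _ h1, ← Finset.add_sum_erase _ _ h2,
    ← add_assoc, ← add_assoc]
  congr 1
  · rw [inducedGen_self t _ hi.le, inducedGen_succ t _ hi.le, expCoeff_step t z hi]
    rw [← mul_assoc, ← mul_assoc, heckeNatGen_sq t hi]
    simp only [mul_add, add_mul, mul_smul_comm, smul_mul_assoc, mul_assoc, one_mul]
    module
  · refine Finset.sum_congr rfl fun k hk => ?_
    simp only [Finset.mem_erase, Finset.mem_range] at hk
    rcases lt_or_ge k i with h | h
    · obtain ⟨j, rfl⟩ : ∃ j, i = j + 1 := ⟨i - 1, by omega⟩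
      rw [inducedGen_lt t v h hi.le, ← mul_assoc, Nat.add_sub_cancel,
        expCoeff_shift t z (by omega) hi, mul_assoc]
    · rw [inducedGen_gt t v (by omega) (by omega), ← mul_assoc, expCoeff_comm t z (by omega),
        mul_assoc]

/-- There is an `H_{m+1}`-bimodule map `H_{m+2} → H_{m+1}` sending `1` to `1` and the last
generator to `z`. -/
lemma exists_hecke_expectation (t z : ℂ) (m : ℕ) (ι : Hecke t m →ₐ[ℂ] Hecke t (m + 1))
    (hι : ∀ i : Fin m, ι (heckeGen t m i) = heckeGen t (m + 1) i.castSucc) :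
    ∃ E : Hecke t (m + 1) →ₗ[ℂ] Hecke t m, E 1 = 1 ∧
      E (heckeGen t (m + 1) (Fin.last m)) = z • 1 ∧
      (∀ u h, E (ι u * h) = u * E h) ∧ ∀ h u, E (h * ι u) = E h * u := by
  have hgen : ∀ i : Fin m, inducedRep t m (ι (heckeGen t m i)) = inducedGen t m i := by
    intro i
    rw [hι, inducedRep_gen, Fin.val_castSucc]
  have hleft : ∀ u v, expFunctional t z m (inducedRep t m (ι u) v) =
      u * expFunctional t z m v := by
    intro u
    let S : Submodule ℂ (Hecke t m) :=
      { carrier := {u | ∀ v, expFunctional t z m (inducedRep t m (ι u) v) =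
          u * expFunctional t z m v}
        add_mem' := by
          intro x y hx hy v
          simp only [map_add, LinearMap.add_apply, hx v, hy v, add_mul]
        zero_mem' := by
          intro v
          simp
        smul_mem' := by
          intro r x hx v
          simp only [map_smul, LinearMap.smul_apply, hx v, smul_mul_assoc] }
    refine hecke_submodule_eq_top t m S ?_ ?_ u
    · intro v
      simp
    · intro i a ha v
      rw [map_mul, map_mul, Module.End.mul_apply, hgen, expFunctional_inducedGen t z i.2, ha v,
        heckeNatGen_of_lt t i.2, mul_assoc]
  let e : ℕ → Hecke t m := Pi.single (m + 1) 1
  have he : ∀ u, inducedRep t m (ι u) e = fun k => e k * u := by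
    intro u
    let S : Submodule ℂ (Hecke t m) :=
      { carrier := {u | inducedRep t m (ι u) e = fun k => e k * u}
        add_mem' := by
          intro x y hx hy
          simp only [Set.mem_ofPred_eq] at *
          rw [map_add, map_add, LinearMap.add_apply, hx, hy]
          funext k
          simp [mul_add]
        zero_mem' := by
          simp only [Set.mem_ofPred_eq]
          funext k
          simp
        smul_mem' := by
          intro r x hx
          simp only [Set.mem_ofPred_eq] at *
          rw [map_smul, map_smul, LinearMap.smul_apply, hx]
          funext k
          simp }
    refine hecke_submodule_eq_top t m S ?_ ?_ u
    · simp [S]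
    · intro i a ha
      change _ = _ at ha
      change _ = _
      have hi := i.2
      rw [map_mul, map_mul, Module.End.mul_apply, ha, hgen, inducedGen_mul_right]
      funext k
      by_cases hk : k = m + 1
      · subst hk
        rw [inducedGen_gt t _ (by omega) le_rfl, heckeNatGen_of_lt t i.2]
        simp [e]
      · have hk0 : e k = 0 := Pi.single_eq_of_ne hk _
        have hk1 : e i = 0 := Pi.single_eq_of_ne (by omega) _
        have hk2 : e (i + 1) = 0 := Pi.single_eq_of_ne (by omega) _
        simp [inducedGen_apply, hk0, hk1, hk2]
  have hfe : expFunctional t z m e = 1 := by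
    rw [expFunctional_apply, Finset.sum_eq_single (m + 1)]
    · simp [e, expCoeff]
    · intro k _ hk
      simp [e, hk]
    · simp
  refine ⟨expFunctional t z m ∘ₗ LinearMap.applyₗ e ∘ₗ (inducedRep t m).toLinearMap,
    ?_, ?_, ?_, ?_⟩
  · simpa using hfe
  · simp only [LinearMap.comp_apply, AlgHom.toLinearMap_apply, LinearMap.applyₗ_apply_apply,
      inducedRep_gen, Fin.val_last]
    rw [expFunctional_apply, Finset.sum_eq_single m]
    · rw [inducedGen_self t _ le_rfl]
      simp [e, expCoeff, lastProd]
    · intro k _ hk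
      have hm : e m = 0 := Pi.single_eq_of_ne (by omega) _
      by_cases hk' : k = m + 1
      · rw [hk', inducedGen_succ t _ le_rfl, hm]
        simp
      · have hk0 : e k = 0 := Pi.single_eq_of_ne hk' _
        simp [inducedGen_apply, hk0, hk, hk']
    · simp
  · intro u h
    simpa using hleft u _
  · intro h u
    simp only [LinearMap.comp_apply, AlgHom.toLinearMap_apply, LinearMap.applyₗ_apply_apply,
      map_mul, Module.End.mul_apply, he, inducedRep_mul_right]
    simp only [expFunctional_apply, Finset.sum_mul, mul_assoc]

lemma hecke_zero_eq_smul_one {t : ℂ} (a : Hecke t 0) : ∃ r : ℂ, a = r • 1 := by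
  have := hecke_submodule_eq_top t 0 (Submodule.span ℂ {1})
    (Submodule.mem_span_singleton_self 1) (fun i => i.elim0) a
  obtain ⟨r, hr⟩ := Submodule.mem_span_singleton.1 this
  exact ⟨r, hr.symm⟩

section Tower

variable {t : ℂ} {ι : ∀ m : ℕ, Hecke t m →ₐ[ℂ] Hecke t (m + 1)}

lemma hecke_last_comm
    (hι : ∀ (m : ℕ) (i : Fin m), ι m (heckeGen t m i) = heckeGen t (m + 1) i.castSucc)
    (m : ℕ) (w : Hecke t m) :
    heckeGen t (m + 2) (Fin.last (m + 1)) * ι (m + 1) (ι m w) =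
      ι (m + 1) (ι m w) * heckeGen t (m + 2) (Fin.last (m + 1)) := by
  let x := heckeGen t (m + 2) (Fin.last (m + 1))
  let f := ((ι (m + 1)).comp (ι m)).toLinearMap
  refine hecke_submodule_eq_top t m
    (LinearMap.eqLocus (LinearMap.mulLeft ℂ x ∘ₗ f) (LinearMap.mulRight ℂ x ∘ₗ f)) ?_ ?_ w
  · simp [f]
  · intro i a ha
    have hia : x * ι (m + 1) (ι m a) = ι (m + 1) (ι m a) * x := ha
    have hc := heckeGen_comm t (m + 2) i.castSucc.castSucc (Fin.last (m + 1)) (by simp)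
    change x * ι (m + 1) (ι m (heckeGen t m i * a)) = ι (m + 1) (ι m (heckeGen t m i * a)) * x
    rw [map_mul, map_mul, hι, hι, ← mul_assoc, ← hc, mul_assoc, hia, mul_assoc]

lemma heckeGen_castSucc_braid (m : ℕ)
    (hι : ∀ (m : ℕ) (i : Fin m), ι m (heckeGen t m i) = heckeGen t (m + 1) i.castSucc) :
    heckeGen t (m + 2) (Fin.last (m + 1)) * ι (m + 1) (heckeGen t (m + 1) (Fin.last m)) *
        heckeGen t (m + 2) (Fin.last (m + 1)) =
      ι (m + 1) (heckeGen t (m + 1) (Fin.last m)) * heckeGen t (m + 2) (Fin.last (m + 1)) *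
        ι (m + 1) (heckeGen t (m + 1) (Fin.last m)) := by
  rw [hι]
  exact (heckeGen_braid t (m + 2) (Fin.last m).castSucc (Fin.last (m + 1)) (by simp)).symm

/-- The subspace `H_{m+1} + H_{m+1} x_{m+1} H_{m+1}` of `H_{m+2}`. -/
def heckeSpan (ι : ∀ m : ℕ, Hecke t m →ₐ[ℂ] Hecke t (m + 1)) (m : ℕ) :
    Submodule ℂ (Hecke t (m + 1)) :=
  LinearMap.range (ι m).toLinearMap ⊔ Submodule.span ℂ
    (Set.range fun p : Hecke t m × Hecke t m =>
      ι m p.1 * heckeGen t (m + 1) (Fin.last m) * ι m p.2)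

lemma heckeSpan_le {m : ℕ} {S : Submodule ℂ (Hecke t (m + 1))} (h0 : ∀ u, ι m u ∈ S)
    (h1 : ∀ u v, ι m u * heckeGen t (m + 1) (Fin.last m) * ι m v ∈ S) : heckeSpan ι m ≤ S := by
  refine sup_le ?_ (Submodule.span_le.2 ?_)
  · rintro _ ⟨u, rfl⟩
    exact h0 u
  · rintro _ ⟨p, rfl⟩
    exact h1 p.1 p.2

lemma mem_heckeSpan (m : ℕ) (u : Hecke t m) : ι m u ∈ heckeSpan ι m :=
  Submodule.mem_sup_left ⟨u, rfl⟩

lemma mul_mul_mem_heckeSpan (m : ℕ) (u v : Hecke t m) :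
    ι m u * heckeGen t (m + 1) (Fin.last m) * ι m v ∈ heckeSpan ι m :=
  Submodule.mem_sup_right (Submodule.subset_span ⟨(u, v), rfl⟩)

lemma mul_mem_heckeSpan {m : ℕ} (w : Hecke t m) {a : Hecke t (m + 1)} (ha : a ∈ heckeSpan ι m) :
    ι m w * a ∈ heckeSpan ι m := by
  refine heckeSpan_le (S := (heckeSpan ι m).comap (LinearMap.mulLeft ℂ (ι m w))) ?_ ?_ ha
  · intro u
    change ι m w * ι m u ∈ heckeSpan ι m
    rw [← map_mul]
    exact mem_heckeSpan m _
  · intro u v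
    change ι m w * (ι m u * heckeGen t (m + 1) (Fin.last m) * ι m v) ∈ heckeSpan ι m
    rw [← mul_assoc, ← mul_assoc, ← map_mul]
    exact mul_mul_mem_heckeSpan m _ _

lemma last_mul_mem_heckeSpan (m : ℕ) (v : Hecke t m) :
    heckeGen t (m + 1) (Fin.last m) * ι m v ∈ heckeSpan ι m := by
  simpa using mul_mul_mem_heckeSpan (ι := ι) m 1 v

lemma last_mul_last_mul_mem_heckeSpan (m : ℕ) (v : Hecke t m) :
    heckeGen t (m + 1) (Fin.last m) * heckeGen t (m + 1) (Fin.last m) * ι m v ∈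
      heckeSpan ι m := by
  rw [heckeGen_sq, add_mul, smul_mul_assoc, smul_mul_assoc, one_mul]
  exact add_mem (Submodule.smul_mem _ _ (last_mul_mem_heckeSpan m v))
    (Submodule.smul_mem _ _ (mem_heckeSpan m v))

lemma heckeSpan_eq_top_of_last_mul
    (hι : ∀ (m : ℕ) (i : Fin m), ι m (heckeGen t m i) = heckeGen t (m + 1) i.castSucc) {m : ℕ}
    (H : ∀ u v, heckeGen t (m + 1) (Fin.last m) *
      (ι m u * heckeGen t (m + 1) (Fin.last m) * ι m v) ∈ heckeSpan ι m) :
    heckeSpan ι m = ⊤ := by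
  refine eq_top_iff.2 fun a _ => hecke_submodule_eq_top t (m + 1) _ ?_ ?_ a
  · simpa using mem_heckeSpan (ι := ι) m 1
  · intro i a ha
    induction i using Fin.lastCases with
    | last =>
      exact heckeSpan_le (S := (heckeSpan ι m).comap (LinearMap.mulLeft ℂ _))
        (last_mul_mem_heckeSpan m) H ha
    | cast i =>
      rw [← hι]
      exact mul_mem_heckeSpan _ ha

lemma heckeSpan_eq_top
    (hι : ∀ (m : ℕ) (i : Fin m), ι m (heckeGen t m i) = heckeGen t (m + 1) i.castSucc) (m : ℕ) :
    heckeSpan ι m = ⊤ := by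
  induction m with
  | zero =>
    refine heckeSpan_eq_top_of_last_mul hι fun u v => ?_
    obtain ⟨r, rfl⟩ := hecke_zero_eq_smul_one u
    have := Submodule.smul_mem _ r (last_mul_last_mul_mem_heckeSpan (ι := ι) 0 v)
    simpa [mul_assoc] using this
  | succ m ih =>
    refine heckeSpan_eq_top_of_last_mul hι fun u v => ?_
    have h := heckeSpan_le (ι := ι) (m := m) (S := (heckeSpan ι (m + 1)).comap
      (LinearMap.mulLeft ℂ (heckeGen t (m + 2) (Fin.last (m + 1))) ∘ₗ
        LinearMap.mulRight ℂ (heckeGen t (m + 2) (Fin.last (m + 1)) * ι (m + 1) v) ∘ₗ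
          (ι (m + 1)).toLinearMap)) ?_ ?_ (ih.ge (Submodule.mem_top (x := u)))
    · simpa [mul_assoc] using h
    · intro w
      have := mul_mem_heckeSpan (ι m w) (last_mul_last_mul_mem_heckeSpan (ι := ι) (m + 1) v)
      rw [← mul_assoc, ← mul_assoc, ← hecke_last_comm hι] at this
      simpa [mul_assoc] using this
    · intro w w'
      have := mul_mul_mem_heckeSpan (ι := ι) (m + 1)
        (ι m w * heckeGen t (m + 1) (Fin.last m))
        (heckeGen t (m + 1) (Fin.last m) * ι m w' * v)
      have key : ι (m + 1) (ι m w * heckeGen t (m + 1) (Fin.last m)) *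
          heckeGen t (m + 2) (Fin.last (m + 1)) *
          ι (m + 1) (heckeGen t (m + 1) (Fin.last m) * ι m w' * v) =
          heckeGen t (m + 2) (Fin.last (m + 1)) *
          (ι (m + 1) (ι m w * heckeGen t (m + 1) (Fin.last m) * ι m w') *
          (heckeGen t (m + 2) (Fin.last (m + 1)) * ι (m + 1) v)) := by
        simp only [map_mul]
        have hb := heckeGen_castSucc_braid m hι
        have hc := hecke_last_comm hι m w
        have hc' := hecke_last_comm hι m w'
        generalize heckeGen t (m + 2) (Fin.last (m + 1)) = x at *
        generalize ι (m + 1) (heckeGen t (m + 1) (Fin.last m)) = y at *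
        generalize ι (m + 1) (ι m w) = a at *
        generalize ι (m + 1) (ι m w') = b at *
        calc _ = a * (y * x * y) * b * ι (m + 1) v := by simp only [mul_assoc]
          _ = (a * x) * y * (x * b) * ι (m + 1) v := by rw [← hb]; simp only [mul_assoc]
          _ = _ := by rw [← hc, hc']; simp only [mul_assoc]
      rw [key] at this
      exact this

lemma hecke_span
    (hι : ∀ (m : ℕ) (i : Fin m), ι m (heckeGen t m i) = heckeGen t (m + 1) i.castSucc)
    (m : ℕ) (S : Submodule ℂ (Hecke t (m + 1))) (h0 : ∀ u, ι m u ∈ S)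
    (h1 : ∀ u v, ι m u * heckeGen t (m + 1) (Fin.last m) * ι m v ∈ S) (a : Hecke t (m + 1)) :
    a ∈ S :=
  heckeSpan_le h0 h1 ((heckeSpan_eq_top hι m).ge Submodule.mem_top)

/-- The conditional expectation of `x v x` with `x` the last generator. -/
lemma expectation_last_mul_last {z : ℂ}
    (hι : ∀ (m : ℕ) (i : Fin m), ι m (heckeGen t m i) = heckeGen t (m + 1) i.castSucc) {m : ℕ}
    {E : Hecke t (m + 1) →ₗ[ℂ] Hecke t m} {E' : Hecke t (m + 2) →ₗ[ℂ] Hecke t (m + 1)}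
    (E_one : E 1 = 1) (E_last : E (heckeGen t (m + 1) (Fin.last m)) = z • 1)
    (E_left : ∀ u h, E (ι m u * h) = u * E h) (E_right : ∀ h u, E (h * ι m u) = E h * u)
    (E'_one : E' 1 = 1) (E'_last : E' (heckeGen t (m + 2) (Fin.last (m + 1))) = z • 1)
    (E'_left : ∀ u h, E' (ι (m + 1) u * h) = u * E' h)
    (E'_right : ∀ h u, E' (h * ι (m + 1) u) = E' h * u) (v : Hecke t (m + 1)) :
    E' (heckeGen t (m + 2) (Fin.last (m + 1)) * ι (m + 1) v *
      heckeGen t (m + 2) (Fin.last (m + 1))) = ((t - 1) * z) • v + t • ι m (E v) := by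
  have hEι : ∀ u, E (ι m u) = u := fun u => by simpa [E_one] using E_left u 1
  have hb := heckeGen_castSucc_braid m hι
  have hsq := heckeGen_sq t (m + 2) (Fin.last (m + 1))
  have hsq' := heckeGen_sq t (m + 1) (Fin.last m)
  have hc := hecke_last_comm hι m
  generalize heckeGen t (m + 2) (Fin.last (m + 1)) = x at *
  have h := hecke_span hι m (LinearMap.eqLocus
    (E' ∘ₗ LinearMap.mulLeft ℂ x ∘ₗ LinearMap.mulRight ℂ x ∘ₗ (ι (m + 1)).toLinearMap)
    (((t - 1) * z) • LinearMap.id + t • (ι m).toLinearMap ∘ₗ E)) ?_ ?_ v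
  · simpa [mul_assoc] using h
  · intro u
    have : E' (x * (ι (m + 1) (ι m u) * x)) = ((t - 1) * z) • ι m u + t • ι m (E (ι m u)) := by
      rw [← mul_assoc, hc, mul_assoc, E'_left, hsq, map_add, map_smul, map_smul, E'_last, E'_one,
        hEι, mul_add, mul_smul_comm, mul_smul_comm, mul_smul_comm, mul_one, smul_smul]
    exact this
  · intro u w
    generalize heckeGen t (m + 1) (Fin.last m) = y at *
    have : E' (x * (ι (m + 1) (ι m u * y * ι m w) * x)) =
        ((t - 1) * z) • (ι m u * y * ι m w) + t • ι m (E (ι m u * y * ι m w)) := by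
      have e : x * (ι (m + 1) (ι m u * y * ι m w) * x) =
          ι (m + 1) (ι m u * y) * x * ι (m + 1) (y * ι m w) := by
        simp only [map_mul]
        have hcu := hc u
        have hcw := hc w
        generalize ι (m + 1) y = y' at *
        generalize ι (m + 1) (ι m u) = a at *
        generalize ι (m + 1) (ι m w) = b at *
        calc _ = (x * a) * y' * (b * x) := by simp only [mul_assoc]
          _ = a * (x * y' * x) * b := by rw [hcu, ← hcw]; simp only [mul_assoc]
          _ = _ := by rw [hb]; simp only [mul_assoc]
      rw [e, E'_right, E'_left, E'_last, E_right, E_left, E_last]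
      calc _ = z • (ι m u * (y * y) * ι m w) := by
            simp only [mul_smul_comm, smul_mul_assoc, mul_one, mul_assoc]
        _ = _ := by
            rw [hsq']
            simp only [mul_add, add_mul, mul_smul_comm, smul_mul_assoc, mul_one, map_smul, map_mul]
            module
    exact this

end Tower

/-- The one-dimensional representation sending each generator to `t`. -/
noncomputable def heckeIndexRep (t : ℂ) (m : ℕ) : Hecke t m →ₐ[ℂ] ℂ :=
  RingQuot.liftAlgHom ℂ ⟨FreeAlgebra.lift ℂ fun _ => t, by
    intro a b hab
    cases hab with
    | comm i k h => simp
    | braid i k h => simp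
    | quad i =>
      simp
      ring⟩

/-- (Ocneanu) For each nonzero `t, z ∈ ℂ` there is a unique family of `ℂ`-linear maps
`tr_n : H_n(t) → ℂ` with `tr(1) = 1`, `tr(ab) = tr(ba)`, compatibility with the canonical
inclusions `ι_n : H_n(t) → H_{n+1}(t)` (the unital algebra maps fixing the generators),
and the Markov property `tr(ι_n(u) xₙ ι_n(v)) = z · tr(uv)`.  Here `H_{n}(t) = Hecke t (n-1)`,
so the family is indexed by the number of generators `m = n - 1`. -/
theorem ocneanu_trace (t z : ℂ) (ht : t ≠ 0) (hz : z ≠ 0)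
    (ι : ∀ m : ℕ, Hecke t m →ₐ[ℂ] Hecke t (m + 1))
    (hι : ∀ (m : ℕ) (i : Fin m), ι m (heckeGen t m i) = heckeGen t (m + 1) i.castSucc) :
    ∃! tr : ∀ m : ℕ, Hecke t m →ₗ[ℂ] ℂ,
      (∀ m : ℕ, tr m 1 = 1) ∧
      (∀ (m : ℕ) (a b : Hecke t m), tr m (a * b) = tr m (b * a)) ∧
      (∀ (m : ℕ) (u : Hecke t m), tr (m + 1) (ι m u) = tr m u) ∧
      (∀ (m : ℕ) (u v : Hecke t m),
        tr (m + 1) (ι m u * heckeGen t (m + 1) (Fin.last m) * ι m v) = z * tr m (u * v)) := by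
  choose E E_one E_last E_left E_right using fun m => exists_hecke_expectation t z m (ι m) (hι m)
  have hEι : ∀ m u, E m (ι m u) = u := fun m u => by simpa [E_one] using E_left m u 1
  have hEmul : ∀ m u v, E m (ι m u * heckeGen t (m + 1) (Fin.last m) * ι m v) = z • (u * v) := by
    intro m u v
    rw [E_right, E_left, E_last, mul_smul_comm, mul_one, smul_mul_assoc]
  let tr : ∀ m : ℕ, Hecke t m →ₗ[ℂ] ℂ :=
    fun m => Nat.rec (heckeIndexRep t 0).toLinearMap (fun m f => f ∘ₗ E m) m
  have tr_succ : ∀ m a, tr (m + 1) a = tr m (E m a) := fun _ _ => rfl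
  have tr_comm : ∀ (m : ℕ) (a b : Hecke t m), tr m (a * b) = tr m (b * a) := by
    intro m
    induction m with
    | zero =>
      intro a b
      change heckeIndexRep t 0 (a * b) = heckeIndexRep t 0 (b * a)
      rw [map_mul, map_mul, mul_comm]
    | succ m ih =>
      have hF : ∀ u v, tr m (u * E m (heckeGen t (m + 1) (Fin.last m) * ι m v *
            heckeGen t (m + 1) (Fin.last m))) =
          tr m (E m (heckeGen t (m + 1) (Fin.last m) * ι m u *
            heckeGen t (m + 1) (Fin.last m)) * v) := by
        intro u v
        cases m with
        | zero =>
          obtain ⟨r, rfl⟩ := hecke_zero_eq_smul_one u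
          obtain ⟨s, rfl⟩ := hecke_zero_eq_smul_one v
          simp [mul_left_comm]
        | succ m =>
          rw [expectation_last_mul_last hι (E_one m) (E_last m) (E_left m) (E_right m)
              (E_one (m + 1)) (E_last (m + 1)) (E_left (m + 1)) (E_right (m + 1)),
            expectation_last_mul_last hι (E_one m) (E_last m) (E_left m) (E_right m)
              (E_one (m + 1)) (E_last (m + 1)) (E_left (m + 1)) (E_right (m + 1))]
          simp only [mul_add, add_mul, map_add, mul_smul_comm, smul_mul_assoc, map_smul, tr_succ,
            E_left, E_right]
      have hlast : ∀ a, tr (m + 1) (a * heckeGen t (m + 1) (Fin.last m)) =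
          tr (m + 1) (heckeGen t (m + 1) (Fin.last m) * a) := by
        intro a
        refine hecke_span hι m (LinearMap.eqLocus
          (tr (m + 1) ∘ₗ LinearMap.mulRight ℂ (heckeGen t (m + 1) (Fin.last m)))
          (tr (m + 1) ∘ₗ LinearMap.mulLeft ℂ (heckeGen t (m + 1) (Fin.last m)))) ?_ ?_ a
        · intro u
          change tr m (E m (ι m u * _)) = tr m (E m (_ * ι m u))
          rw [E_left, E_right, E_last, mul_smul_comm, smul_mul_assoc, mul_one, one_mul]
        · intro u v
          change tr m (E m _) = tr m (E m _)
          simp only [LinearMap.mulRight_apply, LinearMap.mulLeft_apply]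
          rw [mul_assoc, mul_assoc, E_left, ← mul_assoc, hF, ← E_right]
          simp only [mul_assoc]
      intro a b
      let S : Submodule ℂ (Hecke t (m + 1)) :=
        ⨅ a, LinearMap.eqLocus (tr (m + 1) ∘ₗ LinearMap.mulLeft ℂ a)
          (tr (m + 1) ∘ₗ LinearMap.mulRight ℂ a)
      have hS : ∀ b, b ∈ S ↔ ∀ a, tr (m + 1) (a * b) = tr (m + 1) (b * a) := fun b => by
        simp [S, Submodule.mem_iInf]
      refine (hS b).1 (hecke_submodule_eq_top t (m + 1) S ?_ ?_ b) a
      · simp [hS]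
      · intro i b hb
        rw [hS] at hb ⊢
        have hgen : ∀ a, tr (m + 1) (a * heckeGen t (m + 1) i) =
            tr (m + 1) (heckeGen t (m + 1) i * a) := by
          induction i using Fin.lastCases with
          | last => exact hlast
          | cast i =>
            intro a
            rw [← hι, tr_succ, tr_succ, E_left, E_right, ih]
        intro a
        rw [← mul_assoc, hb, ← mul_assoc, hgen, mul_assoc]
  refine ⟨tr, ⟨?_, tr_comm, ?_, ?_⟩, ?_⟩
  · intro m
    induction m with
    | zero => exact map_one (heckeIndexRep t 0)
    | succ m ih => rw [tr_succ, E_one, ih]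
  · intro m u
    rw [tr_succ, hEι]
  · intro m u v
    rw [tr_succ, hEmul, map_smul, smul_eq_mul]
  · rintro tr' ⟨h1, -, h3, h4⟩
    funext m
    induction m with
    | zero =>
      ext1 a
      obtain ⟨r, rfl⟩ := hecke_zero_eq_smul_one a
      rw [map_smul, map_smul, h1]
      exact congrArg (r • ·) (map_one (heckeIndexRep t 0)).symm
    | succ m ih =>
      refine LinearMap.ext fun a => ?_
      refine hecke_span hι m (LinearMap.eqLocus (tr' (m + 1)) (tr (m + 1))) ?_ ?_ a
      · intro u
        change tr' (m + 1) _ = tr (m + 1) _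
        rw [h3, ih, tr_succ, hEι]
      · intro u v
        change tr' (m + 1) _ = tr (m + 1) _
        rw [h4, ih, tr_succ, hEmul, map_smul, smul_eq_mul]
end

section
/- For every n ≥ 1, the fundamental group of the unordered configuration space C_{0,n}(ℂ) of n points in the complex plane (at any basepoint) is isomorphic to the braid group B_n given by Artin's classical presentation. -/
/-- The set of relators for Artin's classical presentation of the braid group `Bₙ`:
generators `σ₁, …, σ_{n-1}` (indexed by `Fin (n-1)`), with relations
`σᵢ σₖ = σₖ σᵢ` when `|i - k| ≥ 2` and `σᵢ σ_{i+1} σᵢ = σ_{i+1} σᵢ σ_{i+1}`. -/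
def braidRels (n : ℕ) : Set (FreeGroup (Fin (n - 1))) :=
  {w | (∃ i k : Fin (n - 1), (i : ℕ) + 2 ≤ (k : ℕ) ∧
          w = FreeGroup.of i * FreeGroup.of k * (FreeGroup.of k * FreeGroup.of i)⁻¹) ∨
       (∃ i k : Fin (n - 1), (i : ℕ) + 1 = (k : ℕ) ∧
          w = FreeGroup.of i * FreeGroup.of k * FreeGroup.of i *
              (FreeGroup.of k * FreeGroup.of i * FreeGroup.of k)⁻¹)}

/-- The braid group `Bₙ`, given by Artin's classical presentation. -/
abbrev BraidGroup (n : ℕ) : Type := PresentedGroup (braidRels n)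

/-- The ordered configuration space of `n` points in `ℂ`: tuples `(z₁, …, zₙ)` with
`zᵢ ≠ zⱼ` for `i ≠ j`, i.e. injective functions `Fin n → ℂ`, with the subspace topology. -/
abbrev OrderedConfig (n : ℕ) : Type := {f : Fin n → ℂ // Function.Injective f}

/-- Two ordered configurations are identified iff they differ by a permutation
of the coordinates (the action of the symmetric group `Σₙ`). -/
def configSetoid (n : ℕ) : Setoid (OrderedConfig n) where
  r x y := ∃ π : Equiv.Perm (Fin n), x.1 ∘ π = y.1
  iseqv := by
    constructor
    · exact fun x => ⟨Equiv.refl _, rfl⟩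
    · rintro x y ⟨π, h⟩
      refine ⟨π.symm, funext fun i => ?_⟩
      have := congrFun h (π.symm i)
      simpa using this.symm
    · rintro x y z ⟨π, h⟩ ⟨ρ, h'⟩
      refine ⟨ρ.trans π, funext fun i => ?_⟩
      have h1 := congrFun h (ρ i)
      have h2 := congrFun h' i
      simp only [Function.comp_apply] at h1 h2 ⊢
      simpa [Equiv.trans_apply] using h1.trans h2

/-- The unordered configuration space `C_{0,n}(ℂ) = C_{0,n̂}(ℂ)/Σₙ`, with the
quotient topology. -/
abbrev UnorderedConfig (n : ℕ) : Type := Quotient (configSetoid n)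

namespace BraidConfig

open CategoryTheory Topology

variable {n : ℕ}

/-- The left position of the `i`-th pair of adjacent positions. -/
def lo (i : Fin (n - 1)) : Fin n := ⟨i, by omega⟩

/-- The right position of the `i`-th pair of adjacent positions. -/
def hi (i : Fin (n - 1)) : Fin n := ⟨i + 1, by omega⟩

/-- The transposition of the `i`-th pair of adjacent positions. -/
def adj (i : Fin (n - 1)) : Equiv.Perm (Fin n) := Equiv.swap (lo i) (hi i)

lemma lo_lt_hi (i : Fin (n - 1)) : lo i < hi i := by simp [lo, hi, Fin.lt_def]

@[simp] lemma adj_lo (i : Fin (n - 1)) : adj i (lo i) = hi i := Equiv.swap_apply_left _ _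

@[simp] lemma adj_hi (i : Fin (n - 1)) : adj i (hi i) = lo i := Equiv.swap_apply_right _ _

@[simp] lemma adj_adj (i : Fin (n - 1)) (a : Fin n) : adj i (adj i a) = a :=
  Equiv.Perm.congr_fun (Equiv.swap_mul_self (lo i) (hi i)) a

lemma coe_adj (i : Fin (n - 1)) (a : Fin n) :
    (adj i a : ℕ) =
      if (a : ℕ) = i then (i : ℕ) + 1 else if (a : ℕ) = i + 1 then (i : ℕ) else a := by
  simp only [adj, Equiv.swap_apply_def, lo, hi, Fin.ext_iff]
  split_ifs <;> rfl

lemma adj_of_ne {i : Fin (n - 1)} {a : Fin n} (h : (a : ℕ) ≠ i) (h' : (a : ℕ) ≠ i + 1) :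
    adj i a = a := by
  ext; rw [coe_adj, if_neg h, if_neg h']

lemma adj_lo_of_lt {i k : Fin (n - 1)} (h : (i : ℕ) < k) : adj k (lo i) = lo i :=
  adj_of_ne (by simp only [lo]; omega) (by simp only [lo]; omega)

lemma adj_hi_of_lt {i k : Fin (n - 1)} (h : (i : ℕ) < k) : adj i (hi k) = hi k :=
  adj_of_ne (by simp only [hi]; omega) (by simp only [hi]; omega)

lemma adj_hi_of_add_two_le {i k : Fin (n - 1)} (h : (i : ℕ) + 2 ≤ k) : adj k (hi i) = hi i :=
  adj_of_ne (by simp only [hi]; omega) (by simp only [hi]; omega)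

lemma adj_lo_of_add_two_le {i k : Fin (n - 1)} (h : (i : ℕ) + 2 ≤ k) : adj i (lo k) = lo k :=
  adj_of_ne (by simp only [lo]; omega) (by simp only [lo]; omega)

lemma lo_eq_hi {i k : Fin (n - 1)} (h : (i : ℕ) + 1 = k) : lo k = hi i := by
  ext; simp [lo, hi, h]

lemma adj_lt_adj {i : Fin (n - 1)} {a b : Fin n} (hab : a < b) (h : ¬(a = lo i ∧ b = hi i)) :
    adj i a < adj i b := by
  rw [Fin.lt_def] at hab ⊢
  rw [coe_adj, coe_adj]
  simp only [lo, hi, Fin.ext_iff] at h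
  split_ifs <;> omega

lemma adj_comm {i k : Fin (n - 1)} (h : (i : ℕ) + 2 ≤ k) (a : Fin n) :
    adj i (adj k a) = adj k (adj i a) := by
  ext
  simp only [coe_adj]
  grind

lemma adj_braid {i k : Fin (n - 1)} (h : (i : ℕ) + 1 = k) (a : Fin n) :
    adj i (adj k (adj i a)) = adj k (adj i (adj k a)) := by
  ext
  simp only [coe_adj]
  grind

/-- The pairs of positions at which the values of `y` are in the wrong order. -/
noncomputable def inversions (y : Fin n → ℝ) : Finset (Fin n × Fin n) :=
  Finset.univ.filter fun p ↦ p.1 < p.2 ∧ y p.2 < y p.1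

lemma card_inversions_comp_adj {y : Fin n → ℝ} {i : Fin (n - 1)} (h : y (hi i) < y (lo i)) :
    (inversions (y ∘ adj i)).card < (inversions y).card := by
  have hmem : (lo i, hi i) ∈ inversions y := by simp [inversions, lo_lt_hi, h]
  refine lt_of_le_of_lt ?_ (Finset.card_erase_lt_of_mem hmem)
  refine Finset.card_le_card_of_injOn (fun p ↦ (adj i p.1, adj i p.2)) ?_ ?_
  · rintro ⟨a, b⟩ hp
    simp only [inversions, Finset.coe_filter, Finset.mem_univ, true_and, Set.mem_ofPred_eq,
      Function.comp_apply] at hp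
    have hne : ¬(a = lo i ∧ b = hi i) := by
      rintro ⟨rfl, rfl⟩
      simp only [adj_lo, adj_hi] at hp
      exact lt_asymm h hp.2
    have hlt := adj_lt_adj hp.1 hne
    simp only [Finset.coe_erase, Set.mem_sdiff, Set.mem_singleton_iff, Prod.mk.injEq, inversions,
      Finset.coe_filter, Finset.mem_univ, true_and, Set.mem_ofPred_eq]
    refine ⟨⟨hlt, hp.2⟩, ?_⟩
    rintro ⟨h1, h2⟩
    have ha : a = hi i := by rw [← adj_adj i a, h1, adj_lo]
    have hb : b = lo i := by rw [← adj_adj i b, h2, adj_hi]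
    rw [ha, hb] at hp
    exact lt_asymm hp.1 (lo_lt_hi i)
  · rintro ⟨a, b⟩ - ⟨c, d⟩ - h
    simpa using h

lemma monotone_of_no_descent {y : Fin n → ℝ} (h : ∀ i : Fin (n - 1), y (lo i) ≤ y (hi i)) :
    Monotone y := by
  obtain _ | m := n
  · intro a; exact a.elim0
  · exact Fin.monotone_iff_le_succ.mpr fun i ↦ h i

/-- The `i`-th Artin generator. -/
def sigma (i : Fin (n - 1)) : BraidGroup n := PresentedGroup.of i

lemma sigma_comm {i k : Fin (n - 1)} (h : (i : ℕ) + 2 ≤ k) :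
    sigma i * sigma k = sigma k * sigma i := by
  have := PresentedGroup.one_of_mem (rels := braidRels n)
    (x := FreeGroup.of i * FreeGroup.of k * (FreeGroup.of k * FreeGroup.of i)⁻¹)
    (Or.inl ⟨i, k, h, rfl⟩)
  rw [map_mul, map_inv, mul_inv_eq_one, map_mul, map_mul] at this
  exact this

lemma sigma_braid {i k : Fin (n - 1)} (h : (i : ℕ) + 1 = k) :
    sigma i * sigma k * sigma i = sigma k * sigma i * sigma k := by
  have := PresentedGroup.one_of_mem (rels := braidRels n)
    (x := FreeGroup.of i * FreeGroup.of k * FreeGroup.of i *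
      (FreeGroup.of k * FreeGroup.of i * FreeGroup.of k)⁻¹)
    (Or.inr ⟨i, k, h, rfl⟩)
  rw [map_mul, map_inv, mul_inv_eq_one, map_mul, map_mul, map_mul, map_mul] at this
  exact this

open Classical in
/-- The positive braid that sorts the heights `y`. -/
noncomputable def sortBraid (y : Fin n → ℝ) : BraidGroup n :=
  if h : ∃ i : Fin (n - 1), y (hi i) < y (lo i) then
    sortBraid (y ∘ adj h.choose) * sigma h.choose
  else 1
termination_by (inversions y).card
decreasing_by exact card_inversions_comp_adj h.choose_spec

lemma sortBraid_of_monotone {y : Fin n → ℝ} (hy : Monotone y) : sortBraid y = 1 := by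
  rw [sortBraid, dif_neg]
  rintro ⟨i, h⟩
  exact h.not_ge (hy (lo_lt_hi i).le)

lemma sortBraid_eq_mul_aux (N : ℕ) : ∀ y : Fin n → ℝ, (inversions y).card < N →
    ∀ i : Fin (n - 1), y (hi i) < y (lo i) → sortBraid y = sortBraid (y ∘ adj i) * sigma i := by
  induction N with
  | zero => intro y hy; omega
  | succ N ih =>
    have key : ∀ y : Fin n → ℝ, (inversions y).card < N + 1 → ∀ i k : Fin (n - 1),
        (i : ℕ) < k → y (hi i) < y (lo i) → y (hi k) < y (lo k) →
        sortBraid (y ∘ adj i) * sigma i = sortBraid (y ∘ adj k) * sigma k := by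
      intro y hN i k hik hi' hk
      have hyi := card_inversions_comp_adj hi'
      have hyk := card_inversions_comp_adj hk
      rcases Nat.lt_or_ge (i + 1 : ℕ) k with h2 | h2
      · have e1 := adj_lo_of_add_two_le h2
        have e2 := adj_hi_of_lt hik
        have e3 := adj_lo_of_lt hik
        have e4 := adj_hi_of_add_two_le h2
        rw [ih (y ∘ adj i) (by omega) k (by simpa [e1, e2] using hk),
          ih (y ∘ adj k) (by omega) i (by simpa [e3, e4] using hi'), mul_assoc, mul_assoc,
          sigma_comm h2]
        congr 2
        ext a
        simp [adj_comm h2]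
      · have h1 : (i : ℕ) + 1 = k := by omega
        have e0 := lo_eq_hi h1
        have e1 := adj_hi_of_lt hik
        have e2 := adj_lo_of_lt hik
        have e3 : adj k (hi i) = hi k := by rw [← e0, adj_lo]
        have e4 : adj k (hi k) = hi i := by rw [← e0, adj_hi]
        rw [e0] at hk
        have d1 : (y ∘ adj i) (hi k) < (y ∘ adj i) (lo k) := by
          rw [e0]; simpa only [Function.comp_apply, e1, adj_hi] using hk.trans hi'
        have d2 : ((y ∘ adj i) ∘ adj k) (hi i) < ((y ∘ adj i) ∘ adj k) (lo i) := by
          simpa only [Function.comp_apply, e1, e2, e3, adj_lo] using hk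
        have d3 : (y ∘ adj k) (hi i) < (y ∘ adj k) (lo i) := by
          simpa only [Function.comp_apply, e2, e3] using hk.trans hi'
        have d4 : ((y ∘ adj k) ∘ adj i) (hi k) < ((y ∘ adj k) ∘ adj i) (lo k) := by
          rw [e0]; simpa only [Function.comp_apply, e1, e2, e4, adj_hi] using hi'
        have := card_inversions_comp_adj d1
        have := card_inversions_comp_adj d3
        rw [ih (y ∘ adj i) (by omega) k d1, ih _ (by omega) i d2,
          ih (y ∘ adj k) (by omega) i d3, ih _ (by omega) k d4]
        have : ((y ∘ adj i) ∘ adj k) ∘ adj i = ((y ∘ adj k) ∘ adj i) ∘ adj k := by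
          ext a; simp [adj_braid h1]
        simp only [this, mul_assoc]
        congr 1
        simpa only [mul_assoc] using sigma_braid h1
    intro y hN i hyi
    have hex : ∃ i : Fin (n - 1), y (hi i) < y (lo i) := ⟨i, hyi⟩
    rw [sortBraid, dif_pos hex]
    rcases lt_trichotomy (hex.choose : ℕ) i with h | h | h
    · exact key y hN _ _ h hex.choose_spec hyi
    · rw [Fin.ext h]
    · exact (key y hN _ _ h hyi hex.choose_spec).symm

lemma sortBraid_eq_mul {y : Fin n → ℝ} {i : Fin (n - 1)} (h : y (hi i) < y (lo i)) :
    sortBraid y = sortBraid (y ∘ adj i) * sigma i :=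
  sortBraid_eq_mul_aux _ y (Nat.lt_succ_self _) i h

/-- The heights (imaginary parts) of a tuple of complex numbers. -/
def height (ζ : Fin n → ℂ) (a : Fin n) : ℝ := (ζ a).im

lemma height_comp (ζ : Fin n → ℂ) (w : Equiv.Perm (Fin n)) : height (ζ ∘ w) = height ζ ∘ w := rfl

variable (n) in
/-- The tuples in which any two points of the same height appear from left to right. -/
def chartSet : Set (Fin n → ℂ) := {ζ | ∀ a b, a < b → ζ b - ζ a ∈ Complex.slitPlane}

lemma mem_chartSet_iff {ζ : Fin n → ℂ} : ζ ∈ chartSet n ↔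
    ∀ a b, a < b → height ζ a = height ζ b → (ζ a).re < (ζ b).re := by
  refine forall₂_congr fun a b ↦ forall_congr' fun _ ↦ ?_
  rw [Complex.mem_slitPlane_iff, Complex.sub_re, Complex.sub_im, sub_pos, sub_ne_zero, height,
    height, or_iff_not_imp_right, not_not, eq_comm]

lemma isOpen_chartSet : IsOpen (chartSet n) := by
  simp only [chartSet, Set.ofPred_forall]
  exact isOpen_iInter_of_finite fun a ↦ isOpen_iInter_of_finite fun b ↦
    isOpen_iInter_of_finite fun _ ↦ Complex.isOpen_slitPlane.preimage (by fun_prop)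

lemma mem_chartSet_of_re_strictMono {ζ : Fin n → ℂ} (h : StrictMono fun a ↦ (ζ a).re) :
    ζ ∈ chartSet n :=
  mem_chartSet_iff.mpr fun _ _ hab _ ↦ h hab

lemma mem_chartSet_of_height_injective {ζ : Fin n → ℂ} (h : Function.Injective (height ζ)) :
    ζ ∈ chartSet n :=
  mem_chartSet_iff.mpr fun _ _ hab e ↦ absurd (h e) hab.ne

lemma injective_of_mem_chartSet {ζ : Fin n → ℂ} (h : ζ ∈ chartSet n) : Function.Injective ζ := by
  intro a b hab
  rw [mem_chartSet_iff] at h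
  rcases lt_trichotomy a b with hlt | heq | hlt
  · exact absurd (h a b hlt (by simp [height, hab])) (by simp [hab])
  · exact heq
  · exact absurd (h b a hlt (by simp [height, hab])) (by simp [hab])

lemma comp_adj_mem {ζ : Fin n → ℂ} (h : ζ ∈ chartSet n) {i : Fin (n - 1)}
    (hi' : height ζ (hi i) < height ζ (lo i)) : ζ ∘ adj i ∈ chartSet n := by
  rw [mem_chartSet_iff] at h ⊢
  intro a b hab e
  by_cases hp : a = lo i ∧ b = hi i
  · obtain ⟨rfl, rfl⟩ := hp
    simp only [height_comp, Function.comp_apply, adj_lo, adj_hi] at e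
    exact absurd e hi'.ne
  · exact h _ _ (adj_lt_adj hab hp) e

lemma segment_subset_chartSet {ζ η : Fin n → ℂ} (hζ : ζ ∈ chartSet n) (hη : η ∈ chartSet n)
    (h : height ζ = height η) : segment ℝ ζ η ⊆ chartSet n := by
  rw [mem_chartSet_iff] at hζ hη
  rintro _ ⟨s, t, hs, ht, hst, rfl⟩
  rw [mem_chartSet_iff]
  intro a b hab e
  have hz (c : Fin n) : height (s • ζ + t • η) c = height ζ c := by
    have : (η c).im = (ζ c).im := (congrFun h c).symm
    simp [height, this, ← add_mul, hst]
  rw [hz, hz] at e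
  have h1 := hζ a b hab e
  have h2 := hη a b hab (by rwa [← h])
  simp only [Pi.add_apply, Pi.smul_apply, Complex.add_re, Complex.real_smul, Complex.mul_re,
    Complex.ofReal_re, Complex.ofReal_im, zero_mul, sub_zero]
  rcases hs.eq_or_lt with rfl | hs
  · have : t = 1 := by linarith
    subst this; linarith
  · nlinarith [mul_lt_mul_of_pos_left h1 hs, mul_le_mul_of_nonneg_left h2.le ht]

/-- The equally spaced tuple on the real line. -/
def base (n : ℕ) : chartSet n :=
  ⟨fun a ↦ ((a : ℕ) : ℂ), mem_chartSet_of_re_strictMono fun a b h ↦ by simpa using h⟩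

lemma starConvex_chartSet : StarConvex ℝ (base n).1 (chartSet n) := by
  intro ζ hζ s t hs ht hst
  rw [mem_chartSet_iff] at hζ ⊢
  intro a b hab e
  have hab' : ((a : ℕ) : ℝ) < (b : ℕ) := by exact_mod_cast hab
  simp only [height, base, Pi.add_apply, Pi.smul_apply, Complex.add_re, Complex.add_im,
    Complex.real_smul, Complex.mul_re, Complex.mul_im, Complex.natCast_re, Complex.natCast_im,
    Complex.ofReal_re, Complex.ofReal_im, zero_mul, sub_zero, mul_zero, zero_add, add_zero] at e ⊢
  rcases ht.eq_or_lt with rfl | ht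
  · have : s = 1 := by linarith
    subst this; linarith
  · have := hζ a b hab (mul_left_cancel₀ ht.ne' e)
    nlinarith [mul_lt_mul_of_pos_left this ht, mul_le_mul_of_nonneg_left hab'.le hs]

instance : ContractibleSpace (chartSet n) :=
  starConvex_chartSet.contractibleSpace ⟨_, (base n).2⟩

/-- Induction along bubble sort by height. -/
lemma bubble_induction {P : (Fin n → ℂ) → Prop}
    (mono : ∀ ζ ∈ chartSet n, Monotone (height ζ) → P ζ)
    (step : ∀ ζ ∈ chartSet n, ∀ i, height ζ (hi i) < height ζ (lo i) → ζ ∘ adj i ∈ chartSet n →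
      P (ζ ∘ adj i) → P ζ) : ∀ ζ ∈ chartSet n, P ζ := by
  suffices ∀ N, ∀ ζ ∈ chartSet n, (inversions (height ζ)).card < N → P ζ from
    fun ζ hζ ↦ this _ ζ hζ (Nat.lt_succ_self _)
  intro N
  induction N with
  | zero => intro ζ _ h; omega
  | succ N ih =>
    intro ζ hζ hN
    by_cases hm : ∃ i : Fin (n - 1), height ζ (hi i) < height ζ (lo i)
    · obtain ⟨i, h⟩ := hm
      have hc := comp_adj_mem hζ h
      refine step ζ hζ i h hc (ih _ hc ?_)
      have := card_inversions_comp_adj h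
      rw [height_comp]
      omega
    · push Not at hm
      exact mono ζ hζ (monotone_of_no_descent hm)

/-- The lexicographic key (height, real part) of the points of a tuple. -/
def lexKey (ζ : Fin n → ℂ) (a : Fin n) : ℝ ×ₗ ℝ := toLex ((ζ a).im, (ζ a).re)

lemma lexKey_monotone {ζ : Fin n → ℂ} (h : ζ ∈ chartSet n) (hm : Monotone (height ζ)) :
    Monotone (lexKey ζ) := by
  intro a b hab
  rcases hab.eq_or_lt with rfl | hab
  · exact le_rfl
  · rw [lexKey, lexKey, Prod.Lex.toLex_le_toLex]
    rcases (hm hab.le).eq_or_lt with e | e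
    · exact Or.inr ⟨e, (mem_chartSet_iff.mp h a b hab e).le⟩
    · exact Or.inl e

lemma lexKey_injective {z : Fin n → ℂ} (hz : Function.Injective z) :
    Function.Injective (lexKey z) := by
  intro a b h
  have := congrArg ofLex h
  simp only [lexKey, ofLex_toLex, Prod.mk.injEq] at this
  exact hz (Complex.ext this.2 this.1)

lemma exists_sorted {z : Fin n → ℂ} (hz : Function.Injective z) :
    ∃ w : Equiv.Perm (Fin n), z ∘ w ∈ chartSet n ∧ Monotone (height (z ∘ w)) := by
  have hm : Monotone (lexKey z ∘ Tuple.sort (lexKey z)) := Tuple.monotone_sort (lexKey z)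
  refine ⟨Tuple.sort (lexKey z), mem_chartSet_iff.mpr fun a b hab e ↦ ?_, fun a b hab ↦ ?_⟩
  · have h1 := hm.strictMono_of_injective
      ((lexKey_injective hz).comp (Equiv.injective _)) hab
    simp only [Function.comp_apply, lexKey, Prod.Lex.toLex_lt_toLex] at h1
    rcases h1 with h1 | h1
    · exact absurd e h1.ne
    · exact h1.2
  · have h1 := hm hab
    simp only [Function.comp_apply, lexKey, Prod.Lex.toLex_le_toLex] at h1
    rcases h1 with h1 | h1
    · exact h1.le
    · exact h1.1.le

lemma sorted_unique {z : Fin n → ℂ} {w v : Equiv.Perm (Fin n)} (hz : Function.Injective z)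
    (hw : z ∘ w ∈ chartSet n) (hw' : Monotone (height (z ∘ w)))
    (hv : z ∘ v ∈ chartSet n) (hv' : Monotone (height (z ∘ v))) : w = v := by
  have := Tuple.unique_monotone (f := lexKey z) (σ := w) (τ := v)
    (lexKey_monotone hw hw') (lexKey_monotone hv hv')
  ext a
  exact congrArg Fin.val (lexKey_injective hz (congrFun this a))

/-- Sorting a perturbation of a tuple first sorts the tuple itself. -/
lemma exists_sortBraid_refine : ∀ ζ ∈ chartSet n, ∃ u : Equiv.Perm (Fin n),
    ζ ∘ u ∈ chartSet n ∧ Monotone (height (ζ ∘ u)) ∧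
    ∀ y : Fin n → ℝ, (∀ a b, height ζ a < height ζ b → y a < y b) →
      sortBraid y = sortBraid (y ∘ u) * sortBraid (height ζ) := by
  refine bubble_induction ?_ ?_
  · intro ζ hζ hm
    exact ⟨1, hζ, hm, fun y _ ↦ by simp [sortBraid_of_monotone hm]⟩
  · rintro ζ hζ i h - ⟨u, hu, hm, H⟩
    refine ⟨adj i * u, hu, hm, fun y hy ↦ ?_⟩
    rw [sortBraid_eq_mul (hy _ _ h), sortBraid_eq_mul h, H (y ∘ adj i) fun a b ↦ hy _ _,
      height_comp, mul_assoc]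
    rfl

/-- The change of coordinates between two orderings of the same configuration. -/
noncomputable def transition (z : Fin n → ℂ) (w v : Equiv.Perm (Fin n)) : BraidGroup n :=
  (sortBraid (height (z ∘ v)))⁻¹ * sortBraid (height (z ∘ w))

lemma transition_locally_constant {z : Fin n → ℂ} (hz : Function.Injective z)
    {w v : Equiv.Perm (Fin n)} (hw : z ∘ w ∈ chartSet n) (hv : z ∘ v ∈ chartSet n) :
    ∀ᶠ z' in 𝓝 z, transition z' w v = transition z w v := by
  have hev : ∀ᶠ z' in 𝓝 z, ∀ a b, height z a < height z b → height z' a < height z' b := by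
    refine Filter.eventually_all.mpr fun a ↦ Filter.eventually_all.mpr fun b ↦
      Filter.eventually_imp_distrib_left.mpr fun h ↦ ?_
    have hc (c : Fin n) : Continuous fun z' : Fin n → ℂ ↦ height z' c := by
      unfold height; fun_prop
    exact (hc a).continuousAt.eventually_lt (hc b).continuousAt h
  filter_upwards [hev] with z' hz'
  obtain ⟨u, hu, hum, Hu⟩ := exists_sortBraid_refine _ hw
  obtain ⟨t, ht, htm, Ht⟩ := exists_sortBraid_refine _ hv
  have hut : w * u = v * t := sorted_unique hz hu hum ht htm
  have e : (height z' ∘ w) ∘ u = (height z' ∘ v) ∘ t := by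
    ext a
    exact congrArg (height z') (Equiv.Perm.congr_fun hut a)
  rw [transition, transition, height_comp z' w, height_comp z' v,
    Hu (height z' ∘ w) fun a b ↦ hz' _ _, Ht (height z' ∘ v) fun a b ↦ hz' _ _, e]
  group

/-- The chart points with a descent at the `i`-th pair of adjacent positions. -/
def descentSet (i : Fin (n - 1)) : Set (Fin n → ℂ) :=
  {ζ | ζ ∈ chartSet n ∧ height ζ (hi i) < height ζ (lo i)}

lemma joinedIn_descentSet_of_height_eq {i : Fin (n - 1)} {ζ η : Fin n → ℂ}
    (hζ : ζ ∈ descentSet i) (hη : η ∈ descentSet i) (h : height ζ = height η) :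
    JoinedIn (descentSet i) ζ η := by
  refine JoinedIn.of_segment_subset fun z hz ↦ ⟨segment_subset_chartSet hζ.1 hη.1 h hz, ?_⟩
  obtain ⟨s, t, hs, ht, hst, rfl⟩ := hz
  have hz (c : Fin n) : height (s • ζ + t • η) c = height ζ c := by
    have : (η c).im = (ζ c).im := (congrFun h c).symm
    simp [height, this, ← add_mul, hst]
  rw [hz, hz]
  exact hζ.2

/-- The tuple with given heights and equally spaced real parts. -/
def spread (y : Fin n → ℝ) (a : Fin n) : ℂ := ⟨(a : ℕ), y a⟩

lemma spread_mem (y : Fin n → ℝ) : spread y ∈ chartSet n :=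
  mem_chartSet_of_re_strictMono fun a b h ↦ by simpa [spread] using h

lemma joinedIn_descentSet {i : Fin (n - 1)} {ζ η : Fin n → ℂ}
    (hζ : ζ ∈ descentSet i) (hη : η ∈ descentSet i) : JoinedIn (descentSet i) ζ η := by
  have mem {ζ : Fin n → ℂ} (h : ζ ∈ descentSet i) : spread (height ζ) ∈ descentSet i :=
    ⟨spread_mem _, h.2⟩
  refine (joinedIn_descentSet_of_height_eq hζ (mem hζ) rfl).trans
    (JoinedIn.trans ?_ (joinedIn_descentSet_of_height_eq (mem hη) hη rfl))
  refine JoinedIn.of_segment_subset ?_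
  rintro _ ⟨s, t, hs, ht, hst, rfl⟩
  have e : s • spread (height ζ) + t • spread (height η) =
      spread (fun a ↦ s * height ζ a + t * height η a) := by
    ext a
    apply Complex.ext <;> simp [spread, ← add_mul, hst]
  rw [e]
  refine ⟨spread_mem _, ?_⟩
  change s * _ + t * _ < s * _ + t * _
  have h1 := hζ.2
  have h2 := hη.2
  rcases hs.eq_or_lt with rfl | hs
  · have : t = 1 := by linarith
    subst this; linarith
  · nlinarith [mul_lt_mul_of_pos_left h1 hs, mul_le_mul_of_nonneg_left h2.le ht]

/-- The homotopy class of a path, as a morphism of the fundamental groupoid. -/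
def pathHom {X : Type*} [TopologicalSpace X] {x y : X} (γ : Path x y) :
    FundamentalGroupoid.mk x ⟶ FundamentalGroupoid.mk y :=
  Path.Homotopic.Quotient.mk γ

lemma pathHom_subpath {X : Type*} [TopologicalSpace X] {x y : X} (γ : Path x y)
    (r s t : unitInterval) :
    pathHom (γ.subpath r s) ≫ pathHom (γ.subpath s t) = pathHom (γ.subpath r t) :=
  Path.Homotopic.Quotient.eq.mpr ⟨Path.Homotopy.subpathTransSubpath γ r s t⟩

section Thread

variable {U X : Type*} [TopologicalSpace U] [TopologicalSpace X] [SimplyConnectedSpace U]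

/-- The image in `X` of the unique homotopy class of paths in `U` from `u₀` to `u`. -/
noncomputable def thread (f : C(U, X)) (u₀ u : U) {x : X} (h : f u = x) :
    FundamentalGroupoid.mk (f u₀) ⟶ FundamentalGroupoid.mk x :=
  ((Path.Homotopic.Quotient.mk (PathConnectedSpace.somePath u₀ u)).map f).cast rfl h.symm

lemma thread_comp (f : C(U, X)) (u₀ : U) {u v : U} {x y : X} (hu : f u = x) (hv : f v = y)
    (Γ : Path u v) (γ : Path x y) (h : ∀ t, f (Γ t) = γ t) :
    thread f u₀ u hu ≫ pathHom γ = thread f u₀ v hv := by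
  subst hu hv
  have e : γ = Γ.map f.continuous := by ext t; exact (h t).symm
  subst e
  have : Path.Homotopic.Quotient.mk (PathConnectedSpace.somePath u₀ v) =
    (Path.Homotopic.Quotient.mk (PathConnectedSpace.somePath u₀ u)).trans (.mk Γ) :=
    Subsingleton.elim _ _
  change ((Path.Homotopic.Quotient.mk (PathConnectedSpace.somePath u₀ u)).map f).trans
    ((Path.Homotopic.Quotient.mk Γ).map f) =
    (Path.Homotopic.Quotient.mk (PathConnectedSpace.somePath u₀ v)).map f
  rw [this]; exact congrArg Path.Homotopic.Quotient.mk (Path.map_trans ..).symm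

lemma thread_self (f : C(U, X)) (u₀ : U) : thread f u₀ u₀ rfl = 𝟙 _ := by
  have : Path.Homotopic.Quotient.mk (PathConnectedSpace.somePath u₀ u₀) = .refl u₀ :=
    Subsingleton.elim _ _
  change (Path.Homotopic.Quotient.mk (PathConnectedSpace.somePath u₀ u₀)).map f = .refl _
  rw [this]; rfl

/-- The loop running to `u` along `U` and returning along `U` from another lift `v` of `f u`. -/
noncomputable def threadLoop (f : C(U, X)) (u₀ : U) {u v : U} (h : f u = f v) :
    FundamentalGroup X (f u₀) :=
  thread f u₀ u h ≫ inv (thread f u₀ v rfl)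

lemma threadLoop_eq (f : C(U, X)) (u₀ : U) {u v : U} {x : X} (hu : f u = x) (hv : f v = x) :
    threadLoop f u₀ (hu.trans hv.symm) = thread f u₀ u hu ≫ inv (thread f u₀ v hv) := by
  subst hv; rfl

lemma threadLoop_self (f : C(U, X)) (u₀ u : U) : threadLoop f u₀ (rfl : f u = f u) = 1 :=
  IsIso.hom_inv_id _

lemma threadLoop_mul (f : C(U, X)) (u₀ : U) {u v w : U} (h : f u = f v) (h' : f v = f w) :
    threadLoop f u₀ h' * threadLoop f u₀ h = threadLoop f u₀ (h.trans h') := by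
  change threadLoop f u₀ h ≫ threadLoop f u₀ h' = _
  rw [threadLoop_eq f u₀ (h.trans h') h', threadLoop_eq f u₀ h' rfl,
    threadLoop_eq f u₀ (h.trans h') rfl]
  simp

lemma threadLoop_congr (f : C(U, X)) (u₀ : U) {u v u' v' : U} (h : f u = f v) (h' : f u' = f v')
    (Γ : Path u u') (Δ : Path v v') (e : ∀ t, f (Γ t) = f (Δ t)) :
    threadLoop f u₀ h = threadLoop f u₀ h' := by
  have h1 := thread_comp f u₀ h h' Γ (Δ.map f.continuous) e
  have h2 := thread_comp f u₀ (rfl : f v = f v) (rfl : f v' = f v') Δ (Δ.map f.continuous)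
    fun _ ↦ rfl
  rw [threadLoop, threadLoop, ← cancel_mono (thread f u₀ v' rfl), Category.assoc, Category.assoc,
    IsIso.inv_hom_id, Category.comp_id, ← h1, ← h2, IsIso.inv_hom_id_assoc]

lemma thread_comp_cast (f : C(U, X)) (u₀ : U) {u v : U} {x y x' y' : X} (γ : Path x y)
    (ex : x' = x) (ey : y' = y) (hu : f u = x) (hu' : f u = x') (hv : f v = y) (hv' : f v = y') :
    thread f u₀ u hu' ≫ pathHom (γ.cast ex ey) ≫ inv (thread f u₀ v hv') =
      thread f u₀ u hu ≫ pathHom γ ≫ inv (thread f u₀ v hv) := by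
  subst ex ey; rfl

end Thread

/-- The configuration underlying a chart point. -/
def proj (n : ℕ) : C(chartSet n, UnorderedConfig n) where
  toFun ζ := Quotient.mk _ ⟨ζ.1, injective_of_mem_chartSet ζ.2⟩
  continuous_toFun := continuous_quotient_mk'.comp (continuous_subtype_val.subtype_mk _)

lemma proj_comp {ζ : Fin n → ℂ} (h : ζ ∈ chartSet n) {w : Equiv.Perm (Fin n)}
    (hw : ζ ∘ w ∈ chartSet n) : proj n ⟨ζ, h⟩ = proj n ⟨ζ ∘ w, hw⟩ :=
  Quotient.sound ⟨w, rfl⟩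

lemma exists_of_proj_eq {ζ η : chartSet n} (h : proj n ζ = proj n η) :
    ∃ w : Equiv.Perm (Fin n), ζ.1 ∘ w = η.1 :=
  Quotient.exact h

/-- The loop in configuration space that connects two orderings of the same configuration. -/
noncomputable def chartLoop (ζ : Fin n → ℂ) (w : Equiv.Perm (Fin n)) (h : ζ ∈ chartSet n)
    (hw : ζ ∘ w ∈ chartSet n) : FundamentalGroup (UnorderedConfig n) (proj n (base n)) :=
  threadLoop (proj n) (base n) (proj_comp h hw)

lemma chartLoop_mul {ζ : Fin n → ℂ} {w v : Equiv.Perm (Fin n)} (h : ζ ∈ chartSet n)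
    (hw : ζ ∘ w ∈ chartSet n) (hv : (ζ ∘ w) ∘ v ∈ chartSet n) :
    chartLoop (ζ ∘ w) v hw hv * chartLoop ζ w h hw = chartLoop ζ (w * v) h hv :=
  threadLoop_mul _ _ _ _

/-- The sample tuple with strictly decreasing heights. -/
noncomputable def falling (n : ℕ) : Fin n → ℂ := spread fun a ↦ -(a : ℕ)

lemma falling_comp_mem (w : Equiv.Perm (Fin n)) : falling n ∘ w ∈ chartSet n :=
  mem_chartSet_of_height_injective fun a b h ↦ w.injective (Fin.ext (by
    simpa [falling, spread, height] using h))

lemma falling_comp_mem_descentSet {w : Equiv.Perm (Fin n)} {i : Fin (n - 1)}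
    (h : w (lo i) < w (hi i)) : falling n ∘ w ∈ descentSet i :=
  ⟨falling_comp_mem w, by simpa [falling, spread, height] using h⟩

/-- The half twist exchanging two adjacent points. -/
noncomputable def halfTwist (i : Fin (n - 1)) :
    FundamentalGroup (UnorderedConfig n) (proj n (base n)) :=
  chartLoop (falling n) (adj i) (falling_comp_mem 1) (falling_comp_mem _)

lemma chartLoop_adj {ζ : Fin n → ℂ} {i : Fin (n - 1)} (h : ζ ∈ descentSet i)
    (h' : ζ ∘ adj i ∈ chartSet n) : chartLoop ζ (adj i) h.1 h' = halfTwist i := by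
  have hf : falling n ∈ descentSet i :=
    falling_comp_mem_descentSet (w := 1) (lo_lt_hi i)
  obtain ⟨γ, hγ⟩ := joinedIn_descentSet h hf
  let Γ : Path (⟨ζ, h.1⟩ : chartSet n) ⟨falling n, hf.1⟩ :=
    { toFun := fun t ↦ ⟨γ t, (hγ t).1⟩
      source' := by simp
      target' := by simp }
  let Δ : Path (⟨ζ ∘ adj i, h'⟩ : chartSet n) ⟨falling n ∘ adj i, falling_comp_mem _⟩ :=
    { toFun := fun t ↦ ⟨γ t ∘ adj i, comp_adj_mem (hγ t).1 (hγ t).2⟩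
      continuous_toFun := by fun_prop
      source' := by simp
      target' := by simp }
  exact threadLoop_congr _ _ _ _ Γ Δ fun t ↦ proj_comp _ _

lemma chartLoop_congr {ζ : Fin n → ℂ} {w v : Equiv.Perm (Fin n)} (e : w = v) (h : ζ ∈ chartSet n)
    (hw : ζ ∘ w ∈ chartSet n) (hv : ζ ∘ v ∈ chartSet n) :
    chartLoop ζ w h hw = chartLoop ζ v h hv := by
  subst e; rfl

lemma halfTwist_mul_chartLoop {w : Equiv.Perm (Fin n)} {i : Fin (n - 1)}
    (h : w (lo i) < w (hi i)) :
    halfTwist i * chartLoop (falling n) w (falling_comp_mem 1) (falling_comp_mem w) =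
      chartLoop (falling n) (w * adj i) (falling_comp_mem 1) (falling_comp_mem _) := by
  rw [← chartLoop_adj (falling_comp_mem_descentSet h) (falling_comp_mem (w * adj i))]
  exact chartLoop_mul _ _ _

lemma halfTwist_comm {i k : Fin (n - 1)} (h : (i : ℕ) + 2 ≤ k) :
    halfTwist i * halfTwist k = halfTwist k * halfTwist i := by
  have hk : adj k (lo i) < adj k (hi i) := by
    rw [adj_lo_of_lt (by omega), adj_hi_of_add_two_le h]; exact lo_lt_hi i
  have hi' : adj i (lo k) < adj i (hi k) := by
    rw [adj_lo_of_add_two_le h, adj_hi_of_lt (by omega)]; exact lo_lt_hi k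
  rw [halfTwist.eq_1 k, halfTwist_mul_chartLoop hk, ← halfTwist.eq_1 k, halfTwist.eq_1 i,
    halfTwist_mul_chartLoop hi']
  exact chartLoop_congr (Equiv.ext fun a ↦ (adj_comm h a).symm) _ _ _

lemma halfTwist_braid {i k : Fin (n - 1)} (h : (i : ℕ) + 1 = k) :
    halfTwist i * halfTwist k * halfTwist i = halfTwist k * halfTwist i * halfTwist k := by
  have hlt : (i : ℕ) < k := by omega
  have e := lo_eq_hi h
  have h1 : adj i (lo k) < adj i (hi k) := by
    rw [e, adj_hi, adj_hi_of_lt hlt]; exact (lo_lt_hi i).trans (e ▸ lo_lt_hi k)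
  have h2 : (adj i * adj k) (lo i) < (adj i * adj k) (hi i) := by
    rw [Equiv.Perm.mul_apply, Equiv.Perm.mul_apply, adj_lo_of_lt hlt, adj_lo, ← e, adj_lo,
      adj_hi_of_lt hlt]
    exact lo_lt_hi k
  have h3 : adj k (lo i) < adj k (hi i) := by
    rw [adj_lo_of_lt hlt, ← e, adj_lo]; exact (lo_lt_hi i).trans (e ▸ lo_lt_hi k)
  have h4 : (adj k * adj i) (lo k) < (adj k * adj i) (hi k) := by
    rw [Equiv.Perm.mul_apply, Equiv.Perm.mul_apply, e, adj_hi, adj_lo_of_lt hlt,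
      adj_hi_of_lt hlt, adj_hi, e]
    exact lo_lt_hi i
  have e1 := (congrArg (halfTwist i * ·) (halfTwist_mul_chartLoop h1)).trans
    (halfTwist_mul_chartLoop h2)
  have e2 := (congrArg (halfTwist k * ·) (halfTwist_mul_chartLoop h3)).trans
    (halfTwist_mul_chartLoop h4)
  rw [mul_assoc, mul_assoc]
  exact (e1.trans (chartLoop_congr (Equiv.ext fun a ↦ adj_braid h a) _ _ _)).trans e2.symm

variable (n) in
/-- The homomorphism sending the Artin generators to the half twists. -/
noncomputable def braidHom :
    BraidGroup n →* FundamentalGroup (UnorderedConfig n) (proj n (base n)) :=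
  PresentedGroup.toGroup (f := halfTwist) (by
    rintro r (⟨i, k, h, rfl⟩ | ⟨i, k, h, rfl⟩)
    · rw [map_mul, map_inv, mul_inv_eq_one, map_mul, map_mul, FreeGroup.lift_apply_of,
        FreeGroup.lift_apply_of, halfTwist_comm h]
    · rw [map_mul, map_inv, mul_inv_eq_one, map_mul, map_mul, map_mul, map_mul,
        FreeGroup.lift_apply_of, FreeGroup.lift_apply_of, halfTwist_braid h])

lemma braidHom_sigma (i : Fin (n - 1)) : braidHom n (sigma i) = halfTwist i :=
  PresentedGroup.toGroup.of _

lemma exists_sorted_chartLoop_mem : ∀ ζ ∈ chartSet n, ∃ u : Equiv.Perm (Fin n),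
    ∃ (h : ζ ∈ chartSet n) (hu : ζ ∘ u ∈ chartSet n), Monotone (height (ζ ∘ u)) ∧
      chartLoop ζ u h hu ∈ (braidHom n).range := by
  refine bubble_induction ?_ ?_
  · intro ζ hζ hm
    refine ⟨1, hζ, hζ, hm, ?_⟩
    have : chartLoop ζ 1 hζ hζ = 1 := threadLoop_self _ _ _
    rw [this]
    exact one_mem _
  · rintro ζ hζ i hlt - ⟨u, h, hu, hm, hr⟩
    refine ⟨adj i * u, hζ, hu, hm, ?_⟩
    rw [← chartLoop_mul hζ h hu]
    refine mul_mem hr ⟨sigma i, ?_⟩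
    rw [braidHom_sigma]
    exact (chartLoop_adj ⟨hζ, hlt⟩ h).symm

lemma threadLoop_mem_range {ζ η : chartSet n} (h : proj n ζ = proj n η) :
    threadLoop (proj n) (base n) h ∈ (braidHom n).range := by
  obtain ⟨ζ, hζ⟩ := ζ
  obtain ⟨η, hη⟩ := η
  obtain ⟨w, rfl⟩ := exists_of_proj_eq h
  obtain ⟨u, h1, hu, hum, hur⟩ := exists_sorted_chartLoop_mem _ hζ
  obtain ⟨v, h2, hv, hvm, hvr⟩ := exists_sorted_chartLoop_mem _ hη
  obtain rfl : u = w * v := sorted_unique (injective_of_mem_chartSet hζ) hu hum hv hvm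
  rw [← chartLoop_mul hζ hη hv] at hur
  exact (Subgroup.mul_mem_cancel_left _ hvr).mp hur

lemma isOpen_setOf_injective : IsOpen {z : Fin n → ℂ | Function.Injective z} := by
  have : {z : Fin n → ℂ | Function.Injective z} = ⋂ (a) (b) (_ : a ≠ b), {z | z a ≠ z b} := by
    ext z
    simp [Function.Injective, not_imp_not]
  rw [this]
  exact isOpen_iInter_of_finite fun a ↦ isOpen_iInter_of_finite fun b ↦
    isOpen_iInter_of_finite fun _ ↦ isOpen_ne_fun (by fun_prop) (by fun_prop)

instance : LocallyCompactSpace (OrderedConfig n) :=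
  IsOpen.locallyCompactSpace isOpen_setOf_injective

/-- The symmetric group acts on ordered configurations by permuting the points. -/
instance : MulAction (Equiv.Perm (Fin n)) (OrderedConfig n) where
  smul g z := ⟨z.1 ∘ ⇑g⁻¹, z.2.comp (Equiv.injective _)⟩
  one_smul z := rfl
  mul_smul g h z := Subtype.ext <| by
    change z.1 ∘ ⇑(g * h)⁻¹ = (z.1 ∘ ⇑h⁻¹) ∘ ⇑g⁻¹
    rw [mul_inv_rev]; rfl

instance : ContinuousConstSMul (Equiv.Perm (Fin n)) (OrderedConfig n) where
  continuous_const_smul g := by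
    refine Continuous.subtype_mk (f := fun z : OrderedConfig n ↦ z.1 ∘ ⇑g⁻¹) ?_ _
    exact continuous_pi fun a ↦ (continuous_apply (g⁻¹ a)).comp continuous_subtype_val

instance : ProperlyDiscontinuousSMul (Equiv.Perm (Fin n)) (OrderedConfig n) where
  finite_disjoint_inter_image _ _ := Set.toFinite _

instance : IsCancelSMul (Equiv.Perm (Fin n)) (OrderedConfig n) where
  right_cancel' _ _ z e := inv_injective <| Equiv.ext fun a ↦
    z.2 (congrFun (congrArg Subtype.val e) a)

lemma isCoveringMap_mk : IsCoveringMap (Quotient.mk _ : OrderedConfig n → UnorderedConfig n) := by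
  refine (isQuotientMap_quotient_mk'.isQuotientCoveringMap_of_properlyDiscontinuousSMul
    (G := Equiv.Perm (Fin n)) fun {z z'} ↦ ?_).isCoveringMap
  refine Quotient.eq.trans ⟨?_, ?_⟩
  · rintro ⟨w, hw⟩
    refine ⟨w, Subtype.ext ?_⟩
    change z'.1 ∘ ⇑w⁻¹ = z.1
    rw [← hw]
    ext a
    simp
  · rintro ⟨w, rfl⟩
    refine ⟨w, ?_⟩
    change (z'.1 ∘ ⇑w⁻¹) ∘ ⇑w = z'.1
    ext a
    simp

lemma exists_proj_eq (x : UnorderedConfig n) : ∃ ζ : chartSet n, proj n ζ = x := by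
  obtain ⟨z, rfl⟩ := Quotient.exists_rep x
  obtain ⟨w, hw, -⟩ := exists_sorted z.2
  exact ⟨⟨_, hw⟩, Quotient.sound ⟨w⁻¹, by ext a; simp⟩⟩

instance : PathConnectedSpace (UnorderedConfig n) where
  nonempty := ⟨proj n (base n)⟩
  joined x y := by
    obtain ⟨ζ, rfl⟩ := exists_proj_eq x
    obtain ⟨η, rfl⟩ := exists_proj_eq y
    exact ⟨(PathConnectedSpace.somePath ζ η).map (proj n).continuous⟩

lemma thread_comp_inv_mem_range {x : UnorderedConfig n} {ζ η : chartSet n} (hζ : proj n ζ = x)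
    (hη : proj n η = x) :
    (thread (proj n) (base n) ζ hζ ≫ inv (thread (proj n) (base n) η hη) :
      FundamentalGroup (UnorderedConfig n) (proj n (base n))) ∈ (braidHom n).range := by
  rw [← threadLoop_eq]
  exact threadLoop_mem_range _

lemma subpath_mem_range {γ : Path (proj n (base n)) (proj n (base n))}
    (Γ : C(unitInterval, OrderedConfig n)) (hΓ : ∀ t, (⟦Γ t⟧ : UnorderedConfig n) = γ t)
    {s t : unitInterval} {w : Equiv.Perm (Fin n)} (hst : s ≤ t)
    (hw : ∀ r ∈ Set.Icc s t, (Γ r).1 ∘ w ∈ chartSet n)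
    {ζ η : chartSet n} (hζ : proj n ζ = γ s) (hη : proj n η = γ t) :
    (thread (proj n) (base n) ζ hζ ≫
        pathHom (γ.subpath s t) ≫
        inv (thread (proj n) (base n) η hη) :
      FundamentalGroup (UnorderedConfig n) (proj n (base n))) ∈ (braidHom n).range := by
  have hmem (r) : (Γ (Set.Icc.convexComb s t r)).1 ∘ w ∈ chartSet n :=
    hw _ (by
      rw [← Set.uIcc_of_le hst, ← Path.range_subpathAux]; exact ⟨r, rfl⟩)
  have hp (r) (h : (Γ r).1 ∘ w ∈ chartSet n) : proj n ⟨_, h⟩ = γ r := by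
    rw [← hΓ]
    exact Quotient.sound ⟨w⁻¹, by ext a; simp⟩
  let Δ : Path (⟨_, hw s (Set.left_mem_Icc.mpr hst)⟩ : chartSet n)
      ⟨_, hw t (Set.right_mem_Icc.mpr hst)⟩ :=
    { toFun := fun r ↦ ⟨_, hmem r⟩
      continuous_toFun := by
        refine Continuous.subtype_mk (f := fun r ↦ (Γ (Set.Icc.convexComb s t r)).1 ∘ w) ?_ _
        have : Continuous fun r ↦ (Γ (Set.Icc.convexComb s t r)).1 :=
          continuous_subtype_val.comp (Γ.continuous.comp (by fun_prop))
        exact continuous_pi fun a ↦ (continuous_apply (w a)).comp this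
      source' := by simp
      target' := by simp }
  have key := thread_comp (proj n) (base n) (hp _ _) (hp _ _) Δ (γ.subpath s t) fun r ↦ hp _ _
  have h1 := thread_comp_inv_mem_range hζ (hp _ (hw s (Set.left_mem_Icc.mpr hst)))
  have h2 := thread_comp_inv_mem_range (hp _ (hw t (Set.right_mem_Icc.mpr hst))) hη
  have h3 := mul_mem h2 h1
  change (_ ≫ inv _) ≫ _ ≫ inv _ ∈ _ at h3
  rw [← key] at h3
  simpa using h3

lemma isOpen_comp_mem_chartSet (w : Equiv.Perm (Fin n)) :
    IsOpen {z : OrderedConfig n | z.1 ∘ w ∈ chartSet n} :=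
  isOpen_chartSet.preimage <|
    continuous_pi fun a ↦ (continuous_apply (w a)).comp continuous_subtype_val

lemma braidHom_surjective : Function.Surjective (braidHom n) := by
  intro p
  obtain ⟨γ, rfl⟩ := Path.Homotopic.Quotient.mk_surjective p
  obtain ⟨Γ, hΓ, -⟩ := isCoveringMap_mk.exists_path_lifts γ.toContinuousMap
    ⟨(base n).1, injective_of_mem_chartSet (base n).2⟩ γ.source
  replace hΓ (t) : (⟦Γ t⟧ : UnorderedConfig n) = γ t := congrFun hΓ t
  obtain ⟨t, t0, tmono, ⟨N, hN⟩, ht⟩ := exists_monotone_Icc_subset_open_cover_unitInterval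
    (c := fun w : Equiv.Perm (Fin n) ↦ {r | (Γ r).1 ∘ w ∈ chartSet n})
    (fun w ↦ (isOpen_comp_mem_chartSet w).preimage Γ.continuous) fun r _ ↦
      Set.mem_iUnion.mpr ((exists_sorted (Γ r).2).imp fun w h ↦ h.1)
  have key (k : ℕ) : ∀ ζ : chartSet n, ∀ hζ : proj n ζ = γ (t k),
      (thread (proj n) (base n) (base n) γ.source.symm ≫
        pathHom (γ.subpath 0 (t k)) ≫
        inv (thread (proj n) (base n) ζ hζ) :
      FundamentalGroup (UnorderedConfig n) (proj n (base n))) ∈ (braidHom n).range := by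
    induction k with
    | zero =>
      rw [t0, Path.subpath_self]
      intro ζ hζ
      have := thread_comp_inv_mem_range (γ.source.symm) hζ
      convert this using 2
      exact Category.id_comp _
    | succ k ih =>
      intro η hη
      obtain ⟨ζ, hζ⟩ := exists_proj_eq (γ (t k))
      obtain ⟨w, hw⟩ := ht k
      have h1 := subpath_mem_range Γ hΓ (tmono (Nat.le_succ k)) (fun r hr ↦ hw hr) hζ hη
      have h2 := mul_mem h1 (ih ζ hζ)
      change (_ ≫ _ ≫ inv _) ≫ _ ≫ _ ≫ inv _ ∈ _ at h2
      rw [← pathHom_subpath γ 0 (t k) (t (k + 1))]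
      simpa using h2
  have h := key N
  rw [hN N le_rfl] at h
  have := h (base n) γ.target.symm
  rw [Path.subpath_zero_one, thread_comp_cast _ _ γ γ.source γ.target rfl γ.source.symm rfl
    γ.target.symm, thread_self, IsIso.inv_id, Category.comp_id, Category.id_comp] at this
  exact this

section Lifts

variable {E X : Type*} [TopologicalSpace E] [TopologicalSpace X]

/-- The class `a` is the image under `Q` of a class of paths from `e` to `e'`. -/
def LiftsTo (Q : C(E, X)) {x y : X} (a : FundamentalGroupoid.mk x ⟶ FundamentalGroupoid.mk y)
    (e e' : E) : Prop :=
  ∃ (he : Q e = x) (he' : Q e' = y) (Γ : Path e e'),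
    a = pathHom ((Γ.map Q.continuous).cast he.symm he'.symm)

lemma LiftsTo.comp {Q : C(E, X)} {x y z : X} {a : FundamentalGroupoid.mk x ⟶ .mk y}
    {b : FundamentalGroupoid.mk y ⟶ .mk z} {e e' e'' : E} (ha : LiftsTo Q a e e')
    (hb : LiftsTo Q b e' e'') : LiftsTo Q (a ≫ b) e e'' := by
  obtain ⟨rfl, rfl, Γ, rfl⟩ := ha
  obtain ⟨-, rfl, Δ, rfl⟩ := hb
  refine ⟨rfl, rfl, Γ.trans Δ, ?_⟩
  rw [Path.map_trans]
  rfl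

lemma LiftsTo.inv {Q : C(E, X)} {x y : X} {a : FundamentalGroupoid.mk x ⟶ .mk y} {e e' : E}
    (ha : LiftsTo Q a e e') : LiftsTo Q (CategoryTheory.inv a) e' e := by
  obtain ⟨rfl, rfl, Γ, rfl⟩ := ha
  refine ⟨rfl, rfl, Γ.symm, ?_⟩
  rw [← Groupoid.inv_eq_inv]
  rfl

lemma liftsTo_id {Q : C(E, X)} {x : X} {e : E} (h : Q e = x) :
    LiftsTo Q (𝟙 (FundamentalGroupoid.mk x)) e e := by
  subst h
  exact ⟨rfl, rfl, Path.refl e, rfl⟩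

lemma liftsTo_thread {U : Type*} [TopologicalSpace U] [SimplyConnectedSpace U] {Q : C(E, X)}
    {f : C(U, X)} (κ : C(U, E)) (hκ : ∀ u, Q (κ u) = f u) (u₀ u : U) {x : X} (h : f u = x) :
    LiftsTo Q (thread f u₀ u h) (κ u₀) (κ u) :=
  ⟨hκ u₀, (hκ u).trans h, (PathConnectedSpace.somePath u₀ u).map κ.continuous,
    congrArg Path.Homotopic.Quotient.mk (by ext t; exact (hκ _).symm)⟩

lemma liftsTo_threadLoop {U : Type*} [TopologicalSpace U] [SimplyConnectedSpace U] {Q : C(E, X)}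
    {f : C(U, X)} (κ κ' : C(U, E)) (hκ : ∀ u, Q (κ u) = f u) (hκ' : ∀ u, Q (κ' u) = f u)
    (u₀ : U) {u v : U} (h : f u = f v) (e : κ u = κ' v) :
    LiftsTo Q (threadLoop f u₀ h) (κ u₀) (κ' u₀) :=
  (liftsTo_thread κ hκ u₀ u h).comp (e ▸ (liftsTo_thread κ' hκ' u₀ v rfl).inv)

/-- A null-homotopic loop only lifts to loops along a tower of two covering maps. -/
lemma eq_of_liftsTo_id {Y : Type*} [TopologicalSpace Y] {p : C(E, Y)} {q : C(Y, X)}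
    (hp : IsCoveringMap p) (hq : IsCoveringMap q) {x : X} {e e' : E}
    (h : LiftsTo (q.comp p) (𝟙 (FundamentalGroupoid.mk x)) e e') : e = e' := by
  obtain ⟨rfl, he', Γ, hΓ⟩ := h
  have h1 : p e = p e' := by
    have := hq.monodromy_eq_of_map_eq (γ := .refl (q (p e))) (ex := ⟨p e, rfl⟩)
      (ey := ⟨p e', he'⟩) (.mk (Γ.map p.continuous))
      (congrArg (fun c : Path.Homotopic.Quotient (q (p e)) (q (p e)) ↦ c.cast rfl he') hΓ.symm)
    rw [hq.monodromy_refl] at this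
    exact congrArg Subtype.val this
  have h2 : Path.Homotopic.Quotient.mk ((Γ.map p.continuous).cast rfl h1) = .refl (p e) := by
    refine hq.injective_path_homotopic_map _ _ ?_
    exact hΓ.symm
  have := hp.monodromy_eq_of_map_eq (γ := .refl (p e)) (ex := ⟨e, rfl⟩)
    (ey := ⟨e', h1.symm⟩) (.mk Γ)
    (congrArg (fun c : Path.Homotopic.Quotient (p e) (p e) ↦ c.cast rfl h1.symm) h2)
  rw [hp.monodromy_refl] at this
  exact congrArg Subtype.val this

end Lifts

instance : TopologicalSpace (BraidGroup n) := ⊥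

instance : DiscreteTopology (BraidGroup n) := ⟨rfl⟩

variable (n) in
/-- The universal cover of the ordered configuration space, as a bundle of braid groups whose
local trivializations are indexed by the orderings of the points. -/
noncomputable def sortCore :
    FiberBundleCore (Equiv.Perm (Fin n)) (OrderedConfig n) (BraidGroup n) where
  baseSet w := {z | z.1 ∘ w ∈ chartSet n}
  isOpen_baseSet := isOpen_comp_mem_chartSet
  indexAt z := (exists_sorted z.2).choose
  mem_baseSet_at z := (exists_sorted z.2).choose_spec.1
  coordChange w v z g := transition z.1 w v * g
  coordChange_self w z _ g := by simp [transition]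
  continuousOn_coordChange w v := by
    rintro ⟨z, g⟩ ⟨⟨hw, hv⟩, -⟩
    refine ContinuousAt.continuousWithinAt ?_
    rw [continuousAt_prod_of_discrete_right]
    refine (continuousAt_const (y := transition z.1 w v * g)).congr ?_
    filter_upwards [continuous_subtype_val.continuousAt.eventually
      (transition_locally_constant z.2 hw hv)] with z' hz'
    rw [hz']
  coordChange_comp w v u z _ g := by simp [transition, mul_assoc]

lemma comp_inv_comp (ζ : Fin n → ℂ) (w : Equiv.Perm (Fin n)) : (ζ ∘ ⇑w⁻¹) ∘ ⇑w = ζ := by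
  ext a
  simp

/-- The copy of the chart in the universal cover determined by an ordering and a braid. -/
noncomputable def sheet (w : Equiv.Perm (Fin n)) (g : BraidGroup n) :
    C(chartSet n, (sortCore n).TotalSpace) where
  toFun ζ := ((sortCore n).localTriv w).toOpenPartialHomeomorph.symm
    (⟨ζ.1 ∘ ⇑w⁻¹, (injective_of_mem_chartSet ζ.2).comp (Equiv.injective _)⟩, g)
  continuous_toFun := by
    refine ((sortCore n).localTriv w).toOpenPartialHomeomorph.continuousOn_symm.comp_continuous
      ?_ fun ζ ↦ ?_
    · refine Continuous.prodMk (Continuous.subtype_mk ?_ _) continuous_const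
      exact continuous_pi fun a ↦ (continuous_apply (w⁻¹ a)).comp continuous_subtype_val
    · refine ((sortCore n).mem_localTriv_target _ _).mpr ?_
      change (ζ.1 ∘ ⇑w⁻¹) ∘ ⇑w ∈ chartSet n
      rw [comp_inv_comp]
      exact ζ.2

lemma sortBraid_mul_of_sheet_eq {ζ η : chartSet n} {w v : Equiv.Perm (Fin n)}
    {g h : BraidGroup n} (e : sheet w g ζ = sheet v h η) :
    sortBraid (height ζ.1) * g = sortBraid (height η.1) * h := by
  have h1 : (⟨ζ.1 ∘ ⇑w⁻¹, _⟩ : OrderedConfig n) = ⟨η.1 ∘ ⇑v⁻¹, _⟩ :=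
    congrArg Bundle.TotalSpace.proj e
  have h2 : transition (ζ.1 ∘ ⇑w⁻¹) w ((sortCore n).indexAt ⟨ζ.1 ∘ ⇑w⁻¹, _⟩) * g =
      transition (η.1 ∘ ⇑v⁻¹) v ((sortCore n).indexAt ⟨η.1 ∘ ⇑v⁻¹, _⟩) * h :=
    congrArg (fun p : (sortCore n).TotalSpace ↦ (p.2 : BraidGroup n)) e
  have h3 : ζ.1 ∘ ⇑w⁻¹ = η.1 ∘ ⇑v⁻¹ := congrArg Subtype.val h1
  rw [← h1, transition, transition, comp_inv_comp, comp_inv_comp, ← h3, mul_assoc, mul_assoc] at h2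
  exact mul_left_cancel h2

lemma sheet_adj {ζ : Fin n → ℂ} {i : Fin (n - 1)} (hζ : ζ ∈ descentSet i)
    (w : Equiv.Perm (Fin n)) (g : BraidGroup n) :
    sheet w g ⟨ζ, hζ.1⟩ =
      sheet (w * adj i) (sigma i * g) ⟨ζ ∘ adj i, comp_adj_mem hζ.1 hζ.2⟩ := by
  have h1 : (ζ ∘ ⇑(adj i)) ∘ ⇑(w * adj i)⁻¹ = ζ ∘ ⇑w⁻¹ := by
    ext a
    simp [mul_inv_rev]
  have h2 (u : Equiv.Perm (Fin n)) : transition (ζ ∘ ⇑w⁻¹) w u * g =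
      transition ((ζ ∘ ⇑(adj i)) ∘ ⇑(w * adj i)⁻¹) (w * adj i) u * (sigma i * g) := by
    rw [transition, transition, comp_inv_comp, comp_inv_comp, h1, height_comp ζ (adj i),
      sortBraid_eq_mul hζ.2]
    group
  have h3 : (⟨ζ ∘ ⇑w⁻¹, (injective_of_mem_chartSet hζ.1).comp (Equiv.injective _)⟩ :
      OrderedConfig n) = ⟨(ζ ∘ ⇑(adj i)) ∘ ⇑(w * adj i)⁻¹,
        ((injective_of_mem_chartSet hζ.1).comp (Equiv.injective _)).comp (Equiv.injective _)⟩ :=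
    Subtype.ext h1.symm
  refine Bundle.TotalSpace.ext h3 (heq_of_eq ?_)
  change transition (ζ ∘ ⇑w⁻¹) w _ * g = transition ((ζ ∘ ⇑(adj i)) ∘ ⇑(w * adj i)⁻¹) _ _ * _
  rw [h2, h3]

variable (n) in
/-- The projection of the universal cover to ordered configurations. -/
noncomputable def coverProj : C((sortCore n).TotalSpace, OrderedConfig n) :=
  ⟨(sortCore n).proj, (sortCore n).continuous_proj⟩

variable (n) in
/-- The quotient map from ordered to unordered configurations. -/
noncomputable def quotProj : C(OrderedConfig n, UnorderedConfig n) :=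
  ⟨Quotient.mk _, continuous_quotient_mk'⟩

lemma quotProj_sheet (w : Equiv.Perm (Fin n)) (g : BraidGroup n) (ζ : chartSet n) :
    (quotProj n).comp (coverProj n) (sheet w g ζ) = proj n ζ :=
  Quotient.sound ⟨w, comp_inv_comp _ _⟩

lemma liftsTo_halfTwist (i : Fin (n - 1)) (w : Equiv.Perm (Fin n)) (g : BraidGroup n) :
    LiftsTo ((quotProj n).comp (coverProj n)) (halfTwist i) (sheet w g (base n))
      (sheet (w * adj i) (sigma i * g) (base n)) :=
  liftsTo_threadLoop _ _ (quotProj_sheet _ _) (quotProj_sheet _ _) _ _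
    (sheet_adj (falling_comp_mem_descentSet (w := 1) (lo_lt_hi i)) w g)

lemma exists_liftsTo_braidHom (b : BraidGroup n) : ∃ π : Equiv.Perm (Fin n),
    ∀ (w : Equiv.Perm (Fin n)) (g : BraidGroup n),
      LiftsTo ((quotProj n).comp (coverProj n)) (braidHom n b) (sheet w g (base n))
        (sheet (w * π) (b * g) (base n)) := by
  have hb : b ∈ Subgroup.closure (Set.range (PresentedGroup.of (rels := braidRels n))) := by
    rw [PresentedGroup.closure_range_of]; trivial
  induction hb using Subgroup.closure_induction with
  | mem b hb =>
    obtain ⟨i, rfl⟩ := hb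
    exact ⟨adj i, fun w g ↦ (braidHom_sigma i).symm ▸ liftsTo_halfTwist i w g⟩
  | one =>
    refine ⟨1, fun w g ↦ ?_⟩
    rw [map_one, mul_one, one_mul]
    exact liftsTo_id (quotProj_sheet _ _ _)
  | mul b c _ _ hb hc =>
    obtain ⟨π, hπ⟩ := hb
    obtain ⟨ρ, hρ⟩ := hc
    refine ⟨ρ * π, fun w g ↦ ?_⟩
    rw [map_mul, mul_assoc b, ← mul_assoc w]
    exact (hρ w g).comp (hπ _ _)
  | inv b _ hb =>
    obtain ⟨π, hπ⟩ := hb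
    refine ⟨π⁻¹, fun w g ↦ ?_⟩
    have := (hπ (w * π⁻¹) (b⁻¹ * g)).inv
    rw [inv_mul_cancel_right, mul_inv_cancel_left] at this
    rw [map_inv]
    convert this using 1
    exact Groupoid.inv_eq_inv _

lemma isCoveringMap_coverProj : IsCoveringMap (coverProj n) :=
  FiberBundle.isCoveringMap (F := BraidGroup n) (E := (sortCore n).Fiber)

lemma braidHom_injective : Function.Injective (braidHom n) := by
  refine (injective_iff_map_eq_one _).mpr fun b hb ↦ ?_
  obtain ⟨π, hπ⟩ := exists_liftsTo_braidHom b
  have h := hπ 1 1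
  rw [hb] at h
  have h' := sortBraid_mul_of_sheet_eq
    (eq_of_liftsTo_id isCoveringMap_coverProj isCoveringMap_mk h)
  simpa using h'.symm

end BraidConfig

/-- The fundamental group of the unordered configuration space of `n` points in the
complex plane, at any basepoint, is isomorphic to the braid group `Bₙ` given by
Artin's classical presentation. -/
theorem fundamentalGroup_config_iso_braidGroup (n : ℕ) (hn : 1 ≤ n)
    (x : UnorderedConfig n) :
    Nonempty (FundamentalGroup (UnorderedConfig n) x ≃* BraidGroup n) := by
  have e := MulEquiv.ofBijective (BraidConfig.braidHom n)
    ⟨BraidConfig.braidHom_injective, BraidConfig.braidHom_surjective⟩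
  exact ⟨(FundamentalGroup.fundamentalGroupMulEquivOfPathConnected _ _).trans e.symm⟩
end
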